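/- arXiv:2311.05751 — 5 statements merged into one kernel-verified Lean document; each statement's English description precedes it below -/
import Mathlib

section
/- The Stone space of the measure algebra 𝔹 = Bor(2^ω)/𝒩 contains a weak P-point. -/
open MeasureTheory Topology ENNReal NNReal

/-- A *Radon measure* on a topological space: a σ-additive Borel probability measure which is
inner regular with respect to compact sets and outer regular with respect to open sets. -/
def IsRadon {X : Type*} [TopologicalSpace X] [MeasurableSpace X] (μ : Measure X) : Prop :=
  IsProbabilityMeasure μ ∧ μ.InnerRegularWRT IsCompact MeasurableSet ∧ μ.OuterRegular

/-- A point `x` *avoids measures* if for every Radon measure `μ` with `μ {x} = 0` there is an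
open neighbourhood of `x` of measure zero. -/
def AvoidsMeasures {X : Type*} [TopologicalSpace X] [MeasurableSpace X] (x : X) : Prop :=
  ∀ μ : Measure X, IsRadon μ → μ {x} = 0 → ∃ U : Set X, IsOpen U ∧ x ∈ U ∧ μ U = 0

/-- A point `x` is a *μ-point* if it avoids all non-atomic Radon measures. -/
def IsMuPoint {X : Type*} [TopologicalSpace X] [MeasurableSpace X] (x : X) : Prop :=
  ∀ μ : Measure X, IsRadon μ → (∀ y : X, μ {y} = 0) →
    ∃ U : Set X, IsOpen U ∧ x ∈ U ∧ μ U = 0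

/-- A point `p` is a *weak P-point* if it is not in the closure of any countable subset of
`X \ {p}`. -/
def IsWeakPPoint {X : Type*} [TopologicalSpace X] (p : X) : Prop :=
  ∀ C : Set X, C.Countable → p ∉ C → p ∉ closure C

/-- The basic clopen cylinder `[v] ⊆ 2^ω` determined by a finite 0-1 sequence `v`. -/
def Cyl (v : List Bool) : Set (ℕ → Bool) := {x | ∀ i : Fin v.length, x i.val = v.get i}

/-- The Stone space of the measure algebra `𝔹 = Bor(2^ω)/𝒩`, realized as the space of Boolean
homomorphisms from the algebra of Borel subsets of `2^ω` to `Bool` which vanish on `lam`-null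
sets (such homomorphisms correspond exactly to ultrafilters on the quotient `Bor(2^ω)/𝒩`),
with the topology inherited from the product `2^{Bor(2^ω)}`, i.e. the Stone topology. -/
def MeasureAlgebraStone (lam : Measure (ℕ → Bool)) : Type :=
  {f : {s : Set (ℕ → Bool) // MeasurableSet s} → Bool //
    f ⟨Set.univ, MeasurableSet.univ⟩ = true ∧
    (∀ s t : {s : Set (ℕ → Bool) // MeasurableSet s},
      f ⟨s.1 ∪ t.1, s.2.union t.2⟩ = (f s || f t)) ∧
    (∀ s : {s : Set (ℕ → Bool) // MeasurableSet s}, f ⟨s.1ᶜ, s.2.compl⟩ = !(f s)) ∧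
    (∀ s : {s : Set (ℕ → Bool) // MeasurableSet s}, lam s.1 = 0 → f s = false)}

instance (lam : Measure (ℕ → Bool)) : TopologicalSpace (MeasureAlgebraStone lam) := by
  unfold MeasureAlgebraStone; infer_instance


namespace WPP

open Filter Set

/-- Points of the Cantor space. -/
abbrev Om := ℕ → Bool

/-- Restriction to the first `k` coordinates. -/
def res (k : ℕ) (X : Om) : Fin k → Bool := fun i => X i

/-- The countable set carrying the independent linked family. -/
abbrev S := Σ k : ℕ, ((Fin k → Bool) → Finset (Fin k → Bool))

/-- The null ideal. -/
def N (ν : S → Measure Om) (B : Set Om) : Prop :=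
  Tendsto (fun s => ν s B) cofinite (𝓝 0)

lemma N.mono {ν : S → Measure Om} {B B' : Set Om} (h : N ν B') (hs : B ⊆ B') : N ν B :=
  tendsto_of_tendsto_of_tendsto_of_le_of_le tendsto_const_nhds h (fun _ => zero_le)
    (fun _ => measure_mono hs)

lemma N.union {ν : S → Measure Om} {B B' : Set Om} (h : N ν B) (h' : N ν B') : N ν (B ∪ B') := by
  have := Tendsto.add h h'
  rw [add_zero] at this
  exact tendsto_of_tendsto_of_tendsto_of_le_of_le tendsto_const_nhds this (fun _ => zero_le)
    (fun s => measure_union_le _ _)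

/-- Selection from the independent linked family. -/
def Sel (π : Om → S) (τ : Set Om) (σ : Om → Finset Om) : Set Om :=
  {x | ∀ Y ∈ τ, (π x).2 (res (π x).1 Y) = (σ Y).image (res (π x).1)}

/-- The sets added for a row `Y` and a sequence `U`. -/
def D (π : Om → S) (U : ℕ → Set Om) (Y X : Om) : Set Om :=
  {x | res (π x).1 X ∈ (π x).2 (res (π x).1 Y) ∧ x ∈ U ((π x).2 (res (π x).1 Y)).card}

lemma D_measurable {π : Om → S} (hπ : ∀ s, MeasurableSet (π ⁻¹' {s})) {U : ℕ → Set Om}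
    (hU : ∀ n, MeasurableSet (U n)) (Y X : Om) : MeasurableSet (D π U Y X) := by
  have : D π U Y X = ⋃ s ∈ {s : S | res s.1 X ∈ s.2 (res s.1 Y)},
      (π ⁻¹' {s} ∩ U (s.2 (res s.1 Y)).card) := by
    ext x
    simp only [D, mem_ofPred_eq, mem_iUnion, mem_inter_iff, mem_preimage, mem_singleton_iff,
      exists_prop]
    constructor
    · intro h
      exact ⟨π x, h.1, rfl, h.2⟩
    · rintro ⟨s, h1, rfl, h2⟩
      exact ⟨h1, h2⟩
  rw [this]
  exact MeasurableSet.biUnion (Set.to_countable _) fun s _ => (hπ s).inter (hU _)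

def Good (ν : S → Measure Om) (π : Om → S) (G : Set (Set Om)) (R : Set Om) : Prop :=
  ∀ g ⊆ G, g.Finite → ∀ τ : Set Om, τ.Finite → Disjoint τ R → ∀ σ : Om → Finset Om,
    ¬ N ν (⋂₀ g ∩ Sel π τ σ)

def Done (ν : S → Measure Om) (G : Set (Set Om)) (U : ℕ → Set Om) : Prop :=
  (∃ n, ∃ g ⊆ G, g.Finite ∧ N ν (⋂₀ g ∩ U n)) ∨
  ((∀ n, U n ∈ G) ∧ ∃ V : Om → Set Om, (∀ X, MeasurableSet (V X)) ∧ (∀ X, V X ∈ G) ∧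
    ∀ σ : Finset Om, σ.Nonempty → N ν ((⋂ X ∈ σ, V X) \ U σ.card))

lemma Done.mono {ν : S → Measure Om} {G G' : Set (Set Om)} {U : ℕ → Set Om} (h : Done ν G U)
    (hG : G ⊆ G') : Done ν G' U := by
  rcases h with ⟨n, g, hg, hf, hN⟩ | ⟨h1, V, h2, h3, h4⟩
  · exact Or.inl ⟨n, g, hg.trans hG, hf, hN⟩
  · exact Or.inr ⟨fun n => hG (h1 n), V, h2, fun X => hG (h3 X), h4⟩

lemma finite_lt (k : ℕ) : {s : S | s.1 < k}.Finite := by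
  have : {s : S | s.1 < k} ⊆ range (fun p : Σ i : Fin k, ((Fin i → Bool) → Finset (Fin i → Bool)) =>
      (⟨p.1, p.2⟩ : S)) := by
    rintro ⟨i, f⟩ h
    exact ⟨⟨⟨i, h⟩, f⟩, rfl⟩
  exact (Set.finite_range _).subset this

lemma res_inj_pair {X Y : Om} (h : X ≠ Y) : ∃ k, ∀ m, k ≤ m → res m X ≠ res m Y := by
  obtain ⟨i, hi⟩ := Function.ne_iff.1 h
  refine ⟨i + 1, fun m hm he => hi ?_⟩
  exact congrFun he ⟨i, by omega⟩

lemma res_inj {τ : Set Om} (h : τ.Finite) : ∃ k, ∀ m, k ≤ m → InjOn (res m) τ := by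
  have h2 : ∀ᶠ m in (atTop : Filter ℕ), ∀ p ∈ τ ×ˢ τ, p.1 ≠ p.2 → res m p.1 ≠ res m p.2 := by
    rw [Filter.eventually_all_finite (h.prod h)]
    intro p _
    by_cases hp : p.1 = p.2
    · simp [hp]
    · obtain ⟨k, hk⟩ := res_inj_pair hp
      filter_upwards [eventually_ge_atTop k] with m hm _ using hk m hm
  obtain ⟨k, hk⟩ := eventually_atTop.1 h2
  refine ⟨k, fun m hm X hX Y hY he => ?_⟩
  by_contra hne
  exact hk m hm (X, Y) ⟨hX, hY⟩ hne he

lemma not_N_of_infinite {ν : S → Measure Om} {π : Om → S} (hν : ∀ s, ν s (π ⁻¹' {s}) = 1)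
    {B : Set Om} (h : ∀ k, ∃ s : S, k ≤ s.1 ∧ π ⁻¹' {s} ⊆ B) : ¬ N ν B := by
  intro hN
  have h1 : ∀ᶠ s in cofinite, ν s B < 1 := hN.eventually (gt_mem_nhds one_pos)
  have h2 : {s : S | ¬ ν s B < 1}.Finite := h1
  obtain ⟨k, hk⟩ := (h2.image Sigma.fst).bddAbove
  obtain ⟨s, hs, hsB⟩ := h (k + 1)
  have : s ∈ {s : S | ¬ ν s B < 1} := by
    simp only [mem_ofPred_eq, not_lt]
    rw [← hν s]
    exact measure_mono hsB
  have := hk (mem_image_of_mem _ this)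
  omega

lemma N_of_eventually {ν : S → Measure Om} {π : Om → S} (hν : ∀ s, ν s (π ⁻¹' {s})ᶜ = 0)
    {B : Set Om} (k : ℕ) (h : ∀ x ∈ B, (π x).1 < k) : N ν B := by
  have : (fun s => ν s B) =ᶠ[cofinite] fun _ => 0 := by
    have : ∀ᶠ s : S in cofinite, ¬ s.1 < k := by
      have := finite_lt k
      simpa [Filter.eventually_cofinite] using this
    filter_upwards [this] with s hs
    refine measure_mono_null ?_ (hν s)
    intro x hx hxs
    have : π x = s := hxs
    exact hs (this ▸ h x hx)
  exact Tendsto.congr' this.symm tendsto_const_nhds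

lemma good_base {ν : S → Measure Om} {π : Om → S} (hν : ∀ s, ν s (π ⁻¹' {s}) = 1) :
    Good ν π ∅ ∅ := by
  classical
  intro g hg _ τ hτ _ σ
  have : g = ∅ := subset_empty_iff.1 hg
  subst this
  apply not_N_of_infinite hν
  intro k
  obtain ⟨k', hk'⟩ := res_inj hτ
  let m := max k k'
  have hinj := hk' m (le_max_right _ _)
  refine ⟨⟨m, fun y => if h : ∃ Y ∈ τ, res m Y = y then (σ h.choose).image (res m) else ∅⟩,
    le_max_left _ _, ?_⟩
  intro x hx
  have hx : π x = _ := hx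
  refine ⟨by simp, ?_⟩
  intro Y hY
  rw [hx]
  have h : ∃ Y' ∈ τ, res m Y' = res m Y := ⟨Y, hY, rfl⟩
  have h2 : h.choose = Y := hinj h.choose_spec.1 hY h.choose_spec.2
  simp only [dif_pos h, h2]

lemma linked {ν : S → Measure Om} {π : Om → S} (hν : ∀ s, ν s (π ⁻¹' {s})ᶜ = 0)
    {U : ℕ → Set Om} (hU : Antitone U) (Y : Om) (σ : Finset Om)
    (hσ : σ.Nonempty) : N ν ((⋂ X ∈ σ, D π U Y X) \ U σ.card) := by
  classical
  obtain ⟨X0, hX0⟩ := hσ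
  obtain ⟨k, hk⟩ := res_inj σ.finite_toSet
  apply N_of_eventually hν k
  rintro x ⟨hx, hxU⟩
  by_contra hlt
  have hinj := hk (π x).1 (not_lt.1 hlt)
  simp only [mem_iInter] at hx
  have h1 : σ.image (res (π x).1) ⊆ (π x).2 (res (π x).1 Y) := by
    intro y hy
    obtain ⟨X, hX, rfl⟩ := Finset.mem_image.1 hy
    exact (hx X hX).1
  have h2 := Finset.card_le_card h1
  rw [Finset.card_image_of_injOn hinj] at h2
  exact hxU (hU h2 (hx X0 hX0).2)

lemma step {ν : S → Measure Om} {π : Om → S} (hν : ∀ s, ν s (π ⁻¹' {s})ᶜ = 0)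
    (hπ : ∀ s, MeasurableSet (π ⁻¹' {s})) {G : Set (Set Om)} {R : Set Om}
    (hG : Good ν π G R) (hR : R ≠ univ) {U : ℕ → Set Om} (hU : Antitone U)
    (hUm : ∀ n, MeasurableSet (U n)) :
    ∃ (H : Set (Set Om)) (τ : Set Om), τ.Finite ∧ Good ν π (G ∪ H) (R ∪ τ) ∧
      Done ν (G ∪ H) U := by
  classical
  by_cases h1 : Good ν π (G ∪ range U) R
  · obtain ⟨Y, hY⟩ := (Set.ne_univ_iff_exists_notMem R).1 hR
    refine ⟨range U ∪ range (D π U Y), {Y}, finite_singleton _, ?_, Or.inr ⟨?_, D π U Y,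
      D_measurable hπ hUm Y, ?_, linked hν hU Y⟩⟩
    · intro g hg hgf τ hτ hd σ hN
      obtain ⟨t, -, htf, ht⟩ := Set.Finite.exists_subset_finite_image_eq (s := univ)
        (hgf.inter_of_left (range (D π U Y))) (by rw [image_univ]; exact inter_subset_right)
      lift t to Finset Om using htf
      rw [disjoint_union_right] at hd
      have hYτ : Y ∉ τ := fun h => Set.disjoint_left.1 hd.2 h rfl
      refine h1 ((g ∩ (G ∪ range U)) ∪ {U t.card}) ?_ ?_ (insert Y τ) (hτ.insert _) ?_
        (fun Y' => if Y' = Y then t else σ Y') (hN.mono ?_)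
      · apply union_subset inter_subset_right
        rw [singleton_subset_iff]
        exact Or.inr ⟨_, rfl⟩
      · exact (hgf.inter_of_left _).union (finite_singleton _)
      · exact disjoint_insert_left.2 ⟨hY, hd.1⟩
      · rintro x ⟨hx1, hx2⟩
        refine ⟨?_, ?_⟩
        · intro s hs
          by_cases hsD : s ∈ range (D π U Y)
          · have hst : s ∈ D π U Y '' t := by rw [ht]; exact ⟨hs, hsD⟩
            obtain ⟨X, hX, rfl⟩ := hst
            have h := hx2 Y (mem_insert _ _)
            simp only [if_true] at h
            refine ⟨?_, ?_⟩
            · rw [h]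
              exact Finset.mem_image_of_mem _ hX
            · rw [h]
              exact hU Finset.card_image_le (hx1 _ (Or.inr rfl))
          · refine hx1 s (Or.inl ⟨hs, ?_⟩)
            rcases hg hs with h | h | h
            · exact Or.inl h
            · exact Or.inr h
            · exact absurd h hsD
        · intro Y' hY'
          have h := hx2 Y' (mem_insert_of_mem _ hY')
          have hne : Y' ≠ Y := fun h => hYτ (h ▸ hY')
          simpa [hne] using h
    · intro n; right; left; exact ⟨n, rfl⟩
    · intro X; right; right; exact ⟨X, rfl⟩
  · unfold Good at h1
    push Not at h1
    obtain ⟨g, hg, hgf, τ, hτ, hd, σ, hN⟩ := h1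
    have hn : ∃ n, ∀ s ∈ g ∩ range U, U n ⊆ s := by
      have : ∀ᶠ n in atTop, ∀ s ∈ g ∩ range U, U n ⊆ s := by
        rw [Filter.eventually_all_finite (hgf.inter_of_left _)]
        rintro s ⟨_, m, rfl⟩
        filter_upwards [eventually_ge_atTop m] with n hn using hU hn
      exact this.exists
    obtain ⟨n, hn⟩ := hn
    refine ⟨{Sel π τ σ}, τ, hτ, ?_, Or.inl ⟨n, (g ∩ G) ∪ {Sel π τ σ}, ?_, ?_, ?_⟩⟩
    · intro g' hg' hgf' τ' hτ' hd' σ' hN'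
      rw [disjoint_union_right] at hd'
      refine hG (g' ∩ G) inter_subset_right (hgf'.inter_of_left _) (τ ∪ τ') (hτ.union hτ')
        (disjoint_union_left.2 ⟨hd, hd'.1⟩) (fun Y => if Y ∈ τ then σ Y else σ' Y) (hN'.mono ?_)
      rintro x ⟨hx1, hx2⟩
      refine ⟨?_, ?_⟩
      · intro s hs
        rcases hg' hs with h | h
        · exact hx1 s ⟨hs, h⟩
        · rw [mem_singleton_iff.1 h]
          intro Y hY
          have := hx2 Y (Or.inl hY)
          simpa [hY] using this
      · intro Y hY
        have := hx2 Y (Or.inr hY)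
        have hY' : Y ∉ τ := fun h => Set.disjoint_left.1 hd'.2 hY h
        simpa [hY'] using this
    · exact union_subset_union_left _ inter_subset_right
    · exact (hgf.inter_of_left _).union (finite_singleton _)
    · refine hN.mono ?_
      rintro x ⟨hx1, hx2⟩
      refine ⟨?_, hx1 _ (Or.inr rfl)⟩
      intro s hs
      rcases hg hs with h | h
      · exact hx1 s (Or.inl ⟨hs, h⟩)
      · exact hn s ⟨hs, h⟩ hx2

/-- The tasks. -/
def Task : Type := {U : ℕ → Set Om // Antitone U ∧ ∀ n, MeasurableSet (U n)}

lemma card_borel : Cardinal.mk {s : Set Om // MeasurableSet s} ≤ Cardinal.continuum := by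
  obtain ⟨b, hb, he⟩ := MeasurableSpace.CountablyGenerated.isCountablyGenerated (α := Om)
  have := MeasurableSpace.cardinal_measurableSet_le_continuum
    (hb.le_aleph0.trans Cardinal.aleph0_le_continuum)
  rw [← he] at this
  exact this

lemma card_T : Cardinal.mk Task ≤ Cardinal.continuum := by
  have h1 : Cardinal.mk Task ≤ Cardinal.mk (ℕ → {s : Set Om // MeasurableSet s}) := by
    refine Cardinal.mk_le_of_injective (f := fun U n => ⟨U.1 n, U.2.2 n⟩) ?_
    intro U U' h
    apply Subtype.ext
    funext n
    exact congrArg Subtype.val (congrFun h n)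
  refine h1.trans ?_
  rw [← Cardinal.power_def, Cardinal.mk_nat]
  calc _ ≤ Cardinal.continuum ^ Cardinal.aleph0 := Cardinal.power_le_power_right card_borel
    _ = _ := Cardinal.continuum_power_aleph0

lemma mk_Om : Cardinal.mk Om = Cardinal.continuum := by
  simp [Om]

/-- The transfinite construction. -/
lemma construct {ν : S → Measure Om} {π : Om → S} (hν0 : ∀ s, ν s (π ⁻¹' {s})ᶜ = 0)
    (hν : ∀ s, ν s (π ⁻¹' {s}) = 1)
    (hπ : ∀ s, MeasurableSet (π ⁻¹' {s})) :
    ∃ G : Set (Set Om), (∀ g ⊆ G, g.Finite → ¬ N ν (⋂₀ g)) ∧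
      ∀ U : ℕ → Set Om, Antitone U → (∀ n, MeasurableSet (U n)) → Done ν G U := by
  classical
  obtain ⟨lo, wf, hr⟩ := Cardinal.exists_ord_eq_type_lt Task
  let P : (t : Task) → ((s : Task) → s < t → Set (Set Om) × {τ : Set Om // τ.Finite}) →
      Set (Set Om) × {τ : Set Om // τ.Finite} → Prop := fun t h a =>
    Good ν π ((⋃ s, ⋃ hs : s < t, (h s hs).1) ∪ a.1) ((⋃ s, ⋃ hs : s < t, (h s hs).2.1) ∪ a.2.1) ∧
      Done ν ((⋃ s, ⋃ hs : s < t, (h s hs).1) ∪ a.1) t.1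
  let H : Task → Set (Set Om) × {τ : Set Om // τ.Finite} :=
    wf.wf.fix (fun t h => if hh : ∃ a, P t h a then hh.choose else ⟨∅, ∅, finite_empty⟩)
  have hH : ∀ t, (∃ a, P t (fun s _ => H s) a) → P t (fun s _ => H s) (H t) := by
    intro t ht
    have : H t = ht.choose := by
      show wf.wf.fix _ t = _
      rw [WellFounded.fix_eq]
      exact dif_pos ht
    rw [this]
    exact ht.choose_spec
  -- directed unions
  have dir : ∀ (Q : Set Task), (∀ t ∈ Q, ∀ s, s < t → s ∈ Q) → (∀ t ∈ Q, P t (fun s _ => H s) (H t)) →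
      Good ν π (⋃ t ∈ Q, (H t).1) (⋃ t ∈ Q, (H t).2.1) := by
    intro Q hdn hQ g hg hgf τ hτ hd σ
    rcases g.eq_empty_or_nonempty with rfl | hne
    · exact good_base hν ∅ subset_rfl finite_empty τ hτ (disjoint_empty _) σ
    obtain ⟨s0, hs0⟩ := hne
    have : Nonempty Task := ⟨(mem_iUnion₂.1 (hg hs0)).choose⟩
    choose! F hFQ hF using fun s (hs : s ∈ g) => mem_iUnion₂.1 (hg hs)
    obtain ⟨s1, hs1, hmax⟩ := hgf.exists_maximalFor F g ⟨s0, hs0⟩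
    have hle : ∀ s ∈ g, F s ≤ F s1 := fun s hs => by
      by_contra h
      exact h (hmax hs (not_le.1 h).le)
    refine (hQ (F s1) (hFQ s1 hs1)).1 g ?_ hgf τ hτ ?_ σ
    · intro s hs
      rcases (hle s hs).lt_or_eq with h | h
      · exact Or.inl (mem_iUnion₂.2 ⟨F s, h, hF s hs⟩)
      · exact Or.inr (h ▸ hF s hs)
    · refine hd.mono_right (union_subset (iUnion₂_subset fun s hs => ?_) ?_)
      · exact fun x hx => mem_iUnion₂.2 ⟨s, hdn _ (hFQ s1 hs1) s hs, hx⟩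
      · exact fun x hx => mem_iUnion₂.2 ⟨_, hFQ s1 hs1, hx⟩
  have main : ∀ t, P t (fun s _ => H s) (H t) := by
    intro t
    induction t using wf.wf.induction with
    | _ t ih =>
      apply hH
      have hgood := dir {s | s < t} (fun a ha b hb => lt_trans hb ha) ih
      have hcard : (⋃ s ∈ {s | s < t}, (H s).2.1) ≠ univ := by
        intro hu
        have h1 : Cardinal.mk (⋃ s ∈ {s | s < t}, (H s).2.1 : Set Om) < Cardinal.continuum := by
          refine (Cardinal.mk_biUnion_le _ _).trans_lt ?_
          refine Cardinal.mul_lt_of_lt Cardinal.aleph0_le_continuum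
            ((Cardinal.mk_Iio_lt t hr).trans_le card_T) ?_
          refine lt_of_le_of_lt (ciSup_le' fun s => ?_) Cardinal.aleph0_lt_continuum
          exact ((H s.1).2.2.lt_aleph0).le
        rw [hu, Cardinal.mk_univ, mk_Om] at h1
        exact lt_irrefl _ h1
      obtain ⟨G', τ, hτ, h1, h2⟩ := step hν0 hπ hgood hcard t.2.1 t.2.2
      exact ⟨⟨G', τ, hτ⟩, h1, h2⟩
  refine ⟨⋃ t ∈ (univ : Set Task), (H t).1, ?_, ?_⟩
  · intro g hg hgf hN
    refine dir univ (fun _ _ _ _ => trivial) (fun t _ => main t) g hg hgf ∅ finite_empty (empty_disjoint _) (fun _ => ∅)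
      (hN.mono inter_subset_left)
  · intro U hU hUm
    refine (main ⟨U, hU, hUm⟩).2.mono ?_
    apply union_subset
    · intro s hs
      simp only [mem_iUnion] at hs ⊢
      obtain ⟨t, _, ht⟩ := hs
      exact ⟨t, trivial, ht⟩
    · intro s hs
      exact mem_iUnion₂.2 ⟨_, trivial, hs⟩

lemma N_iUnion {ν : S → Measure Om} {E : ℕ → Set Om} (hE : ∀ k, N ν (E k))
    (hb : ∀ k s, ν s (E k) ≤ 2⁻¹ ^ k) : N ν (⋃ k, E k) := by
  have : (cofinite : Filter S).IsCountablyGenerated := by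
    have hc : HasCountableBasis (cofinite : Filter S) (fun s : Set S => s.Finite) compl :=
      ⟨hasBasis_cofinite, Set.Countable.ofPred_finite⟩
    exact hc.isCountablyGenerated
  have h1 : Tendsto (fun s => ∫⁻ k, ν s (E k) ∂(Measure.count : Measure ℕ)) cofinite
      (𝓝 (∫⁻ _ : ℕ, 0 ∂(Measure.count : Measure ℕ))) := by
    refine tendsto_lintegral_filter_of_dominated_convergence (fun k => 2⁻¹ ^ k) ?_ ?_ ?_ ?_
    · exact Eventually.of_forall fun s => measurable_of_countable _
    · exact Eventually.of_forall fun s => Eventually.of_forall fun k => hb k s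
    · rw [lintegral_count, ENNReal.tsum_geometric]
      simp
    · exact Eventually.of_forall fun k => hE k
  simp only [lintegral_zero, lintegral_count] at h1
  exact tendsto_of_tendsto_of_tendsto_of_le_of_le tendsto_const_nhds h1 (fun _ => zero_le)
    (fun s => measure_iUnion_le _)

section stone

variable {lam : Measure Om}

lemma mono (q : MeasureAlgebraStone lam) {s t : Set Om} (hs : MeasurableSet s)
    (ht : MeasurableSet t) (h : s ⊆ t) (h1 : q.1 ⟨s, hs⟩ = true) : q.1 ⟨t, ht⟩ = true := by
  have h2 := q.2.2.1 ⟨s, hs⟩ ⟨t, ht⟩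
  have : (⟨s ∪ t, hs.union ht⟩ : {s : Set Om // MeasurableSet s}) = ⟨t, ht⟩ :=
    Subtype.ext (union_eq_self_of_subset_left h)
  simp only [this, h1, Bool.true_or] at h2
  exact h2

lemma union (q : MeasureAlgebraStone lam) {s t : Set Om} (hs : MeasurableSet s)
    (ht : MeasurableSet t) :
    q.1 ⟨s ∪ t, hs.union ht⟩ = true ↔ q.1 ⟨s, hs⟩ = true ∨ q.1 ⟨t, ht⟩ = true := by
  rw [q.2.2.1 ⟨s, hs⟩ ⟨t, ht⟩, Bool.or_eq_true]

lemma compl (q : MeasureAlgebraStone lam) {s : Set Om} (hs : MeasurableSet s) :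
    q.1 ⟨sᶜ, hs.compl⟩ = true ↔ ¬ q.1 ⟨s, hs⟩ = true := by
  rw [q.2.2.2.1 ⟨s, hs⟩]; simp

lemma inter (q : MeasureAlgebraStone lam) {s t : Set Om} (hs : MeasurableSet s)
    (ht : MeasurableSet t) (h1 : q.1 ⟨s, hs⟩ = true) (h2 : q.1 ⟨t, ht⟩ = true) :
    q.1 ⟨s ∩ t, hs.inter ht⟩ = true := by
  by_contra h
  rw [← compl q (hs.inter ht)] at h
  have h3 := mono q _ (hs.compl.union ht.compl) (compl_inter s t).subset h
  rw [union q hs.compl ht.compl, compl q hs, compl q ht] at h3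
  tauto

lemma biInter (q : MeasureAlgebraStone lam) {V : Om → Set Om} (hV : ∀ X, MeasurableSet (V X))
    (σ : Finset Om) (h : ∀ X ∈ σ, q.1 ⟨V X, hV X⟩ = true) :
    q.1 ⟨⋂ X ∈ σ, V X, σ.measurableSet_biInter fun X _ => hV X⟩ = true := by
  classical
  induction σ using Finset.induction_on with
  | empty => exact mono q MeasurableSet.univ _ (by simp) q.2.1
  | insert a t ha ih =>
    have h1 := ih fun X hX => h X (Finset.mem_insert_of_mem hX)
    have h2 := inter q (hV a) _ (h a (Finset.mem_insert_self _ _)) h1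
    refine mono q _ _ ?_ h2
    simp

lemma coord_measurable (i : ℕ) (b : Bool) : MeasurableSet {x : Om | x i = b} := by
  have h : Measurable fun x : Om => x i := measurable_pi_apply i
  exact h (measurableSet_singleton b)

lemma cyl_measurable (v : List Bool) : MeasurableSet (Cyl v) := by
  have : Cyl v = ⋂ i : Fin v.length, {x | x i.val = v.get i} := by
    ext x; simp [Cyl]
  rw [this]
  exact MeasurableSet.iInter fun i => coord_measurable _ _

lemma exists_small (hlam : ∀ v : List Bool, lam (Cyl v) = (1 / 2 : ℝ≥0∞) ^ v.length)
    (q : MeasureAlgebraStone lam) (n : ℕ) :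
    ∃ c : Set Om, ∃ hc : MeasurableSet c, q.1 ⟨c, hc⟩ = true ∧ lam c = (1 / 2 : ℝ≥0∞) ^ n := by
  have : ∀ n, ∃ v : List Bool, v.length = n ∧ q.1 ⟨Cyl v, cyl_measurable v⟩ = true := by
    intro n
    induction n with
    | zero =>
      refine ⟨[], rfl, mono q MeasurableSet.univ _ ?_ q.2.1⟩
      intro x _ i
      exact i.elim0
    | succ n ih =>
      obtain ⟨v, hv, hq⟩ := ih
      have hsub : Cyl v ⊆ Cyl (v ++ [true]) ∪ Cyl (v ++ [false]) := by
        intro x hx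
        have key : ∀ b, x v.length = b → x ∈ Cyl (v ++ [b]) := by
          rintro b hb ⟨i, hi⟩
          simp only [List.length_append, List.length_singleton] at hi
          rcases Nat.lt_succ_iff_lt_or_eq.1 hi with h | rfl
          · have := hx ⟨i, h⟩
            simpa [List.getElem_append, h] using this
          · simpa using hb
        cases hb : x v.length
        · exact Or.inr (key _ hb)
        · exact Or.inl (key _ hb)
      have h2 := mono q _ ((cyl_measurable _).union (cyl_measurable _)) hsub hq
      rw [union q (cyl_measurable _) (cyl_measurable _)] at h2
      rcases h2 with h2 | h2
      · exact ⟨_, by simp [hv], h2⟩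
      · exact ⟨_, by simp [hv], h2⟩
  obtain ⟨v, hv, hq⟩ := this n
  exact ⟨_, _, hq, by rw [hlam, hv]⟩

lemma exists_small_nu (hlam : ∀ v : List Bool, lam (Cyl v) = (1 / 2 : ℝ≥0∞) ^ v.length)
    {ν : S → Measure Om} {K : S → ℝ≥0∞} (hK : ∀ s, K s ≠ ∞) (hν : ∀ s B, ν s B ≤ K s * lam B)
    (q : MeasureAlgebraStone lam) {B : Set Om} (hB : MeasurableSet B) (hN : N ν B)
    (hq : q.1 ⟨B, hB⟩ = true) {ε : ℝ≥0∞} (hε : 0 < ε) :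
    ∃ c : Set Om, ∃ hc : MeasurableSet c, q.1 ⟨c, hc⟩ = true ∧ N ν c ∧ ∀ s, ν s c ≤ ε := by
  have h1 : ∀ᶠ s in cofinite, ν s B < ε := hN.eventually (gt_mem_nhds hε)
  have h2 : {s : S | ¬ ν s B < ε}.Finite := h1
  have h3 : ∀ᶠ n : ℕ in atTop, ∀ s ∈ {s : S | ¬ ν s B < ε}, K s * (1 / 2 : ℝ≥0∞) ^ n ≤ ε := by
    rw [Filter.eventually_all_finite h2]
    intro s _
    have : Tendsto (fun n : ℕ => K s * (1 / 2 : ℝ≥0∞) ^ n) atTop (𝓝 (K s * 0)) :=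
      ENNReal.Tendsto.const_mul (ENNReal.tendsto_pow_atTop_nhds_zero_of_lt_one (by simp))
        (Or.inr (hK s))
    rw [mul_zero] at this
    exact (this.eventually (gt_mem_nhds hε)).mono fun n hn => le_of_lt hn
  obtain ⟨n, hn⟩ := h3.exists
  obtain ⟨c, hc, hqc, hlc⟩ := exists_small hlam q n
  refine ⟨B ∩ c, hB.inter hc, inter q hB hc hq hqc, hN.mono inter_subset_left, fun s => ?_⟩
  by_cases hs : ν s B < ε
  · exact (measure_mono inter_subset_left).trans hs.le
  · refine (measure_mono inter_subset_right).trans ((hν s c).trans ?_)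
    rw [hlc]
    exact hn s hs

/-- The partition map. -/
lemma exists_pi (hlam : ∀ v : List Bool, lam (Cyl v) = (1 / 2 : ℝ≥0∞) ^ v.length) :
    ∃ π : Om → S, (∀ s, MeasurableSet (π ⁻¹' {s})) ∧ ∀ s, lam (π ⁻¹' {s}) ≠ 0 := by
  obtain ⟨e, he⟩ := exists_surjective_nat S
  let p : Om → ℕ := fun x => sInf {i | x i = true}
  have hp : Measurable p := by
    refine measurable_to_countable' fun n => ?_
    have : p ⁻¹' {n} = ({x | x n = true} ∩ ⋂ i ∈ {i | i < n}, {x | x i = false}) ∪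
        ({x | n = 0} ∩ ⋂ i, {x : Om | x i = false}) := by
      ext x
      simp only [mem_preimage, mem_singleton_iff, mem_union, mem_inter_iff, mem_ofPred_eq,
        mem_iInter, p]
      constructor
      · intro h
        rcases eq_empty_or_nonempty {i | x i = true} with h0 | h0
        · right
          rw [h0, Nat.sInf_empty] at h
          refine ⟨h.symm, fun i => ?_⟩
          have : i ∉ {i | x i = true} := by rw [h0]; exact notMem_empty i
          simpa using this
        · left
          have := Nat.sInf_mem h0
          rw [h] at this
          refine ⟨this, fun i hi => ?_⟩
          have := Nat.notMem_of_lt_sInf (h ▸ hi : i < sInf {i | x i = true})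
          simpa using this
      · rintro (⟨h1, h2⟩ | ⟨h1, h2⟩)
        · refine le_antisymm (Nat.sInf_le h1) (le_csInf ⟨n, h1⟩ fun i hi => ?_)
          by_contra hlt
          have h3 := h2 i (not_le.1 hlt)
          have h4 : x i = true := hi
          simp [h3] at h4
        · have : {i | x i = true} = ∅ := by ext i; simp [h2 i]
          rw [this, Nat.sInf_empty, h1]
    rw [this]
    have hm : ∀ (i : ℕ) (b : Bool), MeasurableSet {x : Om | x i = b} := fun i b =>
      coord_measurable i b
    refine MeasurableSet.union ((hm n true).inter (MeasurableSet.biInter (to_countable _)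
      fun i _ => hm i false)) (MeasurableSet.inter (MeasurableSet.const _)
      (MeasurableSet.iInter fun i => hm i false))
  refine ⟨fun x => e (p x), fun s => ?_, fun s => ?_⟩
  · exact hp (t := e ⁻¹' {s}) (MeasurableSet.of_discrete)
  · obtain ⟨n, rfl⟩ := he s
    intro h0
    have hsub : Cyl (List.replicate n false ++ [true]) ⊆ (fun x => e (p x)) ⁻¹' {e n} := by
      intro x hx
      have h1 : x n = true := by simpa using hx ⟨n, by simp⟩
      have h2 : ∀ i < n, x i = false := fun i hi => by
        simpa [List.getElem_append, hi] using hx ⟨i, by simp; omega⟩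
      have : p x = n := by
        refine le_antisymm (Nat.sInf_le h1) (le_csInf ⟨n, h1⟩ fun i hi => ?_)
        by_contra hlt
        have h3 := h2 i (not_le.1 hlt)
        have h4 : x i = true := hi
        simp [h3] at h4
      simp [this]
    have := measure_mono_null hsub h0
    rw [hlam] at this
    simp at this

/-- The ultrafilter determined by a complete family. -/
lemma exists_point {ν : S → Measure Om} {G : Set (Set Om)}
    (hν : ∀ s B, lam B = 0 → ν s B = 0)
    (hG : ∀ g ⊆ G, g.Finite → ¬ N ν (⋂₀ g))
    (hD : ∀ U : ℕ → Set Om, Antitone U → (∀ n, MeasurableSet (U n)) → Done ν G U) :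
    ∃ p : MeasureAlgebraStone lam, ∀ s : {s : Set Om // MeasurableSet s},
      p.1 s = true ↔ ∃ g ⊆ G, g.Finite ∧ N ν (⋂₀ g \ s.1) := by
  classical
  let F : Set Om → Prop := fun s => ∃ g ⊆ G, g.Finite ∧ N ν (⋂₀ g \ s)
  have hmono : ∀ s t, s ⊆ t → F s → F t := by
    rintro s t h ⟨g, hg, hf, hN⟩
    exact ⟨g, hg, hf, hN.mono (sdiff_subset_sdiff_right h)⟩
  have hinter : ∀ s t, F s → F t → F (s ∩ t) := by
    rintro s t ⟨g, hg, hf, hN⟩ ⟨g', hg', hf', hN'⟩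
    refine ⟨g ∪ g', union_subset hg hg', hf.union hf', (hN.union hN').mono ?_⟩
    rintro x ⟨hx, hx'⟩
    by_cases hxs : x ∈ s
    · exact Or.inr ⟨fun a ha => hx a (Or.inr ha), fun hxt => hx' ⟨hxs, hxt⟩⟩
    · exact Or.inl ⟨fun a ha => hx a (Or.inl ha), hxs⟩
  have hnull : ∀ s, N ν s → ¬ F s := by
    rintro s hs ⟨g, hg, hf, hN⟩
    refine hG g hg hf ((hs.union hN).mono ?_)
    intro x hx
    by_cases hxs : x ∈ s
    · exact Or.inl hxs
    · exact Or.inr ⟨hx, hxs⟩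
  have hN0 : N ν ∅ := by
    simp only [N, measure_empty]
    exact tendsto_const_nhds
  have hult : ∀ s, MeasurableSet s → (F sᶜ ↔ ¬ F s) := by
    intro s hs
    constructor
    · intro h1 h2
      refine hnull _ ?_ (hinter _ _ h1 h2)
      rw [compl_inter_self]
      exact hN0
    · intro h
      rcases hD (fun _ => s) antitone_const (fun _ => hs) with ⟨n, g, hg, hf, hN⟩ | ⟨h1, -⟩
      · exact ⟨g, hg, hf, by simpa [Set.sdiff_eq] using hN⟩
      · exact absurd ⟨{s}, by simpa using h1 0, finite_singleton _, by simpa using hN0⟩ h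
  refine ⟨⟨fun s => decide (F s.1), ?_, ?_, ?_, ?_⟩, ?_⟩
  · simp only [decide_eq_true_eq]
    exact ⟨∅, empty_subset _, finite_empty, by simpa using hN0⟩
  · intro s t
    rw [Bool.eq_iff_iff]
    simp only [Bool.or_eq_true, decide_eq_true_eq]
    constructor
    · intro h
      by_contra hn
      push Not at hn
      have h1 := hinter _ _ ((hult _ s.2).2 hn.1) ((hult _ t.2).2 hn.2)
      rw [← compl_union, hult _ (s.2.union t.2)] at h1
      exact h1 h
    · rintro (h | h)
      · exact hmono _ _ subset_union_left h
      · exact hmono _ _ subset_union_right h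
  · intro s
    rw [Bool.eq_iff_iff]
    simp only [Bool.not_eq_true', decide_eq_true_eq, decide_eq_false_iff_not]
    exact hult _ s.2
  · intro s hs
    simp only [decide_eq_false_iff_not]
    apply hnull
    simp only [N, hν _ _ hs]
    exact tendsto_const_nhds
  · intro s
    simp only [decide_eq_true_eq]
    exact Iff.rfl

lemma weak {ν : S → Measure Om} {G : Set (Set Om)} {K : S → ℝ≥0∞}
    (hlam : ∀ v : List Bool, lam (Cyl v) = (1 / 2 : ℝ≥0∞) ^ v.length)
    (hK : ∀ s, K s ≠ ∞) (hν : ∀ s B, ν s B ≤ K s * lam B)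
    (hG : ∀ g ⊆ G, g.Finite → ¬ N ν (⋂₀ g))
    (hD : ∀ U : ℕ → Set Om, Antitone U → (∀ n, MeasurableSet (U n)) → Done ν G U)
    (p : MeasureAlgebraStone lam) (hp : ∀ s : {s : Set Om // MeasurableSet s},
      p.1 s = true ↔ ∃ g ⊆ G, g.Finite ∧ N ν (⋂₀ g \ s.1)) : IsWeakPPoint p := by
  classical
  have hpN : ∀ s (hs : MeasurableSet s), N ν s → ¬ p.1 ⟨s, hs⟩ = true := by
    intro s hs hN h
    obtain ⟨g, hg, hf, hN'⟩ := (hp _).1 h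
    refine hG g hg hf ((hN.union hN').mono ?_)
    intro x hx
    by_cases hxs : x ∈ s
    · exact Or.inl hxs
    · exact Or.inr ⟨hx, hxs⟩
  have hN0 : N ν ∅ := by
    simp only [N, measure_empty]
    exact tendsto_const_nhds
  -- reduction to a separating set
  intro C hC hpC hcl
  suffices h : ∃ B, ∃ hB : MeasurableSet B, p.1 ⟨B, hB⟩ = true ∧
      ∀ c ∈ C, ¬ c.1 ⟨B, hB⟩ = true by
    obtain ⟨B, hB, h1, h2⟩ := h
    have hcont : Continuous fun q : MeasureAlgebraStone lam => q.1 ⟨B, hB⟩ :=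
      (continuous_apply _).comp continuous_subtype_val
    have hopen : IsOpen {q : MeasureAlgebraStone lam | q.1 ⟨B, hB⟩ = true} :=
      hcont.isOpen_preimage {true} (isOpen_discrete _)
    obtain ⟨c, hc1, hc2⟩ := mem_closure_iff.1 hcl _ hopen h1
    exact h2 c hc2 hc1
  have hCne : C.Nonempty := closure_nonempty_iff.1 ⟨p, hcl⟩
  obtain ⟨f, rfl⟩ := hC.exists_eq_range hCne
  have hne : ∀ k, f k ≠ p := fun k h => hpC ⟨k, h⟩
  -- the points with a null set
  obtain ⟨B1, hB1, hB1N, hB1c⟩ : ∃ B, ∃ hB : MeasurableSet B, N ν B ∧ ∀ c ∈ range f,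
      (∃ E, ∃ hE : MeasurableSet E, N ν E ∧ c.1 ⟨E, hE⟩ = true) → c.1 ⟨B, hB⟩ = true := by
    have hE : ∀ k, ∃ E, ∃ hE : MeasurableSet E, N ν E ∧ (∀ s, ν s E ≤ 2⁻¹ ^ k) ∧
        ((∃ E, ∃ hE : MeasurableSet E, N ν E ∧ (f k).1 ⟨E, hE⟩ = true) →
          (f k).1 ⟨E, hE⟩ = true) := by
      intro k
      by_cases h : ∃ E, ∃ hE : MeasurableSet E, N ν E ∧ (f k).1 ⟨E, hE⟩ = true
      · obtain ⟨E, hE, hEN, hEf⟩ := h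
        obtain ⟨c, hc, h1, h2, h3⟩ := exists_small_nu hlam hK hν (f k) hE hEN hEf
          (ε := 2⁻¹ ^ k) (ENNReal.pow_pos (by simp) k)
        exact ⟨c, hc, h2, h3, fun _ => h1⟩
      · exact ⟨∅, MeasurableSet.empty, hN0, by simp, fun h' => absurd h' h⟩
    choose E hEm hEN hEb hEf using hE
    refine ⟨⋃ k, E k, MeasurableSet.iUnion hEm, N_iUnion hEN hEb, ?_⟩
    rintro _ ⟨k, rfl⟩ h
    exact mono _ (hEm k) _ (subset_iUnion E k) (hEf k h)
  -- the points without a null set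
  obtain ⟨B2, hB2, hB2p, hB2c⟩ : ∃ B, ∃ hB : MeasurableSet B, p.1 ⟨B, hB⟩ = true ∧ ∀ c ∈ range f,
      (∀ E, ∀ hE : MeasurableSet E, N ν E → ¬ c.1 ⟨E, hE⟩ = true) → ¬ c.1 ⟨B, hB⟩ = true := by
    have hW : ∀ k, ∃ W, ∃ hW : MeasurableSet W, p.1 ⟨W, hW⟩ = true ∧
        ¬ (f k).1 ⟨W, hW⟩ = true := by
      intro k
      by_contra hcon
      push Not at hcon
      apply hne k
      apply Subtype.ext
      funext s
      rw [Bool.eq_iff_iff]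
      refine ⟨fun h => ?_, fun h => hcon s.1 s.2 h⟩
      by_contra hn
      have h1 := hcon _ s.2.compl ((compl p s.2).2 hn)
      exact (compl (f k) s.2).1 h1 h
    choose W hWm hWp hWf using hW
    let U : ℕ → Set Om := fun n => ⋂ i ∈ Finset.range n, W i
    have hUm : ∀ n, MeasurableSet (U n) := fun n =>
      Finset.measurableSet_biInter _ fun i _ => hWm i
    have hUa : Antitone U := fun a b hab => by
      refine biInter_subset_biInter_left ?_
      intro i hi
      simp only [Finset.coe_range, mem_Iio] at hi ⊢
      omega
    have hUp : ∀ n, p.1 ⟨U n, hUm n⟩ = true := by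
      intro n
      induction n with
      | zero => exact mono p MeasurableSet.univ _ (by simp [U]) p.2.1
      | succ n ih =>
        refine mono p _ _ ?_ (inter p (hWm n) (hUm n) (hWp n) ih)
        rintro x ⟨h1, h2⟩
        simp only [U, mem_iInter, Finset.mem_range] at h2 ⊢
        intro i hi
        rcases Nat.lt_succ_iff_lt_or_eq.1 hi with h | rfl
        · exact h2 i h
        · exact h1
    rcases hD U hUa hUm with ⟨n, g, hg, hf, hN⟩ | ⟨-, V, hVm, hVG, hV⟩
    · exfalso
      have h1 : p.1 ⟨(U n)ᶜ, (hUm n).compl⟩ = true :=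
        (hp _).2 ⟨g, hg, hf, by simpa [Set.sdiff_eq] using hN⟩
      exact (compl p (hUm n)).1 h1 (hUp n)
    · have hfin : ∀ k, (∀ E, ∀ hE : MeasurableSet E, N ν E → ¬ (f k).1 ⟨E, hE⟩ = true) →
          {X | (f k).1 ⟨V X, hVm X⟩ = true}.Finite := by
        intro k hk
        by_contra hinf
        obtain ⟨σ, hσ, hcard⟩ := Set.Infinite.exists_subset_card_eq hinf (k + 1)
        have h1 := biInter (f k) hVm σ fun X hX => hσ hX
        have h2 := hk _ ((σ.measurableSet_biInter fun X _ => hVm X).diff (hUm σ.card))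
          (hV σ (Finset.card_pos.1 (by omega)))
        have h3 : (f k).1 ⟨U σ.card, hUm _⟩ = true := by
          by_contra hn
          exact h2 (inter (f k) _ (hUm _).compl h1 ((compl (f k) (hUm _)).2 hn))
        refine hWf k (mono (f k) _ (hWm k) ?_ h3)
        rw [hcard]
        exact biInter_subset_of_mem (by simp)
      have hcount : (⋃ k ∈ {k | ∀ E, ∀ hE : MeasurableSet E, N ν E → ¬ (f k).1 ⟨E, hE⟩ = true},
          {X | (f k).1 ⟨V X, hVm X⟩ = true}).Countable :=
        Set.Countable.biUnion (to_countable _) fun k hk => (hfin k hk).countable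
      have hneq : (⋃ k ∈ {k | ∀ E, ∀ hE : MeasurableSet E, N ν E → ¬ (f k).1 ⟨E, hE⟩ = true},
          {X | (f k).1 ⟨V X, hVm X⟩ = true}) ≠ univ := by
        intro h
        rw [h] at hcount
        have h1 := hcount.le_aleph0
        rw [Cardinal.mk_univ, mk_Om] at h1
        exact absurd h1 (not_le.2 Cardinal.aleph0_lt_continuum)
      obtain ⟨X, hX⟩ := (Set.ne_univ_iff_exists_notMem _).1 hneq
      refine ⟨V X, hVm X, (hp _).2 ⟨{V X}, by simpa using hVG X, finite_singleton _, ?_⟩, ?_⟩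
      · simpa using hN0
      · rintro _ ⟨k, rfl⟩ hk h
        exact hX (mem_iUnion₂.2 ⟨k, hk, h⟩)
  refine ⟨B2 ∩ B1ᶜ, hB2.inter hB1.compl, inter p hB2 hB1.compl hB2p ?_, fun c hc h => ?_⟩
  · rw [compl p hB1]
    exact hpN _ _ hB1N
  · by_cases hcN : ∃ E, ∃ hE : MeasurableSet E, N ν E ∧ c.1 ⟨E, hE⟩ = true
    · have h1 := hB1c c hc hcN
      have h2 := mono c _ hB1.compl inter_subset_right h
      rw [compl c hB1] at h2
      exact h2 h1
    · push Not at hcN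
      exact hB2c c hc hcN (mono c _ hB2 inter_subset_left h)

end stone

end WPP

/-- The Stone space of the measure algebra `Bor(2^ω)/𝒩` contains a weak
P-point. Here `lam` is the standard coin-flipping (Haar) measure on `2^ω`, whose null sets
form `𝒩`. -/
theorem exists_weakPPoint_in_measure_algebra_stone_space
    (lam : Measure (ℕ → Bool))
    (hlam : ∀ v : List Bool, lam (Cyl v) = (1 / 2 : ℝ≥0∞) ^ v.length) :
    ∃ p : MeasureAlgebraStone lam, IsWeakPPoint p := by
  obtain ⟨π, hπ, hπ0⟩ := WPP.exists_pi hlam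
  have huniv : lam Set.univ = 1 := by
    have h := hlam []
    have h2 : Cyl [] = Set.univ := by
      ext x
      simp only [Set.mem_univ, iff_true]
      intro i
      exact i.elim0
    rw [h2] at h
    simpa using h
  have hfin : IsFiniteMeasure lam := ⟨by rw [huniv]; exact ENNReal.one_lt_top⟩
  let ν : WPP.S → Measure (ℕ → Bool) := fun s => ProbabilityTheory.cond lam (π ⁻¹' {s})
  have hν1 : ∀ s, ν s (π ⁻¹' {s}) = 1 := fun s =>
    ProbabilityTheory.cond_apply_self (hπ0 s) (measure_ne_top _ _)
  have hν0 : ∀ s, ν s (π ⁻¹' {s})ᶜ = 0 := fun s => by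
    have := ProbabilityTheory.cond_apply (hπ s) lam (π ⁻¹' {s})ᶜ
    simpa using this
  have hνK : ∀ s B, ν s B ≤ (lam (π ⁻¹' {s}))⁻¹ * lam B := fun s B => by
    rw [ProbabilityTheory.cond_apply (hπ s)]
    exact mul_le_mul_right (measure_mono Set.inter_subset_right) _
  have hK : ∀ s, (lam (π ⁻¹' {s}))⁻¹ ≠ ∞ := fun s => ENNReal.inv_ne_top.2 (hπ0 s)
  obtain ⟨G, hG, hD⟩ := WPP.construct hν0 hν1 hπ
  obtain ⟨p, hp⟩ := WPP.exists_point (lam := lam) (fun s B hB => by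
    have := hνK s B
    rw [hB, mul_zero] at this
    exact le_antisymm this zero_le) hG hD
  exact ⟨p, WPP.weak hlam hK hνK hG hD p hp⟩
end

section
/- There is a point x of ω* which is neither a μ-point nor a weak P-point: there is a non-atomic Radon measure μ on ω* with μ({x}) = 0 such that every open set containing x has positive μ-measure, and there is a countable set C ⊆ ω* \ {x} with x ∈ closure(C). -/
open MeasureTheory Topology ENNReal NNReal

/-- The space `ω* = βω \ ω`: the free (non-principal) ultrafilters on `ℕ`, with the topology
inherited from the Stone space `βω` of all ultrafilters on `ℕ`. -/
def OmegaStar : Type := {u : Ultrafilter ℕ // ∀ n : ℕ, u ≠ pure n}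

instance : TopologicalSpace OmegaStar := instTopologicalSpaceSubtype
instance : MeasurableSpace OmegaStar := borel OmegaStar
instance : BorelSpace OmegaStar := ⟨rfl⟩

open Filter CompactlySupported

lemma omegaStar_isClosed : IsClosed {u : Ultrafilter ℕ | ∀ n : ℕ, u ≠ pure n} := by
  have : {u : Ultrafilter ℕ | ∀ n : ℕ, u ≠ pure n} = ⋂ n : ℕ, {u : Ultrafilter ℕ | {n}ᶜ ∈ u} := by
    ext u
    simp only [Set.mem_ofPred_eq, Set.mem_iInter, Ultrafilter.compl_mem_iff_notMem]
    refine forall_congr' fun n => not_congr ⟨?_, ?_⟩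
    · rintro rfl; simp
    · intro h
      obtain ⟨x, hx, hu⟩ := Ultrafilter.eq_pure_of_finite_mem (Set.finite_singleton n) h
      rw [Set.mem_singleton_iff] at hx
      rw [hu, hx]
  rw [this]
  exact isClosed_iInter fun n => ultrafilter_isClosed_basic _

instance omegaStar_compact : CompactSpace OmegaStar :=
  isCompact_iff_compactSpace.mp omegaStar_isClosed.isCompact

instance omegaStar_t2 : T2Space OmegaStar :=
  inferInstanceAs (T2Space {u : Ultrafilter ℕ // ∀ n : ℕ, u ≠ pure n})

instance omegaStar_td : TotallyDisconnectedSpace OmegaStar :=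
  inferInstanceAs (TotallyDisconnectedSpace {u : Ultrafilter ℕ // ∀ n : ℕ, u ≠ pure n})

/-- The sequence of averages of a function along a sequence of points. -/
noncomputable def avgSeq {X : Type*} (d : ℕ → X) (f : X → ℝ) (n : ℕ) : ℝ :=
  (∑ i ∈ Finset.range n, f (d i)) / n

lemma avgSeq_bound {X : Type*} (d : ℕ → X) (f : X → ℝ) (C : ℝ) (hC : ∀ x, |f x| ≤ C) (n : ℕ) :
    avgSeq d f n ∈ Set.Icc (-C) C := by
  have hC0 : 0 ≤ C := (abs_nonneg _).trans (hC (d 0))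
  rw [Set.mem_Icc, ← abs_le, avgSeq, abs_div, Nat.abs_cast]
  apply div_le_of_le_mul₀ (by positivity) hC0
  calc |∑ i ∈ Finset.range n, f (d i)| ≤ ∑ i ∈ Finset.range n, |f (d i)| :=
        Finset.abs_sum_le_sum_abs _ _
    _ ≤ ∑ i ∈ Finset.range n, C := Finset.sum_le_sum fun i _ => hC _
    _ = C * n := by simp [mul_comm]

lemma exists_functional {X : Type*} [TopologicalSpace X] [CompactSpace X] (d : ℕ → X) :
    ∃ L : C_c(X, ℝ) →ₚ[ℝ] ℝ, ∀ f : C_c(X, ℝ),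
      Tendsto (avgSeq d f) (hyperfilter ℕ : Filter ℕ) (𝓝 (L f)) := by
  have key : ∀ f : C_c(X, ℝ), ∃ l : ℝ, Tendsto (avgSeq d f) (hyperfilter ℕ : Filter ℕ) (𝓝 l) := by
    intro f
    obtain ⟨C, hC⟩ := (isCompact_range f.continuous).isBounded.exists_norm_le
    have hb : ∀ n, avgSeq d f n ∈ Set.Icc (-C) C :=
      avgSeq_bound d f C (fun x => hC _ ⟨x, rfl⟩)
    obtain ⟨l, -, hl⟩ := (isCompact_Icc (a := -C) (b := C)).ultrafilter_le_nhds
      ((hyperfilter ℕ).map (avgSeq d f)) (by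
        rw [le_principal_iff, Ultrafilter.coe_map]
        exact Filter.mem_map.2 (Filter.univ_mem' hb))
    exact ⟨l, hl⟩
  choose L hL using key
  refine ⟨PositiveLinearMap.mk₀ ⟨⟨L, ?_⟩, ?_⟩ ?_, hL⟩
  · intro f g
    refine tendsto_nhds_unique (hL (f + g)) (((hL f).add (hL g)).congr fun n => ?_)
    simp [avgSeq, Finset.sum_add_distrib, add_div]
  · intro c f
    refine tendsto_nhds_unique (hL (c • f)) (((hL f).const_mul c).congr fun n => ?_)
    simp [avgSeq, ← Finset.mul_sum, mul_div_assoc]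
  · intro f hf
    refine ge_of_tendsto' (hL f) fun n => ?_
    exact div_nonneg (Finset.sum_nonneg fun i _ => hf (d i)) (by positivity)

lemma exists_measure (d : ℕ → OmegaStar) :
    ∃ μ : Measure OmegaStar, IsFiniteMeasure μ ∧ μ.Regular ∧ ∀ A : Set OmegaStar, IsClopen A →
      Tendsto (avgSeq d (A.indicator 1)) (hyperfilter ℕ : Filter ℕ) (𝓝 (μ.real A)) := by
  obtain ⟨L, hL⟩ := exists_functional d
  have hreg : (RealRMK.rieszMeasure L).Regular := RealRMK.regular_rieszMeasure L
  have hfin : IsFiniteMeasure (RealRMK.rieszMeasure L) := inferInstance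
  refine ⟨RealRMK.rieszMeasure L, hfin, hreg, fun A hA => ?_⟩
  let f : C_c(OmegaStar, ℝ) :=
    ⟨⟨A.indicator 1, (continuous_one).indicator (by simp [hA.frontier_eq])⟩,
      HasCompactSupport.of_compactSpace _⟩
  have h1 := hL f
  rw [← RealRMK.integral_rieszMeasure L f] at h1
  have h2 : ∫ x, f x ∂(RealRMK.rieszMeasure L) = (RealRMK.rieszMeasure L).real A :=
    integral_indicator_one hA.isOpen.measurableSet
  rw [h2] at h1
  exact h1

/-- The discrete sequence of free ultrafilters. -/
noncomputable def dseq (n : ℕ) : OmegaStar :=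
  ⟨(hyperfilter ℕ).map (Nat.pair n), by
    intro m h
    have h1 : ({m} : Set ℕ) ∈ (hyperfilter ℕ).map (Nat.pair n) := by rw [h]; simp
    rw [Ultrafilter.mem_map] at h1
    have h2 : (Nat.pair n ⁻¹' {m}).Finite :=
      (Set.finite_singleton m).preimage fun a _ b _ hab => (Nat.pair_eq_pair.1 hab).2
    exact notMem_hyperfilter_of_finite h2 h1⟩

/-- The clopen set of ultrafilters concentrating on pairs with first coordinate `r` mod `k`. -/
def resSet (k r : ℕ) : Set OmegaStar :=
  {u | {m : ℕ | (Nat.unpair m).1 % k = r} ∈ u.1}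

lemma resSet_clopen (k r : ℕ) : IsClopen (resSet k r) :=
  ⟨(ultrafilter_isClosed_basic _).preimage continuous_subtype_val,
    (ultrafilter_isOpen_basic _).preimage continuous_subtype_val⟩

lemma dseq_mem (k r n : ℕ) : dseq n ∈ resSet k r ↔ n % k = r := by
  change {m : ℕ | (Nat.unpair m).1 % k = r} ∈ (hyperfilter ℕ).map (Nat.pair n) ↔ _
  rw [Ultrafilter.mem_map]
  by_cases h : n % k = r
  · simp only [h, iff_true]
    exact Filter.univ_mem' fun m => by simp [h]
  · simp [h, Set.preimage]

lemma mem_some_resSet (k : ℕ) (hk : 0 < k) (y : OmegaStar) : ∃ r, r < k ∧ y ∈ resSet k r := by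
  have h : (⋃ r ∈ Finset.range k, {m : ℕ | (Nat.unpair m).1 % k = r}) ∈ y.1 := by
    refine Filter.univ_mem' (f := (y.1 : Filter ℕ)) fun m => ?_
    simp [Nat.mod_lt _ hk]
  have h' := (Ultrafilter.finite_biUnion_mem_iff (Finset.range k).finite_toSet).1 h
  obtain ⟨r, hr, h⟩ := h'
  exact ⟨r, by simpa using hr, h⟩

lemma avg_resSet_le (k r : ℕ) (hr : r < k) (n : ℕ) (hn : 0 < n) :
    avgSeq dseq ((resSet k r).indicator 1) n ≤ 1 / k + 1 / n := by
  classical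
  have hk : 0 < k := by omega
  have hs : ∑ i ∈ Finset.range n, (resSet k r).indicator (1 : OmegaStar → ℝ) (dseq i)
      = (Nat.count (· ≡ r [MOD k]) n : ℝ) := by
    rw [Nat.count_eq_card_filter_range, Finset.card_filter, Nat.cast_sum]
    refine Finset.sum_congr rfl fun i _ => ?_
    simp [Set.indicator_apply, dseq_mem, Nat.ModEq, Nat.mod_eq_of_lt hr]
  have hc : Nat.count (· ≡ r [MOD k]) n ≤ n / k + 1 := by
    rw [Nat.count_modEq_card n hk]
    split_ifs <;> omega
  have hc' : (Nat.count (· ≡ r [MOD k]) n : ℝ) ≤ (n : ℝ) / k + 1 := by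
    calc (Nat.count (· ≡ r [MOD k]) n : ℝ) ≤ ((n / k + 1 : ℕ) : ℝ) := by exact_mod_cast hc
      _ ≤ _ := by push_cast; gcongr; exact Nat.cast_div_le
  rw [avgSeq, hs]
  have hn' : (0 : ℝ) < n := by exact_mod_cast hn
  have hk' : (0 : ℝ) < k := by exact_mod_cast hk
  calc (Nat.count (· ≡ r [MOD k]) n : ℝ) / n ≤ ((n : ℝ) / k + 1) / n := by gcongr
    _ = 1 / k + 1 / n := by field_simp

/-- There is a point of `ω*` which is neither a μ-point nor a weak P-point. -/
theorem exists_neither_muPoint_nor_weakPPoint :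
    ∃ x : OmegaStar,
      (∃ μ : Measure OmegaStar, IsRadon μ ∧ (∀ y : OmegaStar, μ {y} = 0) ∧ μ {x} = 0 ∧
        ∀ U : Set OmegaStar, IsOpen U → x ∈ U → 0 < μ U) ∧
      (∃ C : Set OmegaStar, C.Countable ∧ x ∉ C ∧ x ∈ closure C) := by
  obtain ⟨μ, hfin, hreg, hμ⟩ := exists_measure dseq
  have hle : (hyperfilter ℕ : Filter ℕ) ≤ atTop := by
    rw [← Nat.cofinite_eq_atTop]; exact hyperfilter_le_cofinite
  have huniv : μ.real Set.univ = 1 := by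
    refine tendsto_nhds_unique (hμ _ isClopen_univ) (tendsto_const_nhds.congr' ?_)
    filter_upwards [hle (eventually_gt_atTop 0)] with n hn
    have : (n : ℝ) ≠ 0 := by exact_mod_cast (Nat.pos_iff_ne_zero.1 hn)
    simp [avgSeq, this]
  have huniv' : μ Set.univ = 1 := by
    rw [← ENNReal.toReal_eq_one_iff]; exact huniv
  have hprob : IsProbabilityMeasure μ := ⟨huniv'⟩
  have hna : ∀ y : OmegaStar, μ {y} = 0 := by
    intro y
    rw [← measureReal_eq_zero_iff]
    refine le_antisymm ?_ measureReal_nonneg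
    have hb : ∀ k : ℕ, μ.real {y} ≤ 1 / ((k : ℝ) + 1) := by
      intro k
      obtain ⟨r, hr, hy⟩ := mem_some_resSet (k + 1) k.succ_pos y
      refine (measureReal_mono (Set.singleton_subset_iff.2 hy)).trans ?_
      have h1 : Tendsto (fun n : ℕ => 1 / ((k + 1 : ℕ) : ℝ) + 1 / (n : ℝ))
          (hyperfilter ℕ : Filter ℕ) (𝓝 (1 / ((k + 1 : ℕ) : ℝ) + 0)) :=
        (tendsto_const_nhds.add tendsto_one_div_atTop_nhds_zero_nat).mono_left hle
      rw [add_zero] at h1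
      push_cast at h1
      refine le_of_tendsto_of_tendsto (hμ _ (resSet_clopen (k + 1) r)) h1 ?_
      filter_upwards [hle (eventually_gt_atTop 0)] with n hn
      simpa using avg_resSet_le (k + 1) r hr n hn
    exact ge_of_tendsto' tendsto_one_div_add_atTop_nhds_zero_nat hb
  have hinner : μ.InnerRegular := inferInstance
  have hradon : IsRadon μ := ⟨hprob, hinner.innerRegular, hreg.toOuterRegular⟩
  by_contra hcon
  have hD : (Set.range dseq).Countable := Set.countable_range _
  have hD0 : μ (Set.range dseq) = 0 := by
    have : NullSingletonClass μ := ⟨hna⟩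
    exact hD.measure_zero μ
  have hnull : ∀ x, x ∉ Set.range dseq → ∃ U, IsOpen U ∧ x ∈ U ∧ μ U = 0 := by
    intro x hx
    by_cases hxc : x ∈ closure (Set.range dseq)
    · by_contra hno
      refine hcon ⟨x, ⟨μ, hradon, hna, hna x, fun U hU hxU => ?_⟩, _, hD, hx, hxc⟩
      exact pos_iff_ne_zero.2 fun h0 => hno ⟨U, hU, hxU, h0⟩
    · obtain ⟨V, hV, hxV, hVs⟩ :=
        compact_exists_isClopen_in_isOpen isClosed_closure.isOpen_compl hxc
      refine ⟨V, hV.isOpen, hxV, ?_⟩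
      rw [← measureReal_eq_zero_iff]
      refine tendsto_nhds_unique (hμ _ hV) (tendsto_const_nhds.congr fun n => ?_)
      have : ∀ i, dseq i ∉ V := fun i hi => hVs hi (subset_closure ⟨i, rfl⟩)
      simp [avgSeq, this]
  have hDc : μ (Set.range dseq)ᶜ = 0 := by
    by_contra hne
    obtain ⟨K, hK, hKc, hpos⟩ := hinner.innerRegular hD.measurableSet.compl 0
      (pos_iff_ne_zero.2 hne)
    refine hpos.ne' (hKc.measure_zero_of_nhdsWithin fun x hx => ?_)
    obtain ⟨U, hU, hxU, h0⟩ := hnull x (hK hx)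
    exact ⟨U, mem_nhdsWithin_of_mem_nhds (hU.mem_nhds hxU), h0⟩
  have := measure_union_le (μ := μ) (Set.range dseq) (Set.range dseq)ᶜ
  rw [Set.union_compl_self, huniv', hD0, hDc] at this
  simp at this
end

section
/- There is a point x of ω* which is simultaneously a weak P-point and a μ-point; equivalently, x avoids all measures: for every Radon measure μ on ω* with μ({x}) = 0 there is an open set U ∋ x with μ(U) = 0. -/
open MeasureTheory Topology ENNReal NNReal

namespace OKPoint

open Set Cardinal

/-- The countable index space of Kunen's independent linked family. -/
abbrev KS : Type := Σ k : ℕ, (Set (Fin k) → Set (Set (Fin k)))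

/-- Trace of a set of naturals on `Fin k`. -/
def tr (k : ℕ) (X : Set ℕ) : Set (Fin k) := {i | (i : ℕ) ∈ X}

lemma tr_inj (a : Finset (Set ℕ)) : ∃ k0, ∀ k, k0 ≤ k → Set.InjOn (tr k) (a : Set (Set ℕ)) := by
  classical
  have h : ∀ p : Set ℕ × Set ℕ, ∃ m : ℕ, p.1 ≠ p.2 → ¬ (m ∈ p.1 ↔ m ∈ p.2) := by
    intro p
    by_cases hp : p.1 = p.2
    · exact ⟨0, fun h => (h hp).elim⟩
    · by_contra hcon
      push Not at hcon
      exact hp (Set.ext fun m => (hcon m).2)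
  choose m hm using h
  refine ⟨((a ×ˢ a).sup m) + 1, ?_⟩
  intro k hk X hX Y hY hXY
  by_contra hne
  apply hm (X, Y) hne
  have h1 : m (X, Y) ≤ (a ×ˢ a).sup m :=
    Finset.le_sup (f := m) (by simpa using ⟨hX, hY⟩ : (X, Y) ∈ a ×ˢ a)
  have h2 : m (X, Y) < k := by omega
  have := Set.ext_iff.1 hXY ⟨m (X, Y), h2⟩
  simpa [tr] using this

/-- Kunen's family on `KS`. -/
def AS (X Y : Set ℕ) (n : ℕ) : Set KS :=
  {s | (s.2 (tr s.1 X)).ncard ≤ n ∧ tr s.1 Y ∈ s.2 (tr s.1 X)}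

lemma AS_mono (X Y : Set ℕ) {n m : ℕ} (h : n ≤ m) : AS X Y n ⊆ AS X Y m :=
  fun _ hs => ⟨hs.1.trans h, hs.2⟩

lemma AS_finite (X : Set ℕ) (n : ℕ) (a : Finset (Set ℕ)) (ha : n < a.card) :
    {s : KS | ∀ Y ∈ a, s ∈ AS X Y n}.Finite := by
  classical
  obtain ⟨k0, hk0⟩ := tr_inj a
  have hfin : (⋃ k ∈ Finset.range k0, Set.range (fun f => (⟨k, f⟩ : KS))).Finite := by
    apply Set.Finite.biUnion (Finset.finite_toSet _)
    intro k _
    exact Set.finite_range _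
  refine hfin.subset ?_
  rintro ⟨k, f⟩ hs
  by_cases hk : k < k0
  · simp only [Set.mem_iUnion]
    exact ⟨k, by simpa using hk, f, rfl⟩
  · exfalso
    have hinj := hk0 k (not_lt.1 hk)
    have hne : a.Nonempty := Finset.card_pos.1 (by omega)
    obtain ⟨Y0, hY0⟩ := hne
    have h1 : (f (tr k X)).ncard ≤ n := (hs Y0 hY0).1
    have h2 : tr k '' (a : Set (Set ℕ)) ⊆ f (tr k X) := by
      rintro _ ⟨Y, hY, rfl⟩
      exact (hs Y hY).2
    have h3 := Set.ncard_le_ncard h2 (Set.toFinite _)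
    rw [hinj.ncard_image, Set.ncard_coe_finset] at h3
    omega

lemma AS_infinite (σ : Finset (Set ℕ)) (e : Set ℕ → Finset (Set ℕ)) :
    {s : KS | ∀ X ∈ σ, ∀ Y ∈ e X, s ∈ AS X Y (e X).card}.Infinite := by
  classical
  obtain ⟨k0, hk0⟩ := tr_inj σ
  apply Set.Infinite.of_image (fun s : KS => s.1)
  apply (Set.Ici_infinite k0).mono
  intro k hk
  have hinj := hk0 k hk
  refine ⟨⟨k, fun y => {z | ∃ X ∈ σ, tr k X = y ∧ ∃ Y ∈ e X, tr k Y = z}⟩, ?_, rfl⟩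
  intro X hX Y hY
  have heq : {z | ∃ X' ∈ σ, tr k X' = tr k X ∧ ∃ Y ∈ e X', tr k Y = z}
      = tr k '' (e X : Set (Set ℕ)) := by
    ext z
    constructor
    · rintro ⟨X', hX', h, Y', hY', rfl⟩
      have := hinj hX' hX h
      subst this
      exact ⟨Y', hY', rfl⟩
    · rintro ⟨Y, hY, rfl⟩
      exact ⟨X, hX, rfl, Y, hY, rfl⟩
  refine ⟨?_, ?_⟩
  · change Set.ncard {z | ∃ X' ∈ σ, tr k X' = tr k X ∧ ∃ Y ∈ e X', tr k Y = z} ≤ _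
    rw [heq]
    exact (Set.ncard_image_le (Finset.finite_toSet _)).trans (by rw [Set.ncard_coe_finset])
  · exact ⟨X, hX, rfl, Y, hY, rfl⟩

instance : Infinite KS :=
  Infinite.of_surjective (fun s : KS => s.1) (fun k => ⟨⟨k, fun _ => ∅⟩, rfl⟩)

lemma exists_family : ∃ A : Set ℕ → Set ℕ → ℕ → Set ℕ,
    (∀ X Y n m, n ≤ m → A X Y n ⊆ A X Y m) ∧
    (∀ X n (a : Finset (Set ℕ)), n < a.card → {x | ∀ Y ∈ a, x ∈ A X Y n}.Finite) ∧
    (∀ (σ : Finset (Set ℕ)) (e : Set ℕ → Finset (Set ℕ)),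
      {x | ∀ X ∈ σ, ∀ Y ∈ e X, x ∈ A X Y (e X).card}.Infinite) := by
  obtain ⟨hd⟩ := nonempty_denumerable KS
  let g : ℕ ≃ KS := (Denumerable.eqv KS).symm
  refine ⟨fun X Y n => g ⁻¹' AS X Y n, ?_, ?_, ?_⟩
  · intro X Y n m h
    exact Set.preimage_mono (AS_mono X Y h)
  · intro X n a ha
    exact (AS_finite X n a ha).preimage g.injective.injOn
  · intro σ e
    exact (AS_infinite σ e).preimage (by rw [g.surjective.range_eq]; exact Set.subset_univ _)

/-- A finite intersection of members of the family. -/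
def Box (A : Set ℕ → Set ℕ → ℕ → Set ℕ) (σ : Finset (Set ℕ)) (e : Set ℕ → Finset (Set ℕ)) :
    Set ℕ := {x | ∀ X ∈ σ, ∀ Y ∈ e X, x ∈ A X Y (e X).card}

/-- The family, with indices outside `R`, is independent modulo the filter generated by `S`. -/
def Good (A : Set ℕ → Set ℕ → ℕ → Set ℕ) (S : Set (Set ℕ)) (R : Set (Set ℕ)) : Prop :=
  ∀ K : Finset (Set ℕ), (K : Set (Set ℕ)) ⊆ S → ∀ σ : Finset (Set ℕ),
    Disjoint (σ : Set (Set ℕ)) R → ∀ e, (⋂₀ (K : Set (Set ℕ)) ∩ Box A σ e).Infinite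

/-- The sequence `C` has been taken care of by `S`. -/
def Handled (C : ℕ → Set ℕ) (S : Set (Set ℕ)) : Prop :=
  (∃ n, ∃ K : Finset (Set ℕ), (K : Set (Set ℕ)) ⊆ S ∧ (⋂₀ (K : Set (Set ℕ)) ∩ C n).Finite) ∨
  ∃ V : Set ℕ → Set ℕ, (∀ α, V α ∈ S) ∧
    ∀ a : Finset (Set ℕ), a.Nonempty → ({x | ∀ α ∈ a, x ∈ V α} \ C a.card).Finite

lemma Handled.mono {C : ℕ → Set ℕ} {S S' : Set (Set ℕ)} (h : Handled C S) (hS : S ⊆ S') :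
    Handled C S' := by
  rcases h with ⟨n, K, hK, hf⟩ | ⟨V, hV, hf⟩
  · exact Or.inl ⟨n, K, hK.trans hS, hf⟩
  · exact Or.inr ⟨V, fun α => hS (hV α), hf⟩

lemma box_union (A : Set ℕ → Set ℕ → ℕ → Set ℕ) (σ σ' : Finset (Set ℕ))
    (e e' : Set ℕ → Finset (Set ℕ)) (hd : Disjoint (σ : Set (Set ℕ)) σ') :
    ∃ σ'' : Finset (Set ℕ), ∃ e'', (σ'' : Set (Set ℕ)) = (σ : Set (Set ℕ)) ∪ (σ' : Set (Set ℕ)) ∧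
      Box A σ'' e'' = Box A σ e ∩ Box A σ' e' := by
  classical
  refine ⟨σ ∪ σ', fun X => if X ∈ σ then e X else e' X, by simp, ?_⟩
  have hd' : ∀ X, X ∈ σ' → X ∉ σ := fun X h h' => Set.disjoint_left.1 hd h' h
  ext x
  constructor
  · intro h
    refine ⟨fun X hX Y hY => ?_, fun X hX Y hY => ?_⟩
    · have := h X (Finset.mem_union_left _ hX) Y
      simp only [if_pos hX] at this
      exact this hY
    · have := h X (Finset.mem_union_right _ hX) Y
      simp only [if_neg (hd' X hX)] at this
      exact this hY
  · rintro ⟨h1, h2⟩ X hX Y hY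
    by_cases hs : X ∈ σ
    · simp only [if_pos hs] at hY ⊢
      exact h1 X hs Y hY
    · simp only [if_neg hs] at hY ⊢
      exact h2 X ((Finset.mem_union.1 hX).resolve_left hs) Y hY

lemma step (A : Set ℕ → Set ℕ → ℕ → Set ℕ)
    (hA1 : ∀ X Y n m, n ≤ m → A X Y n ⊆ A X Y m)
    (hA2 : ∀ X n (a : Finset (Set ℕ)), n < a.card → {x | ∀ Y ∈ a, x ∈ A X Y n}.Finite)
    (C : ℕ → Set ℕ) (hC : Antitone C) (S R : Set (Set ℕ)) (hg : Good A S R)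
    (β : Set ℕ) (hβ : β ∉ R) :
    ∃ S' : Set (Set ℕ), ∃ R' : Set (Set ℕ), R'.Finite ∧ Good A (S ∪ S') (R ∪ R') ∧
      Handled C (S ∪ S') := by
  classical
  by_cases hcase : Good A (S ∪ Set.range C) R
  · -- all the `C n` may be added
    let V : Set ℕ → Set ℕ := fun α =>
      {x | x ∈ C 0 ∧ ∀ n, x ∈ C n → x ∉ C (n + 1) → x ∈ A β α n}
    refine ⟨Set.range C ∪ Set.range V, {β}, Set.finite_singleton _, ?_, ?_⟩
    · intro K hK σ hσ e
      have hsplit : ∃ a : Finset (Set ℕ), ∀ s ∈ K, s ∈ S ∪ Set.range C ∨ ∃ α ∈ a, s = V α := by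
        have : ∀ s : Set ℕ, ∃ α, s ∈ Set.range V → s = V α := by
          intro s
          by_cases h : s ∈ Set.range V
          · obtain ⟨α, rfl⟩ := h
            exact ⟨α, fun _ => rfl⟩
          · exact ⟨∅, fun h' => (h h').elim⟩
        choose q hq using this
        refine ⟨K.image q, fun s hs => ?_⟩
        rcases hK hs with h | h | h
        · exact Or.inl (Or.inl h)
        · exact Or.inl (Or.inr h)
        · exact Or.inr ⟨q s, Finset.mem_image_of_mem _ hs, hq s h⟩
      obtain ⟨a, ha⟩ := hsplit
      have hd1 : Disjoint (σ : Set (Set ℕ)) R := hσ.mono_right Set.subset_union_left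
      have hd2 : Disjoint (σ : Set (Set ℕ)) (({β} : Finset (Set ℕ)) : Set (Set ℕ)) := by
        rw [Finset.coe_singleton]
        exact hσ.mono_right Set.subset_union_right
      obtain ⟨σ'', e'', hσ'', hbox⟩ := box_union A σ {β} e (fun _ => a) hd2
      have hd3 : Disjoint (σ'' : Set (Set ℕ)) R := by
        rw [hσ'', Set.disjoint_union_left]
        refine ⟨hd1, ?_⟩
        rw [Finset.coe_singleton]
        exact Set.disjoint_singleton_left.2 hβ
      have hinf := hcase (insert (C a.card) (K.filter (fun s => s ∈ S ∪ Set.range C))) (by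
        intro s hs
        rw [Finset.coe_insert] at hs
        rcases hs with rfl | hs
        · exact Or.inr ⟨_, rfl⟩
        · exact (Finset.mem_filter.1 hs).2) σ'' hd3 e''
      refine hinf.mono ?_
      rintro x ⟨hx1, hx2⟩
      rw [hbox] at hx2
      have hxC : x ∈ C a.card := hx1 _ (by simp)
      refine ⟨?_, hx2.1⟩
      intro s hs
      rcases ha s hs with h | ⟨α, hα, rfl⟩
      · exact hx1 s (by
          rw [Finset.coe_insert]
          exact Or.inr (Finset.mem_filter.2 ⟨hs, h⟩))
      · refine ⟨hC (Nat.zero_le _) hxC, ?_⟩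
        intro m _ hm2
        have hle : a.card ≤ m := by
          by_contra hlt
          exact hm2 (hC (by omega) hxC)
        exact hA1 β α _ _ hle (hx2.2 β (by simp) α hα)
    · refine Or.inr ⟨V, fun α => Or.inr (Or.inr ⟨α, rfl⟩), ?_⟩
      intro a hane
      have hfin : (⋃ m ∈ Finset.range a.card, {x | ∀ Y ∈ a, x ∈ A β Y m}).Finite := by
        apply Set.Finite.biUnion (Finset.finite_toSet _)
        intro m hm
        exact hA2 β m a (by simpa using hm)
      refine hfin.subset ?_
      rintro x ⟨hx, hxn⟩
      by_cases hxC0 : x ∈ C 0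
      · have hex : ∃ m, x ∉ C m := ⟨_, hxn⟩
        have hf := Nat.find_spec hex
        have hmin : Nat.find hex ≤ a.card := Nat.find_min' hex hxn
        obtain ⟨m, hm⟩ : ∃ m, Nat.find hex = m + 1 := by
          refine Nat.exists_eq_succ_of_ne_zero ?_
          intro h0
          rw [h0] at hf
          exact hf hxC0
        have hm1 : x ∈ C m := by
          by_contra h
          have := Nat.find_min' hex h
          omega
        rw [hm] at hf
        simp only [Set.mem_iUnion]
        refine ⟨m, by simp; omega, fun Y hY => (hx Y hY).2 m hm1 hf⟩
      · exfalso
        obtain ⟨Y, hY⟩ := hane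
        exact hxC0 (hx Y hY).1
  · unfold Good at hcase
    push Not at hcase
    obtain ⟨K, hK, σ, hσ, e, hfin⟩ := hcase
    have hn : ∃ n, ∀ s ∈ K, s ∈ S ∨ C n ⊆ s := by
      have : ∀ s : Set ℕ, ∃ n, s ∈ Set.range C → s = C n := by
        intro s
        by_cases h : s ∈ Set.range C
        · obtain ⟨α, rfl⟩ := h
          exact ⟨α, fun _ => rfl⟩
        · exact ⟨0, fun h' => (h h').elim⟩
      choose q hq using this
      refine ⟨K.sup q, fun s hs => ?_⟩
      rcases hK hs with h | h
      · exact Or.inl h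
      · right
        rw [hq s h]
        have := Finset.le_sup (f := q) hs
        rw [← hq s h]
        conv_rhs => rw [hq s h]
        exact hC this
    obtain ⟨n, hn⟩ := hn
    refine ⟨{Box A σ e}, σ, Finset.finite_toSet _, ?_, ?_⟩
    · intro K' hK' σ' hσ' e'
      have hd : Disjoint (σ' : Set (Set ℕ)) σ := hσ'.mono_right Set.subset_union_right
      obtain ⟨σ'', e'', hσ'', hbox⟩ := box_union A σ' σ e' e hd
      have hinf := hg (K'.filter (fun s => s ∈ S)) (fun s hs => (Finset.mem_filter.1 hs).2) σ''
        (by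
          rw [hσ'', Set.disjoint_union_left]
          exact ⟨hσ'.mono_right Set.subset_union_left, hσ⟩) e''
      refine hinf.mono ?_
      rintro x ⟨hx1, hx2⟩
      rw [hbox] at hx2
      refine ⟨fun s hs => ?_, hx2.1⟩
      rcases hK' hs with h | h
      · exact hx1 s (Finset.mem_filter.2 ⟨hs, h⟩)
      · rw [Set.mem_singleton_iff.1 h]
        exact hx2.2
    · refine Or.inl ⟨n, insert (Box A σ e) (K.filter (fun s => s ∈ S)), ?_, ?_⟩
      · intro s hs
        rw [Finset.coe_insert] at hs
        rcases hs with rfl | hs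
        · exact Or.inr rfl
        · exact Or.inl (Finset.mem_filter.1 hs).2
      · refine hfin.subset ?_
        rintro x ⟨hx1, hx2⟩
        refine ⟨fun s hs => ?_, hx1 _ (by simp)⟩
        by_cases h : s ∈ S
        · exact hx1 s (by
            rw [Finset.coe_insert]
            exact Or.inr (Finset.mem_filter.2 ⟨hs, h⟩))
        · exact ((hn s hs).resolve_left h) hx2

/-- The index set of the transfinite construction. -/
abbrev T : Type := Cardinal.continuum.{0}.ord.ToType

lemma good_union (A : Set ℕ → Set ℕ → ℕ → Set ℕ)
    (hA3 : ∀ σ e, (Box A σ e).Infinite)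
    (P Q : T → Set (Set ℕ)) (J : Set T)
    (hQ : ∀ s ∈ J, Good A (⋃ r ∈ Set.Iic s, P r) (⋃ r ∈ Set.Iic s, Q r))
    (hJ : ∀ s ∈ J, ∀ r ≤ s, r ∈ J) :
    Good A (⋃ r ∈ J, P r) (⋃ r ∈ J, Q r) := by
  classical
  intro K hK σ hσ e
  have key : ∀ K : Finset (Set ℕ), (K : Set (Set ℕ)) ⊆ (⋃ r ∈ J, P r) →
      K = ∅ ∨ ∃ s ∈ J, (K : Set (Set ℕ)) ⊆ ⋃ r ∈ Set.Iic s, P r := by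
    intro K
    induction K using Finset.induction_on with
    | empty => intro _; exact Or.inl rfl
    | insert a K ha ih =>
      intro h
      right
      rw [Finset.coe_insert, Set.insert_subset_iff] at h
      obtain ⟨s, hs, has⟩ := Set.mem_iUnion₂.1 h.1
      rcases ih h.2 with rfl | ⟨s', hs', hK'⟩
      · refine ⟨s, hs, ?_⟩
        simp only [insert_empty_eq, Finset.coe_singleton, Set.singleton_subset_iff]
        exact Set.mem_iUnion₂.2 ⟨s, le_refl s, has⟩
      · have hmem : max s s' ∈ J := by
          rcases max_choice s s' with h | h <;> rw [h] <;> assumption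
        refine ⟨max s s', hmem, ?_⟩
        rw [Finset.coe_insert, Set.insert_subset_iff]
        refine ⟨Set.mem_iUnion₂.2 ⟨s, Set.mem_Iic.2 (le_max_left _ _), has⟩, hK'.trans ?_⟩
        exact Set.biUnion_subset_biUnion_left (Set.Iic_subset_Iic.2 (le_max_right _ _))
  rcases key K hK with rfl | ⟨s, hs, hKs⟩
  · simpa using hA3 σ e
  · refine hQ s hs K hKs σ (hσ.mono_right ?_) e
    exact Set.biUnion_subset_biUnion_left (fun r hr => hJ s hs r hr)

lemma construction (A : Set ℕ → Set ℕ → ℕ → Set ℕ)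
    (hA1 : ∀ X Y n m, n ≤ m → A X Y n ⊆ A X Y m)
    (hA2 : ∀ X n (a : Finset (Set ℕ)), n < a.card → {x | ∀ Y ∈ a, x ∈ A X Y n}.Finite)
    (hA3 : ∀ σ e, (Box A σ e).Infinite)
    (task : T → ℕ → Set ℕ) (htask : ∀ t, Antitone (task t)) :
    ∃ S : Set (Set ℕ), Good A S Set.univ ∧ ∀ t, Handled (task t) S := by
  classical
  have hstep : ∀ (t : T) (S R : Set (Set ℕ)), ∃ p : Set (Set ℕ) × Set (Set ℕ),
      p.2.Finite ∧ (Good A S R → (∃ β, β ∉ R) → Good A (S ∪ p.1) (R ∪ p.2) ∧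
        Handled (task t) (S ∪ p.1)) := by
    intro t S R
    by_cases h : Good A S R ∧ ∃ β, β ∉ R
    · obtain ⟨hg, β, hβ⟩ := h
      obtain ⟨S', R', h1, h2, h3⟩ := step A hA1 hA2 (task t) (htask t) S R hg β hβ
      exact ⟨(S', R'), h1, fun _ _ => ⟨h2, h3⟩⟩
    · exact ⟨(∅, ∅), Set.finite_empty, fun h1 h2 => (h ⟨h1, h2⟩).elim⟩
  choose f hf1 hf2 using hstep
  let F : (t : T) → ((s : T) → s < t → Set (Set ℕ) × Set (Set ℕ)) →
      Set (Set ℕ) × Set (Set ℕ) :=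
    fun t g => f t (⋃ s, ⋃ h : s < t, (g s h).1) (⋃ s, ⋃ h : s < t, (g s h).2)
  let run : T → Set (Set ℕ) × Set (Set ℕ) := (wellFounded_lt (α := T)).fix F
  have hrun : ∀ t, run t = f t (⋃ s ∈ Set.Iio t, (run s).1) (⋃ s ∈ Set.Iio t, (run s).2) :=
    fun t => (wellFounded_lt (α := T)).fix_eq F t
  have hfin : ∀ t, (run t).2.Finite := by
    intro t
    rw [hrun]
    exact hf1 _ _ _
  have hIic : ∀ (P : T → Set (Set ℕ)) t,
      (⋃ s ∈ Set.Iic t, P s) = (⋃ s ∈ Set.Iio t, P s) ∪ P t := by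
    intro P t
    rw [← Set.Iio_insert, Set.biUnion_insert, Set.union_comm]
  have hex : ∀ t, ∃ β, β ∉ (⋃ s ∈ Set.Iio t, (run s).2) := by
    intro t
    by_contra hcon
    push Not at hcon
    have huniv : (⋃ s ∈ Set.Iio t, (run s).2) = Set.univ := Set.eq_univ_of_forall hcon
    have hlt : #(Set.Iio t) < 𝔠 := by
      have := Cardinal.mk_Iio_toType_ord_lt t
      simpa using this
    have hle : #(⋃ s ∈ Set.Iio t, (run s).2 : Set (Set ℕ)) ≤ max #(Set.Iio t) ℵ₀ := by
      rw [Set.biUnion_eq_iUnion]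
      refine (Cardinal.mk_iUnion_le _).trans ?_
      refine (Cardinal.mul_le_max _ _).trans ?_
      refine max_le (max_le (le_max_left _ _) ?_) (le_max_right _ _)
      refine le_max_of_le_right ?_
      refine ciSup_le' fun s => ?_
      exact (hfin s).countable.le_aleph0
    rw [huniv, Cardinal.mk_univ, Cardinal.mk_set, Cardinal.mk_nat,
      Cardinal.two_power_aleph0] at hle
    exact absurd hle (not_le.2 (max_lt hlt Cardinal.aleph0_lt_continuum))
  have hgood : ∀ t, Good A (⋃ s ∈ Set.Iic t, (run s).1) (⋃ s ∈ Set.Iic t, (run s).2) ∧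
      Handled (task t) (⋃ s ∈ Set.Iic t, (run s).1) := by
    intro t
    induction t using (wellFounded_lt (α := T)).induction with
    | _ t ih =>
      have h1 : Good A (⋃ s ∈ Set.Iio t, (run s).1) (⋃ s ∈ Set.Iio t, (run s).2) :=
        good_union A hA3 (fun s => (run s).1) (fun s => (run s).2) (Set.Iio t)
          (fun s hs => (ih s hs).1) (fun s hs r hr => lt_of_le_of_lt hr hs)
      have h2 := hf2 t _ _ h1 (hex t)
      rw [← hrun] at h2
      rw [hIic (fun s => (run s).1), hIic (fun s => (run s).2)]
      exact h2
  refine ⟨⋃ s ∈ (Set.univ : Set T), (run s).1, ?_, ?_⟩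
  · have h := good_union A hA3 (fun s => (run s).1) (fun s => (run s).2) Set.univ
      (fun s _ => (hgood s).1) (fun _ _ _ _ => trivial)
    intro K hK σ hσ e
    have hσ0 : σ = ∅ := by
      have := Set.disjoint_univ.1 hσ
      simpa using this
    subst hσ0
    exact h K hK ∅ (by simp) e
  · intro t
    exact (hgood t).2.mono (Set.biUnion_subset_biUnion_left (Set.subset_univ _))

lemma exists_ultrafilter : ∃ u : Ultrafilter ℕ, (∀ s : Set ℕ, s.Finite → s ∉ u) ∧
    ∀ C : ℕ → Set ℕ, Antitone C → (∀ n, C n ∈ u) →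
      ∃ V : Set ℕ → Set ℕ, (∀ α, V α ∈ u) ∧
        ∀ a : Finset (Set ℕ), a.Nonempty → ({x | ∀ α ∈ a, x ∈ V α} \ C a.card).Finite := by
  classical
  obtain ⟨A, hA1, hA2, hA3⟩ := exists_family
  have hcard : #T = #(ℕ → Set ℕ) := by
    simp
  obtain ⟨eqv⟩ := Cardinal.eq.1 hcard
  let task : T → ℕ → Set ℕ := fun t n => ⋂ i ≤ n, eqv t i
  have htask : ∀ t, Antitone (task t) := by
    intro t n m hnm
    exact Set.biInter_subset_biInter_left (fun i (hi : i ≤ n) => hi.trans hnm)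
  obtain ⟨S, hS, hH⟩ := construction A hA1 hA2 hA3 task htask
  have hfip : ∀ K : Finset (Set ℕ), (K : Set (Set ℕ)) ⊆ S →
      (⋂₀ (K : Set (Set ℕ))).Infinite := by
    intro K hK
    have := hS K hK ∅ (by simp) (fun _ => ∅)
    exact this.mono Set.inter_subset_left
  have hne : (Filter.cofinite ⊓ Filter.generate S).NeBot := by
    rw [Filter.inf_neBot_iff]
    intro s hs t ht
    obtain ⟨K, hKS, hKf, hKt⟩ := Filter.mem_generate_iff.1 ht
    have hinf := hfip hKf.toFinset (by simpa using hKS)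
    rw [Set.Finite.coe_toFinset] at hinf
    obtain ⟨x, hx1, hx2⟩ := (hinf.sdiff (Filter.mem_cofinite.1 hs)).nonempty
    exact ⟨x, not_not.1 hx2, hKt hx1⟩
  let u := Ultrafilter.of (Filter.cofinite ⊓ Filter.generate S)
  have hu : (u : Filter ℕ) ≤ Filter.cofinite ⊓ Filter.generate S := Ultrafilter.of_le _
  have huS : ∀ s ∈ S, s ∈ u := fun s hs =>
    (hu.trans inf_le_right) (Filter.mem_generate_of_mem hs)
  have hufin : ∀ s : Set ℕ, s.Finite → s ∉ u := by
    intro s hs hsu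
    have : sᶜ ∈ u := (hu.trans inf_le_left) hs.compl_mem_cofinite
    exact Ultrafilter.compl_mem_iff_notMem.1 this hsu
  refine ⟨u, hufin, ?_⟩
  intro C hC hCu
  obtain ⟨t, ht⟩ := eqv.surjective C
  have htC : task t = C := by
    funext n
    simp only [task, ht]
    apply subset_antisymm
    · exact Set.biInter_subset_of_mem (le_refl n)
    · exact Set.subset_iInter₂ fun i hi => hC hi
  have h := hH t
  rw [htC] at h
  rcases h with ⟨n, K, hK, hfin⟩ | ⟨V, hV, hfin⟩
  · exfalso
    refine hufin _ hfin (Filter.inter_mem ?_ (hCu n))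
    exact (Filter.sInter_mem (Finset.finite_toSet K)).2 fun s hs => huS s (hK hs)
  · exact ⟨V, fun α => huS _ (hV α), hfin⟩

lemma OmegaStar.notMem_of_finite (q : OmegaStar) (s : Set ℕ) (hs : s.Finite) : s ∉ q.1 := by
  intro h
  obtain ⟨x, _, hx⟩ := Ultrafilter.eq_pure_of_finite_mem hs h
  exact q.2 x hx

lemma isOpen_basic (s : Set ℕ) : IsOpen {q : OmegaStar | s ∈ q.1} :=
  (ultrafilter_isOpen_basic s).preimage continuous_subtype_val

lemma exists_basic (p : OmegaStar) (U : Set OmegaStar) (hU : IsOpen U) (hp : p ∈ U) :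
    ∃ s : Set ℕ, s ∈ p.1 ∧ {q : OmegaStar | s ∈ q.1} ⊆ U := by
  obtain ⟨W, hW, rfl⟩ := isOpen_induced_iff.1 hU
  obtain ⟨_, ⟨s, rfl⟩, hs1, hs2⟩ :=
    (ultrafilterBasis_is_basis (α := ℕ)).exists_subset_of_mem_open hp hW
  exact ⟨s, hs1, fun q hq => hs2 hq⟩

/-- Kunen's theorem: there is an OK point in `ω*`. -/
lemma exists_OK : ∃ p : OmegaStar, ∀ U : ℕ → Set OmegaStar, (∀ n, IsOpen (U n) ∧ p ∈ U n) →
    ∃ V : Set ℕ → Set OmegaStar, (∀ α, IsOpen (V α) ∧ p ∈ V α) ∧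
      ∀ a : Finset (Set ℕ), a.Nonempty → {x | ∀ α ∈ a, x ∈ V α} ⊆ U a.card := by
  obtain ⟨u, hu1, hu2⟩ := exists_ultrafilter
  refine ⟨⟨u, fun n hn => hu1 {n} (Set.finite_singleton n) (by rw [hn]; simp)⟩, ?_⟩
  intro U hU
  choose D hD1 hD2 using fun n => exists_basic _ (U n) (hU n).1 (hU n).2
  let C : ℕ → Set ℕ := fun n => ⋂ i ≤ n, D i
  have hC : Antitone C := by
    intro n m hnm
    exact Set.biInter_subset_biInter_left (fun i (hi : i ≤ n) => hi.trans hnm)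
  have hCu : ∀ n, C n ∈ u := fun n =>
    (Filter.biInter_mem (Set.finite_Iic n)).2 fun i _ => hD1 i
  obtain ⟨V, hV, hfin⟩ := hu2 C hC hCu
  refine ⟨fun α => {q | V α ∈ q.1}, fun α => ⟨isOpen_basic _, hV α⟩, ?_⟩
  intro a hane q hq
  apply hD2
  have h1 : {x | ∀ α ∈ a, x ∈ V α} ∈ q.1 := by
    have : (⋂ α ∈ (a : Set (Set ℕ)), V α) ∈ q.1 :=
      (Filter.biInter_mem (Finset.finite_toSet a)).2 fun i hi => hq i hi
    refine Filter.mem_of_superset this ?_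
    intro x hx α hα
    exact Set.mem_iInter₂.1 hx α hα
  have h2 : C a.card ∈ q.1 := by
    by_contra hcon
    have h3 : (C a.card)ᶜ ∈ q.1 := Ultrafilter.compl_mem_iff_notMem.2 hcon
    exact OmegaStar.notMem_of_finite q _ (hfin a hane) (Filter.inter_mem h1 h3)
  exact Filter.mem_of_superset h2 (fun x hx => Set.mem_iInter₂.1 hx _ (le_refl _))

lemma pigeon (g : Set ℕ → ℕ) : ∃ k, (g ⁻¹' {k}).Infinite := by
  by_contra hcon
  push Not at hcon
  have : (Set.univ : Set (Set ℕ)).Countable := by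
    have h : (Set.univ : Set (Set ℕ)) = ⋃ k, g ⁻¹' {k} := by
      ext x; simp
    rw [h]
    exact Set.countable_iUnion fun k => (hcon k).countable
  have h1 := Cardinal.le_aleph0_iff_set_countable.2 this
  rw [Cardinal.mk_univ, Cardinal.mk_set, Cardinal.mk_nat, Cardinal.two_power_aleph0] at h1
  exact absurd h1 (not_le.2 Cardinal.aleph0_lt_continuum)

instance : T2Space OmegaStar := inferInstanceAs (T2Space (Subtype _))

end OKPoint

/-- There is a point of `ω*` which is simultaneously a weak P-point and a
μ-point; equivalently, it avoids all measures. -/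
theorem exists_weakPPoint_and_muPoint :
    ∃ x : OmegaStar, IsWeakPPoint x ∧ IsMuPoint x ∧ AvoidsMeasures x := by
  obtain ⟨p, hp⟩ := OKPoint.exists_OK
  have hav : AvoidsMeasures p := by
    intro μ hμ h0
    obtain ⟨hprob, -, hout⟩ := hμ
    have hU : ∀ n : ℕ, ∃ U : Set OmegaStar, IsOpen U ∧ p ∈ U ∧ μ U < ((n : ℝ≥0∞) + 1)⁻¹ := by
      intro n
      obtain ⟨U, h1, h2, h3⟩ := Set.exists_isOpen_lt_of_lt {p} (((n : ℝ≥0∞) + 1)⁻¹)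
        (by rw [h0]; simp) (μ := μ)
      exact ⟨U, h2, h1 rfl, h3⟩
    choose U hU1 hU2 hU3 using hU
    obtain ⟨V, hV, hVU⟩ := hp U fun n => ⟨hU1 n, hU2 n⟩
    by_contra hcon
    push Not at hcon
    have hpos : ∀ α, ∃ k : ℕ, ((k : ℝ≥0∞))⁻¹ < μ (V α) := fun α =>
      ENNReal.exists_inv_nat_lt (hcon (V α) (hV α).1 (hV α).2)
    choose g hg using hpos
    obtain ⟨k, hk⟩ := OKPoint.pigeon g
    let s : ℕ ↪ (g ⁻¹' {k}) := hk.natEmbedding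
    have hs : ∀ i, ((k : ℝ≥0∞))⁻¹ < μ (V (s i)) := by
      intro i
      have h1 : g (s i) = k := (s i).2
      have := hg (s i)
      rwa [h1] at this
    let W : ℕ → Set OmegaStar := fun n => ⋃ i ≥ n, V (s i)
    have hWanti : Antitone W := by
      intro n m hnm
      exact Set.biUnion_subset_biUnion_left (fun i (hi : i ≥ m) => le_trans hnm hi)
    have hWmeas : ∀ n, NullMeasurableSet (W n) μ := fun n =>
      (isOpen_biUnion fun i _ => (hV (s i)).1).measurableSet.nullMeasurableSet
    have hlim := tendsto_measure_iInter_atTop hWmeas hWanti ⟨0, measure_ne_top μ _⟩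
    have hge : ((k : ℝ≥0∞))⁻¹ ≤ μ (⋂ n, W n) := by
      refine ge_of_tendsto' hlim fun n => (hs n).le.trans (measure_mono ?_)
      exact Set.subset_biUnion_of_mem (u := fun i => V (s i)) (le_refl n)
    have hsub : ∀ n, (⋂ n, W n) ⊆ U (n + 1) := by
      intro n x hx
      have hinf : {i | x ∈ V (s i)}.Infinite := by
        refine Set.infinite_of_forall_exists_gt fun m => ?_
        obtain ⟨i, hi, hxi⟩ := Set.mem_iUnion₂.1 (Set.mem_iInter.1 hx (m + 1))
        exact ⟨i, hxi, hi⟩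
      obtain ⟨b, hb, hbn⟩ := hinf.exists_subset_card_eq (n + 1)
      have hmem := hVU (b.map (s.trans (Function.Embedding.subtype _)))
        (by rw [← Finset.card_pos, Finset.card_map]; omega)
      rw [Finset.card_map, hbn] at hmem
      apply hmem
      intro α hα
      obtain ⟨i, hi, rfl⟩ := Finset.mem_map.1 hα
      exact hb hi
    have hlt := (hge.trans (measure_mono (hsub k))).trans_lt (hU3 (k + 1))
    have := ENNReal.inv_lt_inv.1 hlt
    exact absurd this (not_lt.2 (by push_cast; rw [add_assoc]; exact le_self_add))
  refine ⟨p, ?_, fun μ hμ h0 => hav μ hμ (h0 p), hav⟩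
  intro C hC hpC hcl
  rcases C.eq_empty_or_nonempty with rfl | hne
  · simp at hcl
  obtain ⟨c, rfl⟩ := hC.exists_eq_range hne
  obtain ⟨V, hV, hVU⟩ := hp (fun n => (c '' Set.Iic n)ᶜ) (fun n =>
    ⟨((Set.finite_Iic n).image c).isClosed.isOpen_compl, fun ⟨i, _, hi⟩ => hpC ⟨i, hi⟩⟩)
  have hmeet : ∀ α, ∃ k, c k ∈ V α := by
    intro α
    obtain ⟨_, h1, k, rfl⟩ := mem_closure_iff.1 hcl (V α) (hV α).1 (hV α).2
    exact ⟨k, h1⟩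
  choose g hg using hmeet
  obtain ⟨k, hk⟩ := OKPoint.pigeon g
  obtain ⟨b, hb, hbn⟩ := hk.exists_subset_card_eq (k + 1)
  have hmem := hVU b (by rw [← Finset.card_pos]; omega)
  rw [hbn] at hmem
  refine hmem (a := c k) ?_ ⟨k, Nat.le_succ k, rfl⟩
  intro α hα
  have h1 : g α = k := hb hα
  rw [← h1]
  exact hg α
end

section
/- There is a point x of ω* which is a weak P-point but not a μ-point: x is not in the closure of any countable subset of ω* \ {x}, yet there is a non-atomic Radon measure μ on ω* with μ({x}) = 0 such that every open set containing x has positive μ-measure. -/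
open MeasureTheory Topology ENNReal NNReal

abbrev DD (k : ℕ) : Type := (Fin k → Bool) → (j : Fin k) → Fin (4 ^ ((j : ℕ) + 1))

theorem DD_fiber {k : ℕ} (s : Fin k → Bool) (j : Fin k) (t : Fin (4 ^ ((j : ℕ) + 1))) :
    (Finset.univ.filter fun d : DD k => d s j = t).card * 4 ^ ((j : ℕ) + 1) =
      Fintype.card (DD k) := by
  classical
  have key : ∀ t' : Fin (4 ^ ((j : ℕ) + 1)),
      (Finset.univ.filter fun d : DD k => d s j = t').card =
      (Finset.univ.filter fun d : DD k => d s j = t).card := by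
    intro t'
    apply Finset.card_bij (fun d _ => d + Pi.single s (Pi.single j (t - t')))
    · intro d hd
      simp only [Finset.mem_filter, Finset.mem_univ, true_and] at hd ⊢
      simp [hd]
    · intro a _ b _ h
      exact add_right_cancel h
    · intro b hb
      refine ⟨b - Pi.single s (Pi.single j (t - t')), ?_, by simp⟩
      simp only [Finset.mem_filter, Finset.mem_univ, true_and] at hb ⊢
      simp [hb]
  have := Finset.card_eq_sum_card_fiberwise (s := (Finset.univ : Finset (DD k)))
    (t := Finset.univ) (f := fun d => d s j) (fun _ _ => Finset.mem_univ _)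
  rw [Finset.sum_congr rfl (fun t' _ => key t')] at this
  simp only [Finset.sum_const, Finset.card_univ, Fintype.card_fin, smul_eq_mul] at this
  rw [mul_comm]; exact this.symm

theorem DD_indep {ι Z : Type*} [Finite ι] [Finite Z] (P : Set ι) (A B : Set (ι → Z))
    (hA : ∀ d d' : ι → Z, (∀ i ∈ P, d i = d' i) → (d ∈ A → d' ∈ A))
    (hB : ∀ d d' : ι → Z, (∀ i ∉ P, d i = d' i) → (d ∈ B → d' ∈ B)) :
    A.ncard * B.ncard = (A ∩ B).ncard * Nat.card (ι → Z) := by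
  classical
  rw [← Set.ncard_univ, ← Set.ncard_prod, ← Set.ncard_prod]
  let mix : (ι → Z) → (ι → Z) → (ι → Z) := fun d d' i => if i ∈ P then d i else d' i
  have mm : ∀ x y, mix (mix x y) (mix y x) = x := by
    intro x y; funext i; by_cases h : i ∈ P <;> simp [mix, h]
  refine Set.ncard_congr (fun q _ => (mix q.1 q.2, mix q.2 q.1)) ?_ ?_ ?_
  · intro q hq
    exact ⟨⟨hA q.1 _ (fun i hi => by simp [mix, hi]) hq.1,
      hB q.2 _ (fun i hi => by simp [mix, hi]) hq.2⟩, trivial⟩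
  · intro q q' _ _ h
    have h1 := congrArg Prod.fst h
    have h2 := congrArg Prod.snd h
    simp only at h1 h2
    apply Prod.ext
    · rw [← mm q.1 q.2, h1, h2, mm]
    · rw [← mm q.2 q.1, h1, h2, mm]
  · intro q hq
    exact ⟨(mix q.1 q.2, mix q.2 q.1), ⟨hA q.1 _ (fun i hi => by simp [mix, hi]) hq.1.1,
      hB q.1 _ (fun i hi => by simp [mix, hi]) hq.1.2⟩, by simp [mm]⟩

structure Model where
  μ : Set ℕ → ℝ≥0
  L : ℕ → ℕ
  X : (ℕ → Bool) → ℕ → ℕ → ℕ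
  dep : Set (ℕ → Bool) → Set ℕ → Prop
  mu_univ : μ Set.univ = 1
  mu_add : ∀ A B, Disjoint A B → μ (A ∪ B) = μ A + μ B
  mu_fin : ∀ A, A.Finite → μ A = 0
  L_fin : ∀ j, {m | L m ≤ j}.Finite
  X_lt : ∀ f m j, X f m j < 4 ^ (j + 1)
  dep_mono : ∀ a b E, a ⊆ b → dep a E → dep b E
  dep_inter : ∀ a E E', dep a E → dep a E' → dep a (E ∩ E')
  dep_univ : ∀ a, dep a Set.univ
  indep : ∀ a b E E', a.Finite → b.Finite → Disjoint a b → dep a E → dep b E' →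
    μ (E ∩ E') = μ E * μ E'
  W_spec : ∀ (f : ℕ → Bool) (n : ℕ) (A : ℕ → Finset ℕ), (∀ j, n ≤ j → (A j).card ≤ n) →
    dep {f} {m | ∀ j, n ≤ j → j < L m → X f m j ∉ A j} ∧
    0 < μ {m | ∀ j, n ≤ j → j < L m → X f m j ∉ A j}
  small : ∀ f j t, μ {m | X f m j = t} ≤ 1 / 4 ^ (j + 1)

noncomputable def fr (e : ℕ ≃ (Σ k, DD k)) (A : Set ℕ) (k : ℕ) : ℝ≥0 :=
  ({d : DD k | e.symm ⟨k, d⟩ ∈ A}.ncard : ℝ≥0) / Fintype.card (DD k)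

theorem fr_eq (e : ℕ ≃ (Σ k, DD k)) (A : Set ℕ) (k : ℕ)
    [DecidablePred fun d : DD k => e.symm ⟨k, d⟩ ∈ A] : fr e A k =
  ((Finset.univ.filter fun d : DD k => e.symm ⟨k, d⟩ ∈ A).card : ℝ≥0) / Fintype.card (DD k) := by
  unfold fr
  rw [← Set.ncard_coe_finset]
  congr 3
  ext d
  simp

theorem num_aux {a b c N : ℕ} (hN : N ≠ 0) (h : a * b = c * N) :
    (c : ℝ≥0) / N = a / N * (b / N) := by
  have hN' : (N : ℝ≥0) ≠ 0 := by exact_mod_cast hN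
  have h' : (a : ℝ≥0) * b = c * N := by exact_mod_cast h
  rw [div_mul_div_comm, h', mul_div_mul_right _ _ hN']

theorem fr_le_one (e A k) : fr e A k ≤ 1 := by
  classical
  rw [fr_eq]
  apply div_le_one_of_le₀ _ (by positivity)
  exact_mod_cast Finset.card_le_univ _

theorem fr_univ (e k) : fr e Set.univ k = 1 := by
  classical
  rw [fr_eq]
  have : (Fintype.card (DD k) : ℝ≥0) ≠ 0 := by exact_mod_cast Fintype.card_ne_zero
  simp only [Set.mem_univ, Finset.filter_true, Finset.card_univ]
  exact div_self this

theorem fr_add (e) (A B : Set ℕ) (h : Disjoint A B) (k) :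
    fr e (A ∪ B) k = fr e A k + fr e B k := by
  classical
  rw [fr_eq, fr_eq, fr_eq]
  rw [← add_div, ← Nat.cast_add, ← Finset.card_union_of_disjoint]
  · congr 3
    ext d
    simp
  · rw [Finset.disjoint_filter]
    intro d _ h1 h2
    exact Set.disjoint_left.1 h h1 h2

theorem fr_indep (e) (A B : Set ℕ) (k) (P : Set (Fin k → Bool))
    (hA : ∀ d d' : DD k, (∀ i ∈ P, d i = d' i) → (e.symm ⟨k, d⟩ ∈ A → e.symm ⟨k, d'⟩ ∈ A))
    (hB : ∀ d d' : DD k, (∀ i ∉ P, d i = d' i) → (e.symm ⟨k, d⟩ ∈ B → e.symm ⟨k, d'⟩ ∈ B)) :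
    fr e (A ∩ B) k = fr e A k * fr e B k := by
  have := DD_indep P {d : DD k | e.symm ⟨k, d⟩ ∈ A} {d : DD k | e.symm ⟨k, d⟩ ∈ B} hA hB
  rw [Nat.card_eq_fintype_card] at this
  exact num_aux Fintype.card_ne_zero this

noncomputable def XX (e : ℕ ≃ (Σ k, DD k)) (f : ℕ → Bool) (m j : ℕ) : ℕ :=
  if h : j < (e m).1 then ((e m).2 (fun i => f i) ⟨j, h⟩ : ℕ) else 0

theorem fiber_le {k : ℕ} (s : Fin k → Bool) (j : Fin k) (t : ℕ) :
    ((Finset.univ.filter fun d : DD k => (d s j : ℕ) = t).card : ℝ) ≤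
      Fintype.card (DD k) / 4 ^ ((j : ℕ) + 1) := by
  by_cases ht : t < 4 ^ ((j : ℕ) + 1)
  · have := DD_fiber s j ⟨t, ht⟩
    rw [le_div_iff₀ (by positivity)]
    simp only [Fin.ext_iff] at this
    exact_mod_cast this.le
  · have : (Finset.univ.filter fun d : DD k => (d s j : ℕ) = t) = ∅ := by
      ext d
      simp only [Finset.mem_filter, Finset.mem_univ, true_and, Finset.notMem_empty, iff_false]
      rintro rfl
      exact ht (d s j).2
    rw [this]
    simp only [Finset.card_empty, Nat.cast_zero]
    positivity

theorem XX_symm (e : ℕ ≃ (Σ k, DD k)) (f : ℕ → Bool) (k : ℕ) (d : DD k) (j : ℕ) (h : j < k) :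
    XX e f (e.symm ⟨k, d⟩) j = (d (fun i => f i) ⟨j, h⟩ : ℕ) := by
  unfold XX
  have : ∀ q : (Σ k, DD k), q = ⟨k, d⟩ → (if h : j < q.1 then (q.2 (fun i => f i) ⟨j, h⟩ : ℕ) else 0)
     = (d (fun i => f i) ⟨j, h⟩ : ℕ) := by
    rintro q rfl
    simp [h]
  exact this _ (e.apply_symm_apply _)

theorem fr_small (e f j t k) (h : j < k) : fr e {m | XX e f m j = t} k ≤ 1 / 4 ^ (j + 1) := by
  classical
  have := fiber_le (fun i : Fin k => f i) ⟨j, h⟩ t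
  have h0 : (0 : ℝ≥0) < (Fintype.card (DD k) : ℝ≥0) := by exact_mod_cast Fintype.card_pos
  rw [fr_eq]
  rw [div_le_div_iff₀ h0 (by positivity), ← NNReal.coe_le_coe]
  rw [le_div_iff₀ (by positivity)] at this
  simp only [Set.mem_ofPred_eq, XX_symm e f k _ j h]
  push_cast
  simpa using this

theorem fr_W (e : ℕ ≃ (Σ k, DD k)) (f : ℕ → Bool) (n : ℕ) (A : ℕ → Finset ℕ)
    (hA : ∀ j, n ≤ j → (A j).card ≤ n) (k : ℕ) :
    (1 / 2 : ℝ≥0) ≤ fr e {m | ∀ j, n ≤ j → j < (e m).1 → XX e f m j ∉ A j} k := by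
  classical
  set W := {m | ∀ j, n ≤ j → j < (e m).1 → XX e f m j ∉ A j} with hW
  have hs := fr_add e W Wᶜ disjoint_compl_right k
  rw [Set.union_compl_self, fr_univ] at hs
  have hC : (0 : ℝ) < (Fintype.card (DD k) : ℝ) := by exact_mod_cast Fintype.card_pos
  have hb : (fr e Wᶜ k : ℝ) ≤ 1 / 2 := by
    rw [fr_eq]
    push_cast
    rw [div_le_iff₀ hC]
    have hsub : (Finset.univ.filter fun d : DD k => e.symm ⟨k, d⟩ ∈ Wᶜ) ⊆
        (Finset.univ.filter fun j : Fin k => n ≤ (j : ℕ)).biUnion fun j =>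
          (A j).biUnion fun t => Finset.univ.filter fun d : DD k => (d (fun i => f i) j : ℕ) = t := by
      intro d hd
      simp only [Finset.mem_filter, Finset.mem_univ, true_and, hW, Set.mem_compl_iff,
        Set.mem_ofPred_eq, not_forall, not_not] at hd
      obtain ⟨j, hj, hjk, hx⟩ := hd
      have hjk' : j < k := by simpa using hjk
      rw [XX_symm e f k d j hjk'] at hx
      simp only [Finset.mem_biUnion, Finset.mem_filter, Finset.mem_univ, true_and]
      exact ⟨⟨j, hjk'⟩, hj, _, hx, rfl⟩
    have h1 : ((Finset.univ.filter fun d : DD k => e.symm ⟨k, d⟩ ∈ Wᶜ).card : ℝ) ≤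
        ∑ j ∈ (Finset.univ.filter fun j : Fin k => n ≤ (j : ℕ)), ∑ t ∈ A j,
          ((Finset.univ.filter fun d : DD k => (d (fun i => f i) j : ℕ) = t).card : ℝ) := by
      have := (Finset.card_le_card hsub).trans (Finset.card_biUnion_le.trans
        (Finset.sum_le_sum fun j _ => Finset.card_biUnion_le))
      exact_mod_cast this
    refine h1.trans ?_
    have h2 : ∀ j ∈ (Finset.univ.filter fun j : Fin k => n ≤ (j : ℕ)), ∑ t ∈ A j,
          ((Finset.univ.filter fun d : DD k => (d (fun i => f i) j : ℕ) = t).card : ℝ) ≤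
          Fintype.card (DD k) * ((1 / 2) ^ (j : ℕ) * (1 / 4)) := by
      intro j hj
      have hj : n ≤ (j : ℕ) := by simpa using hj
      refine (Finset.sum_le_sum fun t _ => fiber_le (fun i => f i) j t).trans ?_
      rw [Finset.sum_const, nsmul_eq_mul]
      have h3 : ((A j).card : ℝ) ≤ 2 ^ (j : ℕ) := by
        have : (A j).card ≤ 2 ^ (j : ℕ) := ((hA j hj).trans hj).trans Nat.lt_two_pow_self.le
        exact_mod_cast this
      have h4 : (4 : ℝ) ^ (j : ℕ) = 2 ^ (j : ℕ) * 2 ^ (j : ℕ) := by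
        rw [← mul_pow]; norm_num
      calc ((A j).card : ℝ) * (Fintype.card (DD k) / 4 ^ ((j : ℕ) + 1))
          ≤ 2 ^ (j : ℕ) * (Fintype.card (DD k) / 4 ^ ((j : ℕ) + 1)) := by gcongr
        _ = _ := by
          rw [pow_succ, h4, div_pow]
          field_simp
          try ring
    refine (Finset.sum_le_sum h2).trans ?_
    rw [← Finset.mul_sum, mul_comm]
    gcongr
    have h5 : ∑ j ∈ (Finset.univ.filter fun j : Fin k => n ≤ (j : ℕ)), ((1 / 2 : ℝ) ^ (j : ℕ) * (1 / 4)) ≤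
        ∑ j : Fin k, ((1 / 2 : ℝ) ^ (j : ℕ) * (1 / 4)) :=
      Finset.sum_le_sum_of_subset_of_nonneg (Finset.subset_univ _) (fun _ _ _ => by positivity)
    refine h5.trans ?_
    rw [Fin.sum_univ_eq_sum_range (fun j => ((1 / 2 : ℝ) ^ j * (1 / 4))), ← Finset.sum_mul]
    have := sum_geometric_two_le k
    linarith
  rw [← NNReal.coe_le_coe]
  have hs' : (1 : ℝ) = fr e W k + fr e Wᶜ k := by exact_mod_cast hs
  push_cast
  linarith

theorem exists_model : Nonempty Model := by
  classical
  obtain ⟨den⟩ := nonempty_denumerable (Σ k, DD k)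
  let e : ℕ ≃ (Σ k, DD k) := (Denumerable.eqv (Σ k, DD k)).symm
  let 𝒰 : Ultrafilter ℕ := Filter.hyperfilter ℕ
  have hex : ∀ A : Set ℕ, ∃ r : ℝ≥0, Filter.Tendsto (fr e A) 𝒰 (𝓝 r) := by
    intro A
    obtain ⟨r, _, hr⟩ := (isCompact_Icc (a := (0 : ℝ≥0)) (b := 1)).ultrafilter_le_nhds (𝒰.map (fr e A))
      (by
        rw [Filter.le_principal_iff]
        rw [Ultrafilter.coe_map, Filter.mem_map]
        exact Filter.Eventually.of_forall (f := (𝒰 : Filter ℕ)) fun k : ℕ => ⟨zero_le, fr_le_one e A k⟩)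
    exact ⟨r, hr⟩
  choose μ hμ using hex
  have hlarge : ∀ k₀ : ℕ, ∀ᶠ k in (𝒰 : Filter ℕ), k₀ ≤ k := by
    intro k₀
    have : (𝒰 : Filter ℕ) ≤ Filter.atTop := by
      rw [← Nat.cofinite_eq_atTop]; exact Filter.hyperfilter_le_cofinite
    exact this (Filter.eventually_ge_atTop k₀)
  refine ⟨{
    μ := μ
    L := fun m => (e m).1
    X := XX e
    dep := fun a E => ∀ k, ∀ d d' : DD k, (∀ f ∈ a, d (fun i => f i) = d' (fun i => f i)) →
      e.symm ⟨k, d⟩ ∈ E → e.symm ⟨k, d'⟩ ∈ E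
    mu_univ := ?_
    mu_add := ?_
    mu_fin := ?_
    L_fin := ?_
    X_lt := ?_
    dep_mono := ?_
    dep_inter := ?_
    dep_univ := ?_
    indep := ?_
    W_spec := ?_
    small := ?_ }⟩
  · refine tendsto_nhds_unique (hμ Set.univ) ?_
    simp only [funext (fr_univ e)]
    exact tendsto_const_nhds
  · intro A B h
    refine tendsto_nhds_unique (hμ _) ?_
    rw [funext (fr_add e A B h)]
    exact (hμ A).add (hμ B)
  · intro A hA
    refine tendsto_nhds_unique (hμ _) ?_
    obtain ⟨k₀, hk₀⟩ := (hA.image fun m => (e m).1).bddAbove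
    refine Filter.Tendsto.congr' (f₁ := fun _ => 0) ?_ tendsto_const_nhds
    filter_upwards [hlarge (k₀ + 1)] with k hk
    rw [fr_eq]
    rw [Finset.filter_false_of_mem]
    · simp
    · intro d _ hd
      have := hk₀ ⟨_, hd, rfl⟩
      simp at this
      omega
  · intro j
    have : {m | (e m).1 ≤ j} = e ⁻¹' (⋃ k ∈ Set.Iic j, Set.range (fun d : DD k => (⟨k, d⟩ : Σ k, DD k))) := by
      ext m
      simp only [Set.mem_ofPred_eq, Set.mem_preimage, Set.mem_iUnion, Set.mem_range, Set.mem_Iic,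
        exists_prop]
      constructor
      · intro h
        exact ⟨_, h, (e m).2, rfl⟩
      · rintro ⟨k, hk, d, hd⟩
        rw [← hd]; exact hk
    rw [this]
    apply Set.Finite.preimage e.injective.injOn
    exact (Set.finite_Iic j).biUnion fun k _ => Set.finite_range _
  · intro f m j
    unfold XX
    split_ifs with h
    · exact Fin.is_lt _
    · positivity
  · intro a b E hab h k d d' hd
    exact h k d d' fun f hf => hd f (hab hf)
  · intro a E E' h h' k d d' hd hm
    exact ⟨h k d d' hd hm.1, h' k d d' hd hm.2⟩
  · intros; trivial
  · intro a b E E' ha hb hab hE hE'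
    refine tendsto_nhds_unique (hμ _) ?_
    refine Filter.Tendsto.congr' ?_ ((hμ E).mul (hμ E'))
    have hsep : ∀ f g : ℕ → Bool, f ≠ g → ∀ᶠ k in (𝒰 : Filter ℕ),
        (fun i : Fin k => f i) ≠ (fun i : Fin k => g i) := by
      intro f g hfg
      obtain ⟨i, hi⟩ := Function.ne_iff.1 hfg
      filter_upwards [hlarge (i + 1)] with k hk heq
      exact hi (congrFun heq ⟨i, hk⟩)
    have hall : ∀ᶠ k in (𝒰 : Filter ℕ), ∀ f ∈ a, ∀ g ∈ b,
        (fun i : Fin k => f i) ≠ (fun i : Fin k => g i) := by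
      rw [Filter.eventually_all_finite ha]
      intro f hf
      rw [Filter.eventually_all_finite hb]
      intro g hg
      exact hsep f g fun h => Set.disjoint_left.1 hab hf (h ▸ hg)
    filter_upwards [hall] with k hk
    symm
    apply fr_indep e E E' k {s | ∃ f ∈ a, s = fun i : Fin k => f i}
    · intro d d' hd
      exact hE k d d' fun f hf => hd _ ⟨f, hf, rfl⟩
    · intro d d' hd
      refine hE' k d d' fun g hg => hd _ ?_
      rintro ⟨f, hf, h⟩
      exact hk f hf g hg h.symm
  · intro f n A hA
    constructor
    · intro k d d' hd hm j hj hjk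
      have hjk' : j < k := by simpa using hjk
      have := hm j hj (by simpa using hjk')
      rw [XX_symm e f k _ j hjk'] at this ⊢
      rwa [← hd f rfl]
    · have : (1 / 2 : ℝ≥0) ≤ μ {m | ∀ j, n ≤ j → j < (e m).1 → XX e f m j ∉ A j} :=
        ge_of_tendsto (hμ _) (Filter.Eventually.of_forall fun k => fr_W e f n A hA k)
      exact lt_of_lt_of_le (by positivity) this
  · intro f j t
    refine le_of_tendsto (hμ _) ?_
    filter_upwards [hlarge (j + 1)] with k hk
    exact fr_small e f j t k hk

theorem Model.mu_mono (M : Model) {A B : Set ℕ} (h : A ⊆ B) : M.μ A ≤ M.μ B := by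
  have := M.mu_add A (B \ A) disjoint_sdiff_self_right
  rw [Set.union_sdiff_cancel h] at this
  rw [this]
  exact le_self_add

def Good (M : Model) (F : Set (Set ℕ)) (J : Set (ℕ → Bool)) : Prop :=
  ∀ B : Set (Set ℕ), B.Finite → B ⊆ F → ∀ (a : Set (ℕ → Bool)) (E : Set ℕ), a.Finite →
    Disjoint a J → M.dep a E → 0 < M.μ E → 0 < M.μ (⋂₀ B ∩ E)

def Vset (M : Model) (U : ℕ → Set ℕ) (f : ℕ → Bool) (α : ℕ → ℕ) : Set ℕ :=
  {m | ∀ j, j < M.L m → m ∈ U (j + 1) ∨ M.X f m j ≠ α j}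

def Done (M : Model) (U : ℕ → Set ℕ) (F : Set (Set ℕ)) : Prop :=
  Antitone U → (∃ n, (U n)ᶜ ∈ F) ∨ ((∀ n, U n ∈ F) ∧ ∃ f, ∀ α, Vset M U f α ∈ F)

theorem step (M : Model) (U : ℕ → Set ℕ) (F : Set (Set ℕ)) (J : Set (ℕ → Bool))
    (hG : Good M F J) (hJ : J ≠ Set.univ) :
    ∃ F' J', F ⊆ F' ∧ J ⊆ J' ∧ (J' \ J).Finite ∧ Good M F' J' ∧ Done M U F' := by
  classical
  by_cases hU : Antitone U
  swap
  · exact ⟨F, J, subset_rfl, subset_rfl, by simp, hG, fun h => absurd h hU⟩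
  by_cases hc : ∀ B : Set (Set ℕ), B.Finite → B ⊆ F → ∀ (n : ℕ) (a : Set (ℕ → Bool)) (E : Set ℕ),
      a.Finite → Disjoint a J → M.dep a E → 0 < M.μ E → 0 < M.μ (⋂₀ B ∩ U n ∩ E)
  · obtain ⟨f, hf⟩ := (Set.ne_univ_iff_exists_notMem J).1 hJ
    refine ⟨F ∪ Set.range U ∪ Set.range (Vset M U f), insert f J,
      fun x hx => Or.inl (Or.inl hx), Set.subset_insert _ _,
      (Set.finite_singleton f).subset ?_, ?_, fun _ => Or.inr ⟨fun n => Or.inl (Or.inr ⟨n, rfl⟩),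
        f, fun α => Or.inr ⟨α, rfl⟩⟩⟩
    · rintro x ⟨rfl | hx, h2⟩
      · rfl
      · exact absurd hx h2
    · intro B hB hBF a E ha haJ hE hEpos
      have hdec : ∃ (B0 : Set (Set ℕ)) (n : ℕ) (Q : Finset (ℕ → ℕ)), B0.Finite ∧ B0 ⊆ F ∧
          ∀ m, m ∈ ⋂₀ B0 → m ∈ U n → (∀ α ∈ Q, m ∈ Vset M U f α) → m ∈ ⋂₀ B := by
        induction B, hB using Set.Finite.induction_on with
        | empty => exact ⟨∅, 0, ∅, Set.finite_empty, by simp, by simp⟩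
        | @insert A B _ hB ih =>
          obtain ⟨B0, n, Q, h1, h2, h3⟩ := ih ((Set.subset_insert _ _).trans hBF)
          rcases hBF (Set.mem_insert A B) with (hA | ⟨n', rfl⟩) | ⟨α, rfl⟩
          · refine ⟨insert A B0, n, Q, h1.insert A, Set.insert_subset hA h2, ?_⟩
            intro m hm hn hQ
            rw [Set.sInter_insert] at hm ⊢
            exact ⟨hm.1, h3 m hm.2 hn hQ⟩
          · refine ⟨B0, max n n', Q, h1, h2, ?_⟩
            intro m hm hn hQ
            rw [Set.sInter_insert]
            exact ⟨hU (le_max_right _ _) hn, h3 m hm (hU (le_max_left _ _) hn) hQ⟩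
          · refine ⟨B0, n, insert α Q, h1, h2, ?_⟩
            intro m hm hn hQ
            rw [Set.sInter_insert]
            exact ⟨hQ α (Finset.mem_insert_self _ _),
              h3 m hm hn fun β hβ => hQ β (Finset.mem_insert_of_mem hβ)⟩
      obtain ⟨B0, n, Q, h1, h2, h3⟩ := hdec
      let k := max n Q.card
      obtain ⟨hW, hWpos⟩ := M.W_spec f k (fun j => Q.image fun α => α j)
        (fun j _ => Finset.card_image_le.trans (le_max_right _ _))
      set W := {m | ∀ j, k ≤ j → j < M.L m → M.X f m j ∉ Q.image fun α => α j} with hWdef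
      have hfa : Disjoint a {f} := by
        rw [Set.disjoint_singleton_right]
        exact fun h => Set.disjoint_left.1 haJ h (Set.mem_insert _ _)
      have hEW : 0 < M.μ (E ∩ W) := by
        rw [M.indep a {f} E W ha (Set.finite_singleton f) hfa hE hW]
        positivity
      have hdis : Disjoint (a ∪ {f}) J := by
        rw [Set.disjoint_union_left, Set.disjoint_singleton_left]
        exact ⟨haJ.mono_right (Set.subset_insert _ _), hf⟩
      have := hc B0 h1 h2 k (a ∪ {f}) (E ∩ W) (ha.union (Set.finite_singleton f)) hdis
        (M.dep_inter _ _ _ (M.dep_mono _ _ _ Set.subset_union_left hE)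
          (M.dep_mono _ _ _ Set.subset_union_right hW)) hEW
      refine this.trans_le (M.mu_mono ?_)
      rintro m ⟨⟨hmB, hmU⟩, hmE, hmW⟩
      refine ⟨h3 m hmB (hU (le_max_left _ _) hmU) ?_, hmE⟩
      intro α hα j hj
      by_cases hjk : k ≤ j
      · right
        intro h
        exact hmW j hjk hj (Finset.mem_image.2 ⟨α, hα, h.symm⟩)
      · left
        exact hU (by omega) hmU
  · push Not at hc
    obtain ⟨B, hB, hBF, n, a, E, ha, haJ, hE, hEpos, h0⟩ := hc
    refine ⟨insert (U n)ᶜ F, J ∪ a, Set.subset_insert _ _, Set.subset_union_left,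
      ha.subset (by intro x hx; exact hx.1.resolve_left hx.2), ?_, fun _ => Or.inl ⟨n, Set.mem_insert _ _⟩⟩
    intro B' hB' hBF' a' E' ha' haJ' hE' hEpos'
    rw [Set.disjoint_union_right] at haJ'
    have hEE : 0 < M.μ (E' ∩ E) := by
      rw [M.indep a' a E' E ha' ha haJ'.2 hE' hE]
      positivity
    have := hG (B ∪ (B' \ {(U n)ᶜ})) (hB.union (hB'.subset Set.sdiff_subset))
      (Set.union_subset hBF (by rintro x ⟨hx, hx2⟩; exact (hBF' hx).resolve_left hx2))
      (a' ∪ a) (E' ∩ E) (ha'.union ha) (Set.disjoint_union_left.2 ⟨haJ'.1, haJ⟩)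
      (M.dep_inter _ _ _ (M.dep_mono _ _ _ Set.subset_union_left hE')
          (M.dep_mono _ _ _ Set.subset_union_right hE)) hEE
    set Z := ⋂₀ (B ∪ (B' \ {(U n)ᶜ})) ∩ (E' ∩ E) with hZ
    have hsplit := M.mu_add (Z ∩ U n) (Z \ U n) Set.disjoint_sdiff_inter.symm
    rw [Set.inter_union_sdiff] at hsplit
    have hz : M.μ (Z ∩ U n) = 0 := by
      refine le_antisymm ((M.mu_mono ?_).trans h0) zero_le
      rintro m ⟨⟨h1, h2⟩, h3⟩
      exact ⟨⟨fun s hs => h1 s (Or.inl hs), h3⟩, h2.2⟩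
    rw [hz, zero_add] at hsplit
    rw [hsplit] at this
    refine this.trans_le (M.mu_mono ?_)
    rintro m ⟨⟨h1, h2⟩, h3⟩
    refine ⟨fun s hs => ?_, h2.1⟩
    by_cases hs' : s = (U n)ᶜ
    · rw [hs']; exact h3
    · exact h1 s (Or.inr ⟨hs, hs'⟩)

theorem good_iUnion (M : Model) {ι : Type*} [LinearOrder ι] (F : ι → Set (Set ℕ))
    (J : ι → Set (ℕ → Bool)) (hF : Monotone F)
    (h : ∀ i, Good M (F i) (J i)) : Good M (⋃ i, F i) (⋃ i, J i) := by
  intro B hB hBF a E ha haJ hE hpos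
  rcases isEmpty_or_nonempty ι with hi | hi
  · have : B = ∅ := by
      rw [Set.iUnion_of_empty] at hBF
      exact Set.subset_empty_iff.1 hBF
    rw [this]; simpa using hpos
  · lift B to Finset (Set ℕ) using hB
    obtain ⟨i, hi⟩ := hF.directed_le.exists_mem_subset_of_finset_subset_biUnion hBF
    have hB := B.finite_toSet
    exact h i B hB hi a E ha (haJ.mono_right (Set.subset_iUnion J i)) hE hpos


theorem exists_final (M : Model) : ∃ F : Set (Set ℕ), (∀ B : Set (Set ℕ), B.Finite → B ⊆ F →
    0 < M.μ (⋂₀ B)) ∧ ∀ U, Done M U F := by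
  classical
  let I : Type := (Cardinal.continuum.{0}).ord.ToType
  have hcard : Cardinal.mk I = Cardinal.mk (ℕ → Set ℕ) := by
    simp [I]
  obtain ⟨task⟩ : Nonempty (I ≃ (ℕ → Set ℕ)) := Cardinal.eq.1 hcard
  have hg : ∀ (U : ℕ → Set ℕ) (p : Set (Set ℕ) × Set (ℕ → Bool)),
      ∃ p' : Set (Set ℕ) × Set (ℕ → Bool), Good M p.1 p.2 → p.2 ≠ Set.univ →
        p.1 ⊆ p'.1 ∧ p.2 ⊆ p'.2 ∧ (p'.2 \ p.2).Finite ∧ Good M p'.1 p'.2 ∧ Done M U p'.1 := by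
    intro U p
    by_cases h : Good M p.1 p.2 ∧ p.2 ≠ Set.univ
    · obtain ⟨F', J', hh⟩ := step M U p.1 p.2 h.1 h.2
      exact ⟨(F', J'), fun _ _ => hh⟩
    · exact ⟨p, fun h1 h2 => absurd ⟨h1, h2⟩ h⟩
  choose g hg using hg
  let s : I → Set (Set ℕ) × Set (ℕ → Bool) :=
    (wellFounded_lt (α := I)).fix fun t ih =>
      g (task t) (⋃ η : Set.Iio t, (ih η.1 η.2).1, ⋃ η : Set.Iio t, (ih η.1 η.2).2)
  let bel : I → Set (Set ℕ) × Set (ℕ → Bool) := fun t =>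
    (⋃ η : Set.Iio t, (s η.1).1, ⋃ η : Set.Iio t, (s η.1).2)
  have hs : ∀ t, s t = g (task t) (bel t) := by
    intro t
    exact (wellFounded_lt (α := I)).fix_eq _ t
  have main : ∀ t, (bel t).1 ⊆ (s t).1 ∧ (bel t).2 ⊆ (s t).2 ∧ ((s t).2 \ (bel t).2).Finite ∧
      Good M (s t).1 (s t).2 ∧ Done M (task t) (s t).1 := by
    intro t
    induction t using WellFoundedLT.induction with
    | ind t ih =>
      have hgood : Good M (bel t).1 (bel t).2 := by
        apply good_iUnion M (fun η : Set.Iio t => (s η.1).1) (fun η : Set.Iio t => (s η.1).2)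
        · intro a b hab
          rcases hab.eq_or_lt with rfl | hlt
          · exact subset_rfl
          · intro x hx
            exact (ih b.1 b.2).1 (Set.mem_iUnion.2 ⟨⟨a.1, hlt⟩, hx⟩)
        · intro η
          exact (ih η.1 η.2).2.2.2.1
      have hne : (bel t).2 ≠ Set.univ := by
        intro huniv
        have hsub : (bel t).2 ⊆ ⋃ η : Set.Iio t, ((s η.1).2 \ (bel η.1).2) := by
          intro x hx
          obtain ⟨⟨η, hη⟩, hx⟩ := Set.mem_iUnion.1 hx
          have hwf := (wellFounded_lt (α := I)).has_min {η | x ∈ (s η).2} ⟨η, hx⟩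
          obtain ⟨η₀, h1, h2⟩ := hwf
          have hle : η₀ ≤ η := not_lt.1 (h2 η hx)
          refine Set.mem_iUnion.2 ⟨⟨η₀, lt_of_le_of_lt hle hη⟩, h1, ?_⟩
          intro hb
          obtain ⟨⟨η', hη'⟩, hx'⟩ := Set.mem_iUnion.1 hb
          exact h2 η' hx' hη'
        have hlt : Cardinal.mk (⋃ η : Set.Iio t, ((s η.1).2 \ (bel η.1).2) : Set (ℕ → Bool)) <
            Cardinal.continuum := by
          have hI : Cardinal.mk (Set.Iio t) < Cardinal.continuum := by
            have := Cardinal.mk_Iio_lt t (by simp [I])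
            simpa [I] using this
          refine lt_of_le_of_lt (Cardinal.mk_iUnion_le _) ?_
          refine Cardinal.mul_lt_of_lt Cardinal.aleph0_le_continuum hI ?_
          refine lt_of_le_of_lt (ciSup_le' (a := Cardinal.aleph0) fun η => ?_)
            Cardinal.aleph0_lt_continuum
          have := (ih η.1 η.2).2.2.1
          exact (Cardinal.lt_aleph0_iff_set_finite.2 this).le
        have h3 := Cardinal.mk_le_mk_of_subset hsub
        rw [huniv, Cardinal.mk_univ] at h3
        have h4 : Cardinal.mk (ℕ → Bool) = Cardinal.continuum := by simp
        rw [h4] at h3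
        exact absurd hlt (not_lt.2 h3)
      have := hg (task t) (bel t) hgood hne
      rw [hs t]
      exact this
  have hmono : Monotone fun t => (s t).1 := by
    intro a b hab
    rcases hab.eq_or_lt with rfl | hlt
    · exact subset_rfl
    · intro x hx
      exact (main b).1 (Set.mem_iUnion.2 ⟨⟨a, hlt⟩, hx⟩)
  refine ⟨⋃ t, (s t).1, ?_, ?_⟩
  · intro B hB hBF
    have := good_iUnion M (fun t => (s t).1) (fun t => (s t).2) hmono (fun t => (main t).2.2.2.1)
      B hB hBF ∅ Set.univ Set.finite_empty (Set.empty_disjoint _) (M.dep_univ _)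
      (by rw [M.mu_univ]; exact one_pos)
    simpa using this
  · intro U hU
    have h := (main (task.symm U)).2.2.2.2
    rw [task.apply_symm_apply] at h
    rcases h hU with ⟨n, hn⟩ | ⟨h1, f, h2⟩
    · exact Or.inl ⟨n, Set.mem_iUnion.2 ⟨_, hn⟩⟩
    · exact Or.inr ⟨fun n => Set.mem_iUnion.2 ⟨_, h1 n⟩, f, fun α => Set.mem_iUnion.2 ⟨_, h2 α⟩⟩

def hat (A : Set ℕ) : Set OmegaStar := {y | A ∈ y.1}

theorem eq_pure_of_mem {u : Ultrafilter ℕ} {n : ℕ} (h : {n} ∈ u) : u = pure n := by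
  apply Ultrafilter.coe_le_coe.1
  rw [Ultrafilter.coe_pure]
  exact Filter.le_pure_iff.2 h

theorem OmegaStar.finite_notMem (y : OmegaStar) {A : Set ℕ} (hA : A.Finite) : A ∉ y.1 := by
  intro h
  rcases y.1.le_cofinite_or_eq_pure with h1 | ⟨n, h1⟩
  · have h2 : Aᶜ ∈ y.1 := h1 (by simpa using hA)
    exact (Ultrafilter.compl_mem_iff_notMem.1 h2) h
  · exact y.2 n h1

theorem hat_isOpen (A : Set ℕ) : IsOpen (hat A) :=
  (ultrafilter_isOpen_basic A).preimage continuous_subtype_val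

theorem hat_isClosed (A : Set ℕ) : IsClosed (hat A) :=
  (ultrafilter_isClosed_basic A).preimage continuous_subtype_val

instance : T2Space OmegaStar :=
  inferInstanceAs (T2Space {u : Ultrafilter ℕ // ∀ n : ℕ, u ≠ pure n})

instance : CompactSpace OmegaStar := by
  have : IsClosed {u : Ultrafilter ℕ | ∀ n : ℕ, u ≠ pure n} := by
    have h : {u : Ultrafilter ℕ | ∀ n : ℕ, u ≠ pure n} = ⋂ n : ℕ, {u | ({n} : Set ℕ)ᶜ ∈ u} := by
      ext u
      simp only [Set.mem_ofPred_eq, Set.mem_iInter, Ultrafilter.compl_mem_iff_notMem]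
      refine forall_congr' fun n => not_congr ⟨?_, eq_pure_of_mem⟩
      rintro rfl
      exact Set.mem_singleton n
    rw [h]
    exact isClosed_iInter fun n => ultrafilter_isClosed_basic _
  exact isCompact_iff_compactSpace.1 this.isCompact

theorem hat_basis {U : Set OmegaStar} (hU : IsOpen U) {x : OmegaStar} (hx : x ∈ U) :
    ∃ A, x ∈ hat A ∧ hat A ⊆ U := by
  obtain ⟨V, hV, rfl⟩ := isOpen_induced_iff.1 hU
  obtain ⟨_, ⟨A, rfl⟩, h1, h2⟩ := ultrafilterBasis_is_basis.exists_subset_of_mem_open hx hV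
  exact ⟨A, h1, fun y hy => h2 hy⟩

theorem hat_sep {K L : Set OmegaStar} (hK : IsCompact K) (hL : IsClosed L) (h : Disjoint K L) :
    ∃ A, K ⊆ hat A ∧ Disjoint (hat A) L := by
  refine hK.induction_on (p := fun s => ∃ A, s ⊆ hat A ∧ Disjoint (hat A) L) ?_ ?_ ?_ ?_
  · refine ⟨∅, Set.empty_subset _, Set.disjoint_left.2 fun y hy => ?_⟩
    exact absurd hy (OmegaStar.finite_notMem y Set.finite_empty)
  · rintro s t hst ⟨A, h1, h2⟩
    exact ⟨A, hst.trans h1, h2⟩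
  · rintro s t ⟨A, h1, h2⟩ ⟨B, h3, h4⟩
    refine ⟨A ∪ B, Set.union_subset (fun y hy => ?_) (fun y hy => ?_), ?_⟩
    · exact Filter.mem_of_superset (h1 hy) Set.subset_union_left
    · exact Filter.mem_of_superset (h3 hy) Set.subset_union_right
    · rw [Set.disjoint_left] at *
      intro y hy
      rcases Ultrafilter.union_mem_iff.1 hy with h | h
      · exact h2 h
      · exact h4 h
  · intro x hx
    obtain ⟨A, h1, h2⟩ := hat_basis hL.isOpen_compl (Set.disjoint_left.1 h hx)
    exact ⟨hat A, mem_nhdsWithin_of_mem_nhds ((hat_isOpen A).mem_nhds h1), A, subset_rfl,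
      Set.disjoint_left.2 fun y hy => h2 hy⟩

theorem hat_subset {A B : Set ℕ} (h : hat A ⊆ hat B) : (A \ B).Finite := by
  by_contra hinf
  have hinf : (A \ B).Infinite := hinf
  have := Filter.cofinite_inf_principal_neBot_iff.2 hinf
  let u := Ultrafilter.of (Filter.cofinite ⊓ Filter.principal (A \ B))
  have hu : (u : Filter ℕ) ≤ Filter.cofinite ⊓ Filter.principal (A \ B) := Ultrafilter.of_le _
  have hAB : A \ B ∈ u := (hu.trans inf_le_right) (Filter.mem_principal_self _)
  have hfree : ∀ n, u ≠ pure n := by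
    intro n hn
    have h1 : ({n} : Set ℕ)ᶜ ∈ u := (hu.trans inf_le_left) (by simp)
    rw [hn] at h1
    exact h1 rfl
  have hy : (⟨u, hfree⟩ : OmegaStar) ∈ hat A := Filter.mem_of_superset hAB Set.sdiff_subset
  have hB : B ∈ u := h hy
  have : (A \ B) ∩ B ∈ u := Filter.inter_mem hAB hB
  rw [Set.sdiff_inter_self] at this
  exact u.empty_notMem this

theorem Model.mu_union_le (M : Model) (A B : Set ℕ) : M.μ (A ∪ B) ≤ M.μ A + M.μ B := by
  have := M.mu_add A (B \ A) disjoint_sdiff_self_right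
  rw [Set.union_sdiff_self] at this
  rw [this]
  gcongr
  exact M.mu_mono Set.sdiff_subset

noncomputable def lam (M : Model) (K : Set OmegaStar) : ℝ≥0 := sInf (M.μ '' {A | K ⊆ hat A})

theorem lam_le (M : Model) {K : Set OmegaStar} {A : Set ℕ} (h : K ⊆ hat A) : lam M K ≤ M.μ A :=
  csInf_le (OrderBot.bddBelow _) ⟨A, h, rfl⟩

theorem le_lam (M : Model) {K : Set OmegaStar} {r : ℝ≥0} (h : ∀ A, K ⊆ hat A → r ≤ M.μ A) :
    r ≤ lam M K := by
  apply le_csInf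
  · exact ⟨_, Set.univ, fun y _ => Filter.univ_mem, rfl⟩
  · rintro _ ⟨A, hA, rfl⟩
    exact h A hA

theorem exists_lam_lt (M : Model) (K : Set OmegaStar) {ε : ℝ≥0} (hε : 0 < ε) :
    ∃ A, K ⊆ hat A ∧ M.μ A < lam M K + ε := by
  by_contra hcon
  push Not at hcon
  have := le_lam M hcon
  exact absurd this (not_le.2 (lt_add_of_pos_right _ hε))

theorem lam_hat (M : Model) (A : Set ℕ) : lam M (hat A) = M.μ A := by
  apply le_antisymm (lam_le M subset_rfl)
  apply le_lam
  intro B hB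
  calc M.μ A ≤ M.μ ((A \ B) ∪ B) := M.mu_mono (by intro x hx; by_cases h : x ∈ B <;> simp [hx, h])
    _ ≤ M.μ (A \ B) + M.μ B := M.mu_union_le _ _
    _ = M.μ B := by rw [M.mu_fin _ (hat_subset hB), zero_add]

theorem lam_union_le (M : Model) (K L : Set OmegaStar) : lam M (K ∪ L) ≤ lam M K + lam M L := by
  apply _root_.le_of_forall_pos_le_add
  intro ε hε
  obtain ⟨A, hA, hA'⟩ := exists_lam_lt M K (half_pos hε)
  obtain ⟨B, hB, hB'⟩ := exists_lam_lt M L (half_pos hε)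
  have h1 : K ∪ L ⊆ hat (A ∪ B) := Set.union_subset
    (fun y hy => Filter.mem_of_superset (hA hy) Set.subset_union_left)
    (fun y hy => Filter.mem_of_superset (hB hy) Set.subset_union_right)
  calc lam M (K ∪ L) ≤ M.μ A + M.μ B := (lam_le M h1).trans (M.mu_union_le A B)
    _ ≤ (lam M K + ε / 2) + (lam M L + ε / 2) := add_le_add hA'.le hB'.le
    _ = lam M K + lam M L + ε := by rw [add_add_add_comm, add_halves]

noncomputable def cont (M : Model) : Content OmegaStar where
  toFun K := lam M K
  mono' K L h := le_lam M fun A hA => lam_le M (h.trans hA)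
  sup_le' K L := lam_union_le M K L
  sup_disjoint' K L h hK hL := by
    apply le_antisymm (lam_union_le M K L)
    obtain ⟨A, hA, hAL⟩ := hat_sep K.isCompact hL h
    apply le_lam
    intro B hB
    have hKB : (K : Set OmegaStar) ⊆ hat (B ∩ A) := fun y hy =>
      Filter.inter_mem (hB (Or.inl hy)) (hA hy)
    have hLB : (L : Set OmegaStar) ⊆ hat (B \ A) := fun y hy =>
      Filter.inter_mem (hB (Or.inr hy))
        (Ultrafilter.compl_mem_iff_notMem.2 fun h => Set.disjoint_left.1 hAL h hy)
    have := M.mu_add (B ∩ A) (B \ A) Set.disjoint_sdiff_inter.symm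
    rw [Set.inter_union_sdiff] at this
    rw [this]
    exact add_le_add (lam_le M hKB) (lam_le M hLB)

theorem cont_hat (M : Model) (A : Set ℕ) : (cont M).measure (hat A) = M.μ A := by
  rw [Content.measure_apply _ (hat_isOpen A).measurableSet,
    Content.outerMeasure_of_isOpen _ _ (hat_isOpen A),
    Content.innerContent_of_isCompact _ (hat_isClosed A).isCompact (hat_isOpen A)]
  change ((lam M (hat A) : ℝ≥0) : ℝ≥0∞) = _
  rw [lam_hat]

theorem exists_value (M : Model) (u : Ultrafilter ℕ) (f : ℕ → Bool) (j : ℕ) :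
    ∃ t, {m | M.X f m j = t} ∈ u := by
  have h : (⋃ t ∈ Set.Iio (4 ^ (j + 1)), {m | M.X f m j = t}) ∈ u := by
    refine Filter.mem_of_superset Filter.univ_mem fun m _ => ?_
    simp only [Set.mem_iUnion]
    exact ⟨M.X f m j, M.X_lt f m j, rfl⟩
  obtain ⟨t, _, ht⟩ := (Ultrafilter.finite_biUnion_mem_iff (Set.finite_Iio _)).1 h
  exact ⟨t, ht⟩

theorem cont_radon (M : Model) : IsRadon (cont M).measure := by
  have : IsProbabilityMeasure (cont M).measure := by
    constructor
    have : (Set.univ : Set OmegaStar) = hat Set.univ := by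
      ext y
      simp only [Set.mem_univ, true_iff]
      exact Filter.univ_mem (f := (y.1 : Filter ℕ))
    rw [this, cont_hat, M.mu_univ]
    simp
  exact ⟨this, Measure.InnerRegular.innerRegular, inferInstance⟩

theorem cont_singleton (M : Model) (y : OmegaStar) : (cont M).measure {y} = 0 := by
  have hle : ∀ j : ℕ, (cont M).measure {y} ≤ ((1 / 4) ^ (j + 1) : ℝ≥0∞) := by
    intro j
    obtain ⟨t, ht⟩ := exists_value M y.1 (fun _ => true) j
    have h1 : ({y} : Set OmegaStar) ⊆ hat {m | M.X (fun _ => true) m j = t} := by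
      rintro _ rfl
      exact ht
    refine (measure_mono h1).trans ?_
    rw [cont_hat]
    have h2 := M.small (fun _ => true) j t
    have h3 : ((1 / 4 ^ (j + 1) : ℝ≥0) : ℝ≥0∞) = (1 / 4) ^ (j + 1) := by
      rw [← one_div_pow]
      push_cast
      simp
    rw [← h3]
    exact_mod_cast h2
  have hlim : Filter.Tendsto (fun j : ℕ => ((1 / 4) ^ (j + 1) : ℝ≥0∞)) Filter.atTop (𝓝 0) := by
    have h : ((1 : ℝ≥0∞) / 4) < 1 := by
      rw [ENNReal.div_lt_iff (by simp) (by simp)]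
      norm_num
    exact (ENNReal.tendsto_pow_atTop_nhds_zero_of_lt_one h).comp (Filter.tendsto_add_atTop_nat 1)
  exact le_antisymm (ge_of_tendsto' hlim hle) zero_le

/-- There is a weak P-point in `ω*` which is not a μ-point: it lies in the
support of a non-atomic Radon measure vanishing at it. -/
theorem exists_weakPPoint_not_muPoint :
    ∃ x : OmegaStar, IsWeakPPoint x ∧
      ∃ μ : Measure OmegaStar, IsRadon μ ∧ (∀ y : OmegaStar, μ {y} = 0) ∧ μ {x} = 0 ∧
        ∀ U : Set OmegaStar, IsOpen U → x ∈ U → 0 < μ U := by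
  obtain ⟨M⟩ := exists_model
  obtain ⟨F, hF, hD⟩ := exists_final M
  have hne : (Filter.generate F).NeBot := by
    rw [Filter.generate_neBot_iff]
    intro t ht hfin
    rw [Set.nonempty_iff_ne_empty]
    intro h0
    have := hF t hfin ht
    rw [h0, M.mu_fin ∅ Set.finite_empty] at this
    exact lt_irrefl _ this
  let u := Ultrafilter.of (Filter.generate F)
  have hu : (u : Filter ℕ) ≤ Filter.generate F := Ultrafilter.of_le _
  have hFu : ∀ A ∈ F, A ∈ u := fun A hA => hu (Filter.mem_generate_of_mem hA)
  have huF : ∀ A ∈ u, A ∈ F := by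
    intro A hA
    rcases hD (fun _ => A) antitone_const with ⟨_, h⟩ | ⟨h, _⟩
    · exact absurd hA (Ultrafilter.compl_mem_iff_notMem.1 (hFu _ h))
    · exact h 0
  have hpos : ∀ A ∈ u, 0 < M.μ A := by
    intro A hA
    have := hF {A} (Set.finite_singleton A) (Set.singleton_subset_iff.2 (huF A hA))
    simpa using this
  have hfree : ∀ n, u ≠ pure n := by
    intro n hn
    have h1 : ({n} : Set ℕ) ∈ u := by rw [hn]; exact Set.mem_singleton n
    have := hpos _ h1
    rw [M.mu_fin _ (Set.finite_singleton n)] at this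
    exact lt_irrefl _ this
  refine ⟨⟨u, hfree⟩, ?_, (cont M).measure, cont_radon M, cont_singleton M, cont_singleton M _, ?_⟩
  · intro C hC hxC
    rcases C.eq_empty_or_nonempty with rfl | hCne
    · rw [closure_empty]; exact hxC
    obtain ⟨c, rfl⟩ := hC.exists_eq_range hCne
    have hA : ∀ k, ∃ A ∈ u, A ∉ (c k).1 := by
      intro k
      by_contra hcon
      push Not at hcon
      have h1 : ((c k).1 : Filter ℕ) ≤ u := fun A hA => hcon A hA
      exact hxC ⟨k, Subtype.ext (Ultrafilter.coe_le_coe.1 h1)⟩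
    choose A hAu hAc using hA
    let U : ℕ → Set ℕ := fun n => ⋂ k ∈ Set.Iio n, A k
    have hUanti : Antitone U := by
      intro n n' hnn
      exact Set.biInter_subset_biInter_left fun k hk => lt_of_lt_of_le hk hnn
    have hUu : ∀ n, U n ∈ u := fun n =>
      (Filter.biInter_mem (Set.finite_Iio n)).2 fun k _ => hAu k
    have hUc : ∀ k, U (k + 1) ∉ (c k).1 := fun k h =>
      hAc k (Filter.mem_of_superset h (Set.biInter_subset_of_mem (Nat.lt_succ_self k)))
    rcases hD U hUanti with ⟨n, hn⟩ | ⟨_, f, hf⟩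
    · exact absurd (hUu n) (Ultrafilter.compl_mem_iff_notMem.1 (hFu _ hn))
    choose α hα using fun k => exists_value M (c k).1 f k
    intro hcl
    obtain ⟨y, hyV, k, rfl⟩ := mem_closure_iff.1 hcl (hat (Vset M U f α)) (hat_isOpen _)
      (hFu _ (hf α))
    have h1 : {m | M.L m ≤ k}ᶜ ∈ (c k).1 :=
      Ultrafilter.compl_mem_iff_notMem.2 ((c k).finite_notMem (M.L_fin k))
    have h2 : (U (k + 1))ᶜ ∈ (c k).1 := Ultrafilter.compl_mem_iff_notMem.2 (hUc k)
    have h3 := Filter.inter_mem (Filter.inter_mem h1 h2) (Filter.inter_mem (hα k) hyV)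
    obtain ⟨m, ⟨hm1, hm2⟩, hm3, hm4⟩ := Ultrafilter.nonempty_of_mem h3
    rcases hm4 k (not_le.1 hm1) with h | h
    · exact hm2 h
    · exact h hm3
  · intro U hU hx
    obtain ⟨A, hA, hAU⟩ := hat_basis hU hx
    refine lt_of_lt_of_le ?_ (measure_mono hAU)
    rw [cont_hat]
    exact_mod_cast hpos A hA
end

section
/- There is a point x of ω* which is a μ-point but not a weak P-point: for every non-atomic Radon measure μ on ω* there is an open set U ∋ x with μ(U) = 0, yet there is a countable set C ⊆ ω* \ {x} with x ∈ closure(C). -/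
open MeasureTheory Topology ENNReal NNReal

open Filter in
lemma kc_injOn (T : Finset (ℕ → Bool)) :
    ∀ᶠ k in atTop, Set.InjOn (fun (X : ℕ → Bool) (j : Fin k) => X j) (T : Set (ℕ → Bool)) := by
  have h : ∀ X ∈ T, ∀ Y ∈ T, ∀ᶠ k in (atTop : Filter ℕ),
      (fun j : Fin k => X j) = (fun j : Fin k => Y j) → X = Y := by
    intro X _ Y _
    by_cases hXY : X = Y
    · exact Eventually.of_forall fun _ _ => hXY
    · obtain ⟨j, hj⟩ := Function.ne_iff.mp hXY
      filter_upwards [eventually_gt_atTop j] with k hk he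
      exact absurd (congrFun he ⟨j, hk⟩) hj
  have h2 : ∀ᶠ k in (atTop : Filter ℕ), ∀ X ∈ T, ∀ Y ∈ T,
      (fun j : Fin k => X j) = (fun j : Fin k => Y j) → X = Y := by
    rw [Filter.eventually_all_finset]
    intro X hX
    rw [Filter.eventually_all_finset]
    exact h X hX
  filter_upwards [h2] with k hk X hX Y hY he
  exact hk X hX Y hY he

/-- The countable set carrying the independent linked system. -/
abbrev KS : Type := Σ k : ℕ, ((Fin k → Bool) → Finset (Fin k → Bool))

/-- The independent linked system. -/
def KA (i : ℕ → Bool) (n : ℕ) (a : ℕ → Bool) : Set KS :=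
  {x | (x.2 (fun j => i j)).card ≤ n ∧ (fun j : Fin x.1 => a j) ∈ x.2 (fun j => i j)}

lemma KA_mono (i : ℕ → Bool) {m n : ℕ} (h : m ≤ n) (a : ℕ → Bool) : KA i m a ⊆ KA i n a :=
  fun _ hx => ⟨hx.1.trans h, hx.2⟩

lemma KA_finite (i : ℕ → Bool) (n : ℕ) (s : Finset (ℕ → Bool)) (hs : n < s.card) :
    {x : KS | ∀ a ∈ s, x ∈ KA i n a}.Finite := by
  classical
  obtain ⟨k0, hk0⟩ := Filter.eventually_atTop.mp (kc_injOn s)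
  have hfin : (Set.range (fun y : (Σ k : Fin k0, ((Fin k → Bool) → Finset (Fin k → Bool))) =>
      (⟨(y.1 : ℕ), y.2⟩ : KS))).Finite := Set.finite_range _
  refine hfin.subset ?_
  rintro ⟨k, f⟩ hx
  by_cases hk : k < k0
  · exact ⟨⟨⟨k, hk⟩, f⟩, rfl⟩
  · exfalso
    have hinj := hk0 k (not_lt.mp hk)
    have hne : s.Nonempty := Finset.card_pos.mp (by omega)
    obtain ⟨a0, ha0⟩ := hne
    have h1 : (f (fun j => i j)).card ≤ n := (hx a0 ha0).1
    have h2 : s.image (fun (X : ℕ → Bool) (j : Fin k) => X j) ⊆ f (fun j => i j) := by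
      intro b hb
      obtain ⟨a, ha, rfl⟩ := Finset.mem_image.mp hb
      exact (hx a ha).2
    have h3 := Finset.card_le_card h2
    rw [Finset.card_image_of_injOn hinj] at h3
    omega

/-- Finite intersections of the system. -/
def KE (t : Finset (ℕ → Bool)) (σ : (ℕ → Bool) → Finset (ℕ → Bool)) : Set KS :=
  {x | ∀ i ∈ t, ∀ a ∈ σ i, x ∈ KA i (σ i).card a}

lemma KE_infinite (t : Finset (ℕ → Bool)) (σ : (ℕ → Bool) → Finset (ℕ → Bool)) :
    (KE t σ).Infinite := by
  classical
  obtain ⟨k0, hk0⟩ := Filter.eventually_atTop.mp (kc_injOn t)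
  have key : ∀ k : ℕ, ∃ x ∈ KE t σ, x.1 = k0 + k := by
    intro k
    have hinj := hk0 (k0 + k) (Nat.le_add_right _ _)
    refine ⟨⟨k0 + k, fun b => if h : ∃ i ∈ t, (fun j : Fin (k0 + k) => i j) = b then
      (σ h.choose).image (fun (X : ℕ → Bool) (j : Fin (k0 + k)) => X j) else ∅⟩, ?_, rfl⟩
    intro i hi a ha
    have h : ∃ i' ∈ t, (fun j : Fin (k0 + k) => i' j) = (fun j : Fin (k0 + k) => i j) :=
      ⟨i, hi, rfl⟩
    have hc : h.choose = i := hinj h.choose_spec.1 hi h.choose_spec.2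
    constructor
    · simp only [dif_pos h, hc]
      exact Finset.card_image_le
    · simp only [dif_pos h, hc]
      exact Finset.mem_image_of_mem _ ha
  choose g hg hg2 using key
  refine Set.infinite_of_injective_forall_mem (f := g) ?_ hg
  intro a b hab
  have := congrArg Sigma.fst hab
  rw [hg2, hg2] at this
  omega

lemma KE_union {t t' : Finset (ℕ → Bool)} (h : Disjoint t t')
    (σ σ' : (ℕ → Bool) → Finset (ℕ → Bool)) :
    ∃ (t'' : Finset (ℕ → Bool)) (σ'' : (ℕ → Bool) → Finset (ℕ → Bool)),
      (∀ i ∈ t'', i ∈ t ∨ i ∈ t') ∧ KE t'' σ'' = KE t σ ∩ KE t' σ' := by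
  classical
  refine ⟨t ∪ t', fun i => if i ∈ t then σ i else σ' i, fun i hi => by simpa using hi, ?_⟩
  ext x
  constructor
  · intro hx
    refine ⟨fun i hi a ha => ?_, fun i hi a ha => ?_⟩
    · have := hx i (Finset.mem_union_left _ hi) a (by simpa [hi] using ha)
      simpa [hi] using this
    · have hi' : i ∉ t := fun h' => Finset.disjoint_left.mp h h' hi
      have := hx i (Finset.mem_union_right _ hi) a (by simpa [hi'] using ha)
      simpa [hi'] using this
  · rintro ⟨h1, h2⟩ i hi a ha
    by_cases hit : i ∈ t
    · simp only [hit, if_true] at ha ⊢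
      exact h1 i hit a ha
    · simp only [hit, if_false] at ha ⊢
      exact h2 i ((Finset.mem_union.mp hi).resolve_left hit) a ha

/-- The part of the system outside `K` is independent with respect to `F`. -/
def KInd (F : Filter KS) (K : Set (ℕ → Bool)) : Prop :=
  ∀ (t : Finset (ℕ → Bool)) (σ : (ℕ → Bool) → Finset (ℕ → Bool)), (∀ i ∈ t, i ∉ K) →
    ∀ B ∈ F, (B ∩ KE t σ).Nonempty

/-- What a filter has to achieve for the sequence `C`. -/
def KGood (F : Filter KS) (C : ℕ → Set KS) : Prop :=
  (∃ n, (⋂ m ≤ n, C m)ᶜ ∈ F) ∨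
    ∃ D : (ℕ → Bool) → Set KS, (∀ a, D a ∈ F) ∧
      ∀ (n : ℕ) (s : Finset (ℕ → Bool)), n < s.card → ((⋂ a ∈ s, D a) \ C n).Finite

lemma KGood.mono {F F' : Filter KS} (h : F' ≤ F) {C : ℕ → Set KS} (hC : KGood F C) :
    KGood F' C := by
  rcases hC with ⟨n, hn⟩ | ⟨D, hD, hs⟩
  · exact Or.inl ⟨n, h hn⟩
  · exact Or.inr ⟨D, fun a => h (hD a), hs⟩

lemma mem_inf_iInf_principal {X ι : Type*} {G : Filter X} {D : ι → Set X} {B : Set X}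
    (hB : B ∈ G ⊓ ⨅ a, Filter.principal (D a)) :
    ∃ B0 ∈ G, ∃ s : Finset ι, B0 ∩ (⋂ a ∈ s, D a) ⊆ B := by
  obtain ⟨B0, hB0, B1, hB1, rfl⟩ := Filter.mem_inf_iff.mp hB
  obtain ⟨s, hs⟩ := Filter.mem_iInf_finite B1 |>.mp hB1
  refine ⟨B0, hB0, s, ?_⟩
  rw [Filter.iInf_principal_finset, Filter.mem_principal] at hs
  exact Set.inter_subset_inter_right _ hs

lemma kstep (F : Filter KS) (K : Set (ℕ → Bool)) (hF : KInd F K) (hK : Kᶜ.Nonempty)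
    (C : ℕ → Set KS) :
    ∃ (F' : Filter KS) (K' : Set (ℕ → Bool)), F' ≤ F ∧ K ⊆ K' ∧ (K' \ K).Finite ∧
      KInd F' K' ∧ KGood F' C := by
  classical
  by_cases hG : KInd (F ⊓ ⨅ n, Filter.principal (C n)) K
  · obtain ⟨i, hi⟩ := hK
    set G := F ⊓ ⨅ n, Filter.principal (C n) with hGdef
    have hCG : ∀ n, C n ∈ G := fun n =>
      (inf_le_right.trans (iInf_le _ n) : G ≤ Filter.principal (C n)) (Filter.mem_principal_self _)
    have hCG' : ∀ n, (⋂ m ≤ n, C m) ∈ G := fun n =>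
      (Filter.biInter_mem (Set.finite_le_nat n)).mpr fun m _ => hCG m
    let D : (ℕ → Bool) → Set KS := fun a => {x | ∀ n, x ∉ (⋂ m ≤ n + 1, C m) → x ∈ KA i n a}
    refine ⟨G ⊓ ⨅ a, Filter.principal (D a), insert i K, inf_le_left.trans inf_le_left,
      Set.subset_insert _ _, (Set.finite_singleton i).subset ?_, ?_, Or.inr ⟨D, ?_, ?_⟩⟩
    · rintro x ⟨hx1, hx2⟩
      exact hx1.resolve_right hx2
    · intro t σ ht B hB
      obtain ⟨B0, hB0, s, hs⟩ := mem_inf_iInf_principal hB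
      have hdis : Disjoint t {i} := by
        rw [Finset.disjoint_singleton_right]
        exact fun h => ht i h (Set.mem_insert _ _)
      obtain ⟨t'', σ'', h1, h2⟩ := KE_union hdis σ (fun _ => s)
      have ht'' : ∀ j ∈ t'', j ∉ K := by
        intro j hj
        rcases h1 j hj with h | h
        · exact fun h' => ht j h (Set.mem_insert_of_mem _ h')
        · rw [Finset.mem_singleton] at h
          exact h ▸ hi
      obtain ⟨x, ⟨hx1, hx2⟩, hx3⟩ := hG t'' σ'' ht'' _ (Filter.inter_mem hB0 (hCG' s.card))
      rw [h2] at hx3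
      refine ⟨x, hs ⟨hx1, ?_⟩, hx3.1⟩
      simp only [Set.mem_iInter]
      intro a ha n hn
      have hxa := hx3.2 i (Finset.mem_singleton_self _) a ha
      have hle : s.card ≤ n := by
        by_contra hlt
        apply hn
        simp only [Set.mem_iInter] at hx2 ⊢
        exact fun m hm => hx2 m (by omega)
      exact KA_mono i hle a hxa
    · intro a
      exact (inf_le_right.trans (iInf_le _ a) : G ⊓ (⨅ a, Filter.principal (D a)) ≤
        Filter.principal (D a)) (Filter.mem_principal_self _)
    · intro n s hs
      refine (KA_finite i n s hs).subset ?_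
      rintro x ⟨hx1, hx2⟩ a ha
      simp only [Set.mem_iInter] at hx1
      refine hx1 a ha n fun h => hx2 ?_
      simp only [Set.mem_iInter] at h
      exact h n (by omega)
  · unfold KInd at hG
    push Not at hG
    obtain ⟨t, σ, ht, B, hB, hBE⟩ := hG
    obtain ⟨B0, hB0, s, hs⟩ := mem_inf_iInf_principal hB
    refine ⟨F ⊓ Filter.principal (KE t σ), K ∪ t, inf_le_left, Set.subset_union_left,
      t.finite_toSet.subset ?_, ?_, Or.inl ⟨s.sup id, ?_⟩⟩
    · rintro x ⟨hx1, hx2⟩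
      exact hx1.resolve_left hx2
    · intro t' σ' ht' B' hB'
      rw [Filter.mem_inf_principal] at hB'
      have hdis : Disjoint t' t := by
        rw [Finset.disjoint_left]
        exact fun j hj hj' => ht' j hj (Or.inr hj')
      obtain ⟨t'', σ'', h1, h2⟩ := KE_union hdis σ' σ
      have ht'' : ∀ j ∈ t'', j ∉ K := by
        intro j hj
        rcases h1 j hj with h | h
        · exact fun h' => ht' j h (Or.inl h')
        · exact ht j h
      obtain ⟨x, hx1, hx3⟩ := hF t'' σ'' ht'' _ hB'
      rw [h2] at hx3
      exact ⟨x, hx1 hx3.2, hx3.1⟩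
    · rw [Filter.mem_inf_principal]
      filter_upwards [hB0] with x hx hxE hxC
      have : x ∈ B ∩ KE t σ := by
        refine ⟨hs ⟨hx, ?_⟩, hxE⟩
        simp only [Set.mem_iInter] at hxC ⊢
        exact fun a ha => hxC a (Finset.le_sup (f := id) ha)
      rw [hBE] at this
      exact this

lemma kstep_fun : ∃ st : (ℕ → Set KS) → Filter KS × Set (ℕ → Bool) → Filter KS × Set (ℕ → Bool),
    ∀ C s, (st C s).1 ≤ s.1 ∧ s.2 ⊆ (st C s).2 ∧ ((st C s).2 \ s.2).Finite ∧
      (KInd s.1 s.2 → s.2ᶜ.Nonempty → KInd (st C s).1 (st C s).2 ∧ KGood (st C s).1 C) := by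
  have : ∀ C : ℕ → Set KS, ∀ s : Filter KS × Set (ℕ → Bool), ∃ s' : Filter KS × Set (ℕ → Bool),
      s'.1 ≤ s.1 ∧ s.2 ⊆ s'.2 ∧ (s'.2 \ s.2).Finite ∧
      (KInd s.1 s.2 → s.2ᶜ.Nonempty → KInd s'.1 s'.2 ∧ KGood s'.1 C) := by
    rintro C ⟨F, K⟩
    by_cases h : KInd F K ∧ Kᶜ.Nonempty
    · obtain ⟨F', K', h1, h2, h3, h4, h5⟩ := kstep F K h.1 h.2 C
      exact ⟨(F', K'), h1, h2, h3, fun _ _ => ⟨h4, h5⟩⟩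
    · exact ⟨(F, K), le_rfl, subset_rfl, by simp, fun h1 h2 => absurd ⟨h1, h2⟩ h⟩
  choose st hst using this
  exact ⟨st, hst⟩

lemma KInd_cofinite : KInd Filter.cofinite ∅ := by
  intro t σ _ B hB
  by_contra h
  rw [Set.not_nonempty_iff_eq_empty] at h
  refine KE_infinite t σ ((Filter.mem_cofinite.mp hB).subset ?_)
  intro x hx hxB
  have : x ∈ B ∩ KE t σ := ⟨hxB, hx⟩
  rw [h] at this
  exact this

lemma KInd.anti {F F' : Filter KS} {K K' : Set (ℕ → Bool)} (h : KInd F' K) (hF : F' ≤ F)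
    (hK : K ⊆ K') : KInd F K' :=
  fun t σ ht B hB => h t σ (fun i hi hi' => ht i hi (hK hi')) B (hF hB)

lemma KInd_iInf {ι : Type*} (F : ι → Filter KS) (K : ι → Set (ℕ → Bool))
    (hd : Directed (· ≥ ·) F) [Nonempty ι] (h : ∀ i, KInd (F i) (K i)) :
    KInd (⨅ i, F i) (⋃ i, K i) := by
  intro t σ ht B hB
  obtain ⟨i, hi⟩ := (Filter.mem_iInf_of_directed hd B).mp hB
  exact h i t σ (fun j hj hj' => ht j hj (Set.mem_iUnion_of_mem i hj')) B hi

open Cardinal in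
lemma kexists : ∃ F : Filter KS, F ≤ Filter.cofinite ∧ F.NeBot ∧ ∀ C, KGood F C := by
  obtain ⟨st, hst⟩ := kstep_fun
  have hT : #(ℕ → Set KS) = 𝔠 := by
    have : #(Set KS) = 𝔠 := by
      rw [Cardinal.mk_set]
      have : Infinite KS := Infinite.of_injective (fun k => (⟨k, fun _ => ∅⟩ : KS))
        (fun a b h => congrArg Sigma.fst h)
      rw [Cardinal.mk_eq_aleph0 KS, two_power_aleph0]
    rw [← Cardinal.power_def, this]; simp
  let O := (Cardinal.ord 𝔠).ToType
  have hO : #O = 𝔠 := Cardinal.mk_ord_toType _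
  obtain ⟨e⟩ : Nonempty (O ≃ (ℕ → Set KS)) := Cardinal.eq.mp (hO.trans hT.symm)
  have wf : WellFounded ((· < ·) : O → O → Prop) := wellFounded_lt
  let inp : (o : O) → ((o' : O) → o' < o → Filter KS × Set (ℕ → Bool)) →
      Filter KS × Set (ℕ → Bool) := fun o g =>
    (Filter.cofinite ⊓ ⨅ o' : Set.Iio o, (g o'.1 o'.2).1, ⋃ o' : Set.Iio o, (g o'.1 o'.2).2)
  let f : O → Filter KS × Set (ℕ → Bool) := wf.fix (fun o g => st (e o) (inp o g))
  let q : O → Filter KS × Set (ℕ → Bool) := fun o =>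
    (Filter.cofinite ⊓ ⨅ o' : Set.Iio o, (f o').1, ⋃ o' : Set.Iio o, (f o').2)
  have hf : ∀ o, f o = st (e o) (q o) := fun o => wf.fix_eq _ o
  have hle : ∀ o, (f o).1 ≤ (q o).1 := fun o => by rw [hf]; exact (hst _ _).1
  have hsub : ∀ o, (q o).2 ⊆ (f o).2 := fun o => by rw [hf o]; exact (hst _ _).2.1
  have hfin : ∀ o, ((f o).2 \ (q o).2).Finite := fun o => by rw [hf o]; exact (hst _ _).2.2.1
  have hstep : ∀ o, KInd (q o).1 (q o).2 → (q o).2ᶜ.Nonempty →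
      KInd (f o).1 (f o).2 ∧ KGood (f o).1 (e o) := fun o => by
    rw [hf o]; exact (hst _ _).2.2.2
  have hanti : Antitone fun o => (f o).1 := by
    intro a b hab
    rcases hab.eq_or_lt with rfl | h
    · exact le_rfl
    · exact (hle b).trans (inf_le_right.trans (iInf_le (fun o' : Set.Iio b => (f o').1) ⟨a, h⟩))
  have hcof : ∀ o, (f o).1 ≤ Filter.cofinite := fun o => (hle o).trans inf_le_left
  have hcov : ∀ o, (f o).2 ⊆ ⋃ o' : Set.Iic o, ((f o').2 \ (q o').2) := by
    intro o
    induction o using wf.induction with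
    | _ o ih =>
      intro x hx
      by_cases hxq : x ∈ (q o).2
      · obtain ⟨⟨o', ho'⟩, hx'⟩ := Set.mem_iUnion.mp hxq
        obtain ⟨⟨o'', ho''⟩, hx''⟩ := Set.mem_iUnion.mp (ih o' ho' hx')
        exact Set.mem_iUnion.mpr ⟨⟨o'', le_trans (Set.mem_Iic.mp ho'') (le_of_lt (Set.mem_Iio.mp ho'))⟩, hx''⟩
      · exact Set.mem_iUnion.mpr ⟨⟨o, le_refl o⟩, hx, hxq⟩
  have hcov2 : ∀ o, (q o).2 ⊆ ⋃ o' : Set.Iio o, ((f o').2 \ (q o').2) := by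
    intro o x hxq
    obtain ⟨⟨o', ho'⟩, hx'⟩ := Set.mem_iUnion.mp hxq
    obtain ⟨⟨o'', ho''⟩, hx''⟩ := Set.mem_iUnion.mp (hcov o' hx')
    exact Set.mem_iUnion.mpr ⟨⟨o'', lt_of_le_of_lt (Set.mem_Iic.mp ho'') (Set.mem_Iio.mp ho')⟩, hx''⟩
  have hne : ∀ o, (q o).2ᶜ.Nonempty := by
    intro o
    by_contra h
    rw [Set.not_nonempty_iff_eq_empty, Set.compl_empty_iff] at h
    have h1 : #(Set.univ : Set (ℕ → Bool)) = 𝔠 := by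
      rw [Cardinal.mk_univ, ← Cardinal.power_def]; simp
    have h2 := Cardinal.mk_le_mk_of_subset (h ▸ hcov2 o)
    rw [h1] at h2
    have h3 : #(⋃ o' : Set.Iio o, ((f o').2 \ (q o').2) : Set (ℕ → Bool)) ≤
        #(Set.Iio o) * ℵ₀ := by
      refine (Cardinal.mk_iUnion_le _).trans ?_
      gcongr
      refine ciSup_le' fun o' => ?_
      exact ((Cardinal.lt_aleph0_iff_set_finite).mpr (hfin o')).le
    have h4 : #(Set.Iio o) < 𝔠 :=
      lt_of_lt_of_eq (Cardinal.mk_Iio_lt o (by simp [O])) hO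
    exact absurd (h2.trans h3) (not_le.mpr
      (Cardinal.mul_lt_of_lt Cardinal.aleph0_le_continuum h4 Cardinal.aleph0_lt_continuum))
  have hq : ∀ o, KInd (f o).1 (f o).2 ∧ KGood (f o).1 (e o) := by
    intro o
    induction o using wf.induction with
    | _ o ih =>
      refine hstep o ?_ (hne o)
      by_cases hemp : Nonempty (Set.Iio o)
      · have hInd := KInd_iInf (fun o' : Set.Iio o => (f o').1) (fun o' : Set.Iio o => (f o').2)
          (Antitone.directed_ge fun a b hab => hanti hab) (fun o' => (ih o' o'.2).1)
        refine hInd.anti ?_ subset_rfl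
        refine le_inf ?_ le_rfl
        obtain ⟨o'⟩ := hemp
        exact (iInf_le _ o').trans (hcof o')
      · refine KInd_cofinite.anti ?_ (Set.empty_subset _)
        refine le_inf le_rfl (le_iInf fun o' => absurd ⟨o'⟩ hemp)
  have hneO : Nonempty O := ⟨e.symm fun _ => ∅⟩
  refine ⟨⨅ o, (f o).1, (iInf_le _ hneO.some).trans (hcof _), ?_, fun C => ?_⟩
  · refine Filter.neBot_iff.mpr fun hbot => ?_
    have hInd := KInd_iInf (fun o => (f o).1) (fun o => (f o).2)
      (Antitone.directed_ge hanti) (fun o' => (hq o').1)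
    have := hInd ∅ (fun _ => ∅) (by simp) ∅ (by rw [hbot]; exact Filter.mem_bot)
    simp at this
  · have := (hq (e.symm C)).2
    rw [Equiv.apply_symm_apply] at this
    exact this.mono (iInf_le (fun o => (f o).1) _)

/-- Strengthened OK ultrafilter on `ℕ`. -/
def UOK (p : Ultrafilter ℕ) : Prop :=
  ∀ C : ℕ → Set ℕ, (∀ n, C n ∈ p) → ∃ D : (ℕ → Bool) → Set ℕ, (∀ a, D a ∈ p) ∧
      ∀ (n : ℕ) (s : Finset (ℕ → Bool)), n < s.card → ((⋂ a ∈ s, D a) \ C n).Finite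

lemma exists_UOK : ∃ p : Ultrafilter ℕ, (p : Filter ℕ) ≤ Filter.cofinite ∧ UOK p := by
  obtain ⟨F, hF, hne, hgood⟩ := kexists
  have : Infinite KS := Infinite.of_injective (fun k => (⟨k, fun _ => ∅⟩ : KS))
        (fun a b h => congrArg Sigma.fst h)
  obtain ⟨e⟩ : Nonempty (KS ≃ ℕ) := nonempty_equiv_of_countable
  let u : Ultrafilter KS := Ultrafilter.of F
  have hu : (u : Filter KS) ≤ F := Ultrafilter.of_le F
  refine ⟨u.map e, ?_, ?_⟩
  · rw [Ultrafilter.coe_map]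
    exact (Filter.map_mono (hu.trans hF)).trans e.injective.tendsto_cofinite
  · intro C hC
    have hC' : ∀ n, e ⁻¹' (C n) ∈ u := hC
    rcases hgood (fun n => e ⁻¹' (C n)) with ⟨n, hn⟩ | ⟨D, hD, hs⟩
    · exfalso
      have h1 : (⋂ m ≤ n, e ⁻¹' (C m)) ∈ (u : Filter KS) :=
        (Filter.biInter_mem (Set.finite_le_nat n)).mpr fun m _ => hC' m
      have h2 := Filter.inter_mem h1 (hu hn)
      rw [Set.inter_compl_self] at h2
      exact u.empty_notMem h2
    · refine ⟨fun a => e.symm ⁻¹' (D a), fun a => ?_, fun n s hns => ?_⟩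
      · change e ⁻¹' (e.symm ⁻¹' (D a)) ∈ u
        rw [← Set.preimage_comp]
        simpa using hu (hD a)
      · refine ((hs n s hns).image e).subset ?_
        rintro x ⟨hx1, hx2⟩
        refine ⟨e.symm x, ⟨?_, ?_⟩, by simp⟩
        · simpa using hx1
        · simpa using hx2

/-- Finitely additive finite measures vanishing on finite sets. -/
structure FAM {X : Type*} (m : Set X → ENNReal) : Prop where
  mono : ∀ A B, A ⊆ B → m A ≤ m B
  add : ∀ A B, Disjoint A B → m (A ∪ B) = m A + m B
  fin : m Set.univ ≠ ⊤
  null : ∀ A : Set X, A.Finite → m A = 0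

namespace FAM

variable {X : Type*} {m : Set X → ENNReal}

lemma union_le (h : FAM m) (A B : Set X) : m (A ∪ B) ≤ m A + m B := by
  rw [← Set.union_sdiff_self, h.add _ _ Set.disjoint_sdiff_right]
  gcongr
  exact h.mono _ _ Set.sdiff_subset

lemma sum_fiber (h : FAM m) {τ : Type*} (g : X → τ) (B : Set X) (T : Finset τ) :
    m {x | x ∈ B ∧ g x ∈ T} = ∑ c ∈ T, m {x | x ∈ B ∧ g x = c} := by
  classical
  induction T using Finset.induction_on with
  | empty => simpa using h.null ∅ Set.finite_empty
  | insert c T hc ih =>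
    rw [Finset.sum_insert hc, ← ih, ← h.add]
    · congr 1
      ext x
      simp only [Finset.mem_insert, Set.mem_ofPred_eq, Set.mem_union]
      tauto
    · rw [Set.disjoint_left]
      rintro x ⟨_, h1⟩ ⟨_, h2⟩
      exact hc (h1 ▸ h2)

lemma sum_le_mul (h : FAM m) {J : Type*} (s : Finset J) (D : J → Set X) (n : ℕ)
    (hD : ∀ t ⊆ s, n < t.card → ∀ x, ¬ ∀ a ∈ t, x ∈ D a) :
    ∑ a ∈ s, m (D a) ≤ n * m Set.univ := by
  classical
  let g : X → Finset J := fun x => s.filter (fun a => x ∈ D a)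
  have hg : ∀ x, g x ∈ s.powerset := fun x => Finset.mem_powerset.mpr (Finset.filter_subset _ _)
  have h1 : ∀ B : Set X, m B = ∑ c ∈ s.powerset, m {x | x ∈ B ∧ g x = c} := by
    intro B
    rw [← h.sum_fiber g B]
    congr 1
    ext x
    exact ⟨fun hx => ⟨hx, hg x⟩, fun hx => hx.1⟩
  have h2 : ∀ a ∈ s, ∀ c ∈ s.powerset,
      m {x | x ∈ D a ∧ g x = c} = if a ∈ c then m {x | x ∈ Set.univ ∧ g x = c} else 0 := by
    intro a ha c hc
    split_ifs with hac
    · congr 1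
      ext x
      simp only [Set.mem_ofPred_eq, Set.mem_univ, true_and, and_iff_right_iff_imp]
      rintro rfl
      exact (Finset.mem_filter.mp hac).2
    · have : {x | x ∈ D a ∧ g x = c} = ∅ := by
        rw [Set.eq_empty_iff_forall_notMem]
        rintro x ⟨hx, rfl⟩
        exact hac (Finset.mem_filter.mpr ⟨ha, hx⟩)
      rw [this]
      exact h.null ∅ Set.finite_empty
  calc ∑ a ∈ s, m (D a)
      = ∑ a ∈ s, ∑ c ∈ s.powerset, if a ∈ c then m {x | x ∈ Set.univ ∧ g x = c} else 0 :=
        Finset.sum_congr rfl fun a ha => (h1 _).trans (Finset.sum_congr rfl (h2 a ha))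
    _ = ∑ c ∈ s.powerset, ∑ a ∈ s, if a ∈ c then m {x | x ∈ Set.univ ∧ g x = c} else 0 :=
        Finset.sum_comm
    _ ≤ ∑ c ∈ s.powerset, (n : ENNReal) * m {x | x ∈ Set.univ ∧ g x = c} := by
        refine Finset.sum_le_sum fun c hc => ?_
        rw [← Finset.sum_filter, Finset.sum_const, nsmul_eq_mul]
        by_cases hcn : n < c.card
        · have : {x | x ∈ Set.univ ∧ g x = c} = ∅ := by
            rw [Set.eq_empty_iff_forall_notMem]
            rintro x ⟨-, rfl⟩
            exact hD _ (Finset.filter_subset _ _) hcn x fun a ha => (Finset.mem_filter.mp ha).2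
          rw [this, h.null ∅ Set.finite_empty]
          simp
        · gcongr
          refine le_trans (Finset.card_le_card ?_) (not_lt.mp hcn)
          intro a ha
          exact (Finset.mem_filter.mp ha).2
    _ = n * m Set.univ := by rw [← Finset.mul_sum, ← h1]

end FAM

/-- `p` avoids all finitely additive measures. -/
def UGood (p : Ultrafilter ℕ) : Prop :=
  ∀ m : Set ℕ → ENNReal, FAM m → (∀ ε > 0, ∃ B ∈ p, m B < ε) → ∃ B ∈ p, m B = 0

lemma UOK.good {p : Ultrafilter ℕ} (hp : UOK p) : UGood p := by
  classical
  intro m hm hsmall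
  by_contra hcon
  push Not at hcon
  have hC : ∀ n : ℕ, ∃ B ∈ p, m B < ((n : ENNReal) + 1)⁻¹ := fun n =>
    hsmall _ (by simp)
  choose C hCp hCm using hC
  obtain ⟨D, hD, hs⟩ := hp C hCp
  have hk : ∃ k : ℕ, {a | ((k : ENNReal) + 1)⁻¹ ≤ m (D a)}.Infinite := by
    by_contra hno
    push Not at hno
    have hun : (Set.univ : Set (ℕ → Bool)) ⊆ ⋃ k : ℕ, {a | ((k : ENNReal) + 1)⁻¹ ≤ m (D a)} := by
      intro a _
      obtain ⟨k, hk⟩ := ENNReal.exists_inv_nat_lt (hcon _ (hD a))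
      refine Set.mem_iUnion.mpr ⟨k, le_trans ?_ hk.le⟩
      exact ENNReal.inv_le_inv.mpr le_self_add
    have hc : (Set.univ : Set (ℕ → Bool)).Countable :=
      (Set.countable_iUnion fun k => (Set.Finite.countable (by simpa using hno k))).mono hun
    have : Cardinal.mk (ℕ → Bool) ≤ Cardinal.aleph0 := by
      rw [Cardinal.mk_le_aleph0_iff]
      exact Set.countable_univ_iff.mp hc
    rw [← Cardinal.power_def] at this
    simp at this
    exact absurd this (not_le.mpr Cardinal.aleph0_lt_continuum)
  obtain ⟨k, hk⟩ := hk
  set n : ℕ := 2 * k + 1 with hn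
  have key : ∀ N : ℕ, (N : ENNReal) * ((k : ENNReal) + 1)⁻¹ ≤
      n * m Set.univ + N * ((n : ENNReal) + 1)⁻¹ := by
    intro N
    obtain ⟨s, hsk, rfl⟩ := hk.exists_subset_card_eq N
    let V : Set ℕ := ⋃ t ∈ s.powerset.filter (fun t => n < t.card), ((⋂ a ∈ t, D a) \ C n)
    have hV : V.Finite := by
      refine Set.Finite.biUnion (Finset.finite_toSet _) ?_
      intro t ht
      have ht' := Finset.mem_filter.mp (Finset.mem_coe.mp ht)
      exact hs n t ht'.2
    have hU : m (C n ∪ V) ≤ ((n : ENNReal) + 1)⁻¹ := by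
      refine (hm.union_le _ _).trans ?_
      rw [hm.null V hV, add_zero]
      exact (hCm n).le
    have h1 := hm.sum_le_mul s (fun a => D a \ (C n ∪ V)) n (by
      intro t hts htc x hx
      have hne : t.Nonempty := Finset.card_pos.mp (by omega)
      obtain ⟨a0, ha0⟩ := hne
      have hx0 := (hx a0 ha0).2
      refine hx0 (Or.inr ?_)
      refine Set.mem_biUnion (x := t) (by simpa using ⟨hts, htc⟩) ⟨?_, fun h => hx0 (Or.inl h)⟩
      simp only [Set.mem_iInter]
      exact fun a ha => (hx a ha).1)
    calc (s.card : ENNReal) * ((k : ENNReal) + 1)⁻¹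
        = ∑ a ∈ s, ((k : ENNReal) + 1)⁻¹ := by simp
      _ ≤ ∑ a ∈ s, (m (D a \ (C n ∪ V)) + ((n : ENNReal) + 1)⁻¹) := by
          refine Finset.sum_le_sum fun a ha => ?_
          have h2 : ((k : ENNReal) + 1)⁻¹ ≤ m (D a) := hsk ha
          refine h2.trans ((hm.mono _ ((D a \ (C n ∪ V)) ∪ (C n ∪ V)) ?_).trans
            ((hm.union_le _ _).trans (by gcongr)))
          rw [Set.sdiff_union_self]
          exact Set.subset_union_left
      _ = ∑ a ∈ s, m (D a \ (C n ∪ V)) + s.card * ((n : ENNReal) + 1)⁻¹ := by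
          rw [Finset.sum_add_distrib]; simp
      _ ≤ _ := by gcongr
  lift m Set.univ to NNReal using hm.fin with M hM
  have key2 : ∀ N : ℕ, (N : ℝ) * ((k : ℝ) + 1)⁻¹ ≤ n * M + N * ((n : ℝ) + 1)⁻¹ := by
    intro N
    have h := key N

    have hk1 : ((k : ENNReal) + 1)⁻¹ = (((k : NNReal) + 1)⁻¹ : NNReal) := by
      rw [ENNReal.coe_inv (by positivity)]; simp
    have hn1 : ((n : ENNReal) + 1)⁻¹ = (((n : NNReal) + 1)⁻¹ : NNReal) := by
      rw [ENNReal.coe_inv (by positivity)]; simp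
    rw [hk1, hn1] at h
    have h' : (N : NNReal) * ((k : NNReal) + 1)⁻¹ ≤ n * M + N * ((n : NNReal) + 1)⁻¹ := by
      exact_mod_cast h
    exact_mod_cast h'
  obtain ⟨N, hN⟩ := exists_nat_gt ((n : ℝ) * M * (2 * ((k : ℝ) + 1)))
  have h := key2 N
  have hnk : ((n : ℝ) + 1) = 2 * ((k : ℝ) + 1) := by rw [hn]; push_cast; ring
  rw [hnk] at h
  have hkpos : (0 : ℝ) < (k : ℝ) + 1 := by positivity
  have e1 : (N : ℝ) * ((k : ℝ) + 1)⁻¹ * (2 * ((k : ℝ) + 1)) = 2 * N := by field_simp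
  have e2 : (N : ℝ) * (2 * ((k : ℝ) + 1))⁻¹ * (2 * ((k : ℝ) + 1)) = N := by field_simp
  have := mul_le_mul_of_nonneg_right h (by positivity : (0 : ℝ) ≤ 2 * ((k : ℝ) + 1))
  rw [add_mul, e1, e2] at this
  linarith

open Filter in
lemma UGood.prod {p : Ultrafilter ℕ} (hp : UGood p) (hfree : (p : Filter ℕ) ≤ Filter.cofinite)
    (m : Set (ℕ × ℕ) → ENNReal) (hm : FAM m)
    (h0 : ∀ n : ℕ, ∀ ε > 0, ∃ B ∈ p, m ((fun k => (n, k)) '' B) < ε)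
    (hq : ∀ ε > 0, ∃ W : Set (ℕ × ℕ), {n | {k | (n, k) ∈ W} ∈ p} ∈ p ∧ m W < ε) :
    ∃ W : Set (ℕ × ℕ), {n | {k | (n, k) ∈ W} ∈ p} ∈ p ∧ m W = 0 := by
  classical
  have hB : ∀ n, ∃ B ∈ p, m ((fun k => (n, k)) '' B) = 0 := by
    intro n
    refine hp (fun B => m ((fun k => (n, k)) '' B)) ⟨?_, ?_, ?_, ?_⟩ (h0 n)
    · exact fun A B h => hm.mono _ _ (Set.image_mono h)
    · intro A B h
      rw [Set.image_union, hm.add]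
      exact (Set.disjoint_image_iff (fun a b h => (Prod.mk.inj h).2)).mpr h
    · exact ne_top_of_le_ne_top hm.fin (hm.mono _ _ (Set.subset_univ _))
    · exact fun A hA => hm.null _ (hA.image _)
  choose B hBp hB0 using hB
  let WW : Type := {W : Set (ℕ × ℕ) // ∀ n, {k | (n, k) ∈ W} ∈ p}
  let m' : Set ℕ → ENNReal := fun S => ⨅ W : WW, m {x | x ∈ W.1 ∧ x.1 ∈ S}
  let W0 : Set (ℕ × ℕ) := {x | x.2 ∈ B x.1}
  have hW0 : ∀ n, {k | (n, k) ∈ W0} ∈ p := hBp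
  have hW0f : ∀ S : Set ℕ, S.Finite → m {x | x ∈ W0 ∧ x.1 ∈ S} = 0 := by
    intro S hS
    induction S, hS using Set.Finite.induction_on with
    | empty => simpa using hm.null ∅ Set.finite_empty
    | @insert a S _ _ ih =>
      have : {x | x ∈ W0 ∧ x.1 ∈ insert a S} ⊆
          ((fun k => (a, k)) '' (B a)) ∪ {x | x ∈ W0 ∧ x.1 ∈ S} := by
        rintro ⟨x, y⟩ ⟨h1, h2⟩
        rcases h2 with h2 | h2
        · left
          dsimp only at h2
          subst h2
          exact ⟨y, h1, rfl⟩
        · exact Or.inr ⟨h1, h2⟩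
      have h2 := (hm.mono _ _ this).trans (hm.union_le _ _)
      rw [hB0, ih, add_zero] at h2
      exact le_antisymm h2 zero_le
  have hm' : FAM m' := by
    refine ⟨?_, ?_, ?_, ?_⟩
    · exact fun S T h => iInf_mono fun W => hm.mono _ _ fun x hx => ⟨hx.1, h hx.2⟩
    · intro S T hST
      have hadd : ∀ W : WW, m {x | x ∈ W.1 ∧ x.1 ∈ S ∪ T} =
          m {x | x ∈ W.1 ∧ x.1 ∈ S} + m {x | x ∈ W.1 ∧ x.1 ∈ T} := by
        intro W
        rw [← hm.add]
        · congr 1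
          ext x
          simp only [Set.mem_ofPred_eq, Set.mem_union]
          tauto
        · rw [Set.disjoint_left]
          exact fun x hx hx' => Set.disjoint_left.mp hST hx.2 hx'.2
      change (⨅ W : WW, m {x | x ∈ W.1 ∧ x.1 ∈ S ∪ T}) = _
      simp_rw [hadd]
      refine (ENNReal.iInf_add_iInf ?_).symm
      intro W1 W2
      refine ⟨⟨W1.1 ∩ W2.1, fun n => inter_mem (W1.2 n) (W2.2 n)⟩, add_le_add ?_ ?_⟩
      · exact hm.mono _ _ fun x hx => ⟨hx.1.1, hx.2⟩
      · exact hm.mono _ _ fun x hx => ⟨hx.1.2, hx.2⟩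
    · exact ne_top_of_le_ne_top hm.fin ((iInf_le _ (⟨W0, hW0⟩ : WW)).trans
        (hm.mono _ _ (Set.subset_univ _)))
    · intro S hS
      refine le_antisymm ?_ zero_le
      rw [← hW0f S hS]
      exact iInf_le (fun W : WW => m {x | x ∈ W.1 ∧ x.1 ∈ S}) ⟨W0, hW0⟩
  have hsm : ∀ ε > 0, ∃ S ∈ p, m' S < ε := by
    intro ε hε
    obtain ⟨W, hW, hWm⟩ := hq ε hε
    refine ⟨_, hW, lt_of_le_of_lt ?_ hWm⟩
    let W' : Set (ℕ × ℕ) := {x | {k | (x.1, k) ∈ W} ∈ p → x ∈ W}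
    have hW' : ∀ n, {k | (n, k) ∈ W'} ∈ p := by
      intro n
      by_cases h : {k | (n, k) ∈ W} ∈ p
      · filter_upwards [h] with k hk _ using hk
      · exact univ_mem' fun k h' => absurd h' h
    refine (iInf_le _ (⟨W', hW'⟩ : WW)).trans (hm.mono _ _ ?_)
    rintro x ⟨h1, h2⟩
    exact h1 h2
  obtain ⟨S, hSp, hS0⟩ := hp m' hm' hsm
  have hW : ∀ j : ℕ, ∃ W : WW, m {x | x ∈ W.1 ∧ x.1 ∈ S} < ((j : ENNReal) + 1)⁻¹ := by
    intro j
    have : m' S < ((j : ENNReal) + 1)⁻¹ := by rw [hS0]; simp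
    exact iInf_lt_iff.mp this
  choose W hWm using hW
  refine ⟨{x | x.1 ∈ S ∧ x ∈ W0 ∧ ∀ j ≤ x.1, x ∈ (W j).1}, ?_, ?_⟩
  · filter_upwards [hSp] with n hn
    have h1 : {k | ∀ j ≤ n, (n, k) ∈ (W j).1} ∈ (p : Filter ℕ) := by
      have := (Filter.biInter_mem (Set.finite_le_nat n)).mpr fun j _ => (W j).2 n
      filter_upwards [this] with k hk
      simpa using hk
    filter_upwards [h1, hW0 n] with k hk hk0
    exact ⟨hn, hk0, hk⟩
  · by_contra hne
    obtain ⟨j, hj⟩ := ENNReal.exists_inv_nat_lt hne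
    have hsub : {x : ℕ × ℕ | x.1 ∈ S ∧ x ∈ W0 ∧ ∀ j ≤ x.1, x ∈ (W j).1} ⊆
        {x | x ∈ (W j).1 ∧ x.1 ∈ S} ∪ {x | x ∈ W0 ∧ x.1 ∈ Set.Iio j} := by
      rintro x ⟨h1, h2, h3⟩
      by_cases hx : j ≤ x.1
      · exact Or.inl ⟨h3 j hx, h1⟩
      · exact Or.inr ⟨h2, not_le.mp hx⟩
    have h := (hm.mono _ _ hsub).trans (hm.union_le _ _)
    rw [hW0f _ (Set.finite_Iio j), add_zero] at h
    have h2 : ((j : ENNReal) + 1)⁻¹ ≤ (j : ENNReal)⁻¹ := ENNReal.inv_le_inv.mpr le_self_add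
    exact absurd (h.trans ((hWm j).le.trans h2)) (not_le.mpr hj)

lemma omegaStar_basic_open (A : Set ℕ) : IsOpen {u : OmegaStar | A ∈ u.1} :=
  (ultrafilter_isOpen_basic A).preimage continuous_subtype_val

lemma omegaStar_exists_basic (y : OmegaStar) (U : Set OmegaStar) (hU : IsOpen U) (hy : y ∈ U) :
    ∃ A ∈ y.1, {u : OmegaStar | A ∈ u.1} ⊆ U := by
  obtain ⟨V, hV, rfl⟩ := isOpen_induced_iff.mp hU
  obtain ⟨T, ⟨A, rfl⟩, hyT, hT⟩ :=
    ultrafilterBasis_is_basis.exists_subset_of_mem_open (show y.1 ∈ V from hy) hV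
  exact ⟨A, hyT, fun u hu => hT hu⟩

lemma ultrafilter_ne_pure {p : Ultrafilter ℕ} (hp : (p : Filter ℕ) ≤ Filter.cofinite) (n : ℕ) :
    p ≠ pure n := by
  rintro rfl
  have : ({n}ᶜ : Set ℕ) ∈ (pure n : Ultrafilter ℕ) :=
    hp (Set.finite_singleton n).compl_mem_cofinite
  rw [Ultrafilter.mem_pure] at this
  exact this rfl

lemma omegaStar_finite (u : OmegaStar) {A : Set ℕ} (hA : A.Finite) : A ∉ u.1 := by
  intro h
  obtain ⟨n, _, hn⟩ := Ultrafilter.eq_pure_of_finite_mem hA h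
  exact u.2 n hn

lemma omegaStar_FAM (μ : Measure OmegaStar) [IsProbabilityMeasure μ] :
    FAM (fun W : Set (ℕ × ℕ) => μ {u : OmegaStar | Nat.unpair ⁻¹' W ∈ u.1}) := by
  refine ⟨?_, ?_, ?_, ?_⟩
  · intro A B h
    exact measure_mono fun u hu => Filter.mem_of_superset hu (Set.preimage_mono h)
  · intro A B h
    rw [← measure_union]
    · congr 1
      ext u
      simp only [Set.preimage_union, Set.mem_ofPred_eq, Set.mem_union, Ultrafilter.union_mem_iff]
    · rw [Set.disjoint_left]
      intro u hu hu'
      have := Filter.inter_mem hu hu'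
      rw [← Set.preimage_inter, Set.disjoint_iff_inter_eq_empty.mp h, Set.preimage_empty] at this
      exact u.1.empty_notMem this
    · exact (omegaStar_basic_open _).measurableSet
  · exact measure_ne_top _ _
  · intro A hA
    have : {u : OmegaStar | Nat.unpair ⁻¹' A ∈ u.1} = ∅ := by
      rw [Set.eq_empty_iff_forall_notMem]
      intro u hu
      exact omegaStar_finite u (hA.preimage (Nat.pairEquiv.symm.injective.injOn)) hu
    rw [this, measure_empty]

/-- There is a μ-point in `ω*` which is not a weak P-point. -/
theorem exists_muPoint_not_weakPPoint :
    ∃ x : OmegaStar, IsMuPoint x ∧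
      ∃ C : Set OmegaStar, C.Countable ∧ x ∉ C ∧ x ∈ closure C := by
  obtain ⟨p, hfree, hok⟩ := exists_UOK
  have hgood := hok.good
  -- the points `c n`
  have hcf : ∀ n : ℕ, ((p.map (fun k => Nat.pair n k) : Ultrafilter ℕ) : Filter ℕ) ≤
      Filter.cofinite := by
    intro n
    rw [Ultrafilter.coe_map]
    refine (Filter.map_mono hfree).trans (Function.Injective.tendsto_cofinite ?_)
    intro a b h
    exact (Nat.pair_eq_pair.mp h).2
  let c : ℕ → OmegaStar := fun n => ⟨p.map (fun k => Nat.pair n k), ultrafilter_ne_pure (hcf n)⟩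
  have hc : ∀ n (A : Set ℕ), A ∈ (c n).1 ↔ {k | Nat.pair n k ∈ A} ∈ p := fun n A => Iff.rfl
  -- the point `x`
  let q : Ultrafilter ℕ := p.bind fun n => (c n).1
  have hq : ∀ A : Set ℕ, A ∈ q ↔ {n | {k | Nat.pair n k ∈ A} ∈ p} ∈ p := fun A => Iff.rfl
  have hpfin : ∀ A : Set ℕ, A.Finite → Aᶜ ∈ p := fun A hA => hfree hA.compl_mem_cofinite
  have hqf : (q : Filter ℕ) ≤ Filter.cofinite := by
    intro A hA
    rw [Ultrafilter.mem_coe, hq]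
    exact Filter.univ_mem' fun n => (hc n A).mp (hcf n hA)
  let x : OmegaStar := ⟨q, ultrafilter_ne_pure hqf⟩
  refine ⟨x, ?_, Set.range c, Set.countable_range c, ?_, ?_⟩
  · rintro μ ⟨hprob, -, houter⟩ hna
    have hsmall : ∀ (y : OmegaStar) (ε : ENNReal), ε > 0 →
        ∃ A ∈ y.1, μ {u : OmegaStar | A ∈ u.1} < ε := by
      intro y ε hε
      obtain ⟨U, hyU, hU, hUε⟩ := Set.exists_isOpen_lt_of_lt {y} ε (by rw [hna]; exact hε)
      obtain ⟨A, hA, hAU⟩ := omegaStar_exists_basic y U hU (hyU rfl)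
      exact ⟨A, hA, (measure_mono hAU).trans_lt hUε⟩
    obtain ⟨W, hW, hW0⟩ := hgood.prod hfree _ (omegaStar_FAM μ) (by
      intro n ε hε
      obtain ⟨A, hA, hAε⟩ := hsmall (c n) ε hε
      refine ⟨{k | Nat.pair n k ∈ A}, hA, lt_of_le_of_lt (measure_mono ?_) hAε⟩
      intro u hu
      refine Filter.mem_of_superset hu ?_
      rintro a ⟨k, hk, hka⟩
      have : a = Nat.pair n k := by
        rw [← Nat.pair_unpair a, ← hka]
      rw [this]
      exact hk) (by
      intro ε hε
      obtain ⟨A, hA, hAε⟩ := hsmall x ε hε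
      refine ⟨{z | Nat.pair z.1 z.2 ∈ A}, hA, lt_of_le_of_lt (measure_mono ?_) hAε⟩
      intro u hu
      refine Filter.mem_of_superset hu ?_
      intro a ha
      simpa using ha)
    refine ⟨_, omegaStar_basic_open (Nat.unpair ⁻¹' W), ?_, hW0⟩
    change Nat.unpair ⁻¹' W ∈ q
    rw [hq]
    simpa using hW
  · rintro ⟨n, hn⟩
    have h1 : {a : ℕ | (Nat.unpair a).1 ≠ n} ∈ q := by
      rw [hq]
      filter_upwards [hpfin {n} (Set.finite_singleton n)] with n' hn'
      refine Filter.univ_mem' fun k => ?_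
      simpa using hn'
    have h2 : {a : ℕ | (Nat.unpair a).1 ≠ n} ∈ (c n).1 := by
      rw [hn]; exact h1
    rw [hc] at h2
    simp at h2
  · rw [mem_closure_iff]
    intro U hU hxU
    obtain ⟨A, hA, hAU⟩ := omegaStar_exists_basic x U hU hxU
    have hA' : {n | {k | Nat.pair n k ∈ A} ∈ p} ∈ p := hA
    obtain ⟨n, hn⟩ := p.nonempty_of_mem hA'
    exact ⟨c n, hAU hn, n, rfl⟩
end
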